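/- Let B be a continuous function on ℝⁿ × ℝ × ℝⁿ, let u ∈ C²(B₁(0)) be a strictly convex solution of det D²u = B(x, u(x), Du(x)) in the unit ball B₁(0) ⊂ ℝⁿ, and set B_u(x) = B(x, u(x), Du(x)). Assume there are constants 0 < λ ≤ Λ such that λ ≤ B_u(x) ≤ Λ for all x ∈ B₁(0). Then there exist constants θ > 0 and C > 0, depending only on n, λ, Λ, a positive lower bound σ for the modulus of convexity of u and an upper bound for the modulus of continuity of B_u, such that for all x, y ∈ B_{1/2}(0), with d = |x − y|, |Du(x) − Du(y)| ≤ C d (1 + exp(2θ ∫_d^1 w_{log B_u}(r)/r dr)), where w_{log B_u} is the modulus of continuity of log B_u on B₁(0). -/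

import Mathlib

open Set Metric MeasureTheory RealInnerProductSpace

noncomputable section

/-- The modulus of continuity of a function `F` on a set `D`. -/
noncomputable def modCont {n : ℕ} (D : Set (EuclideanSpace ℝ (Fin n)))
    (F : EuclideanSpace ℝ (Fin n) → ℝ) (r : ℝ) : ℝ :=
  sSup {a : ℝ | ∃ x ∈ D, ∃ y ∈ D, dist x y ≤ r ∧ a = |F x - F y|}

namespace MA

section LinAlg

set_option linter.unusedSectionVars false

variable {E : Type*} [NormedAddCommGroup E] [InnerProductSpace ℝ E] [FiniteDimensional ℝ E]

open Module (finrank)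

/-- A symmetric positive definite endomorphism. -/
def PosDef (A : E →ₗ[ℝ] E) : Prop := A.IsSymmetric ∧ ∀ v, v ≠ 0 → 0 < ⟪A v, v⟫

/-- A symmetric positive semidefinite endomorphism. -/
def PosSemi (A : E →ₗ[ℝ] E) : Prop := A.IsSymmetric ∧ ∀ v, 0 ≤ ⟪A v, v⟫

/-- The linearised Monge-Ampère operator `tr (A⁻¹ B)`. -/
def linMA (A B : E →ₗ[ℝ] E) : ℝ := LinearMap.trace ℝ E (Ring.inverse A * B)

lemma det_adjoint_real (T : E →ₗ[ℝ] E) : LinearMap.det (LinearMap.adjoint T) = LinearMap.det T := by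
  have b := stdOrthonormalBasis ℝ E
  rw [← LinearMap.det_toMatrix b.toBasis, ← LinearMap.det_toMatrix b.toBasis,
    LinearMap.toMatrix_adjoint b b, Matrix.det_conjTranspose]
  simp

lemma PosDef.exists_root {A : E →ₗ[ℝ] E} (h : PosDef A) :
    ∃ S : E →ₗ[ℝ] E, LinearMap.adjoint S * A * S = 1 := by
  let e := h.1.eigenvectorBasis (n := finrank ℝ E) rfl
  let l := h.1.eigenvalues (n := finrank ℝ E) rfl
  have hAe : ∀ i, A (e i) = l i • e i := fun i => h.1.apply_eigenvectorBasis rfl i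
  have hl : ∀ i, 0 < l i := by
    intro i
    have h1 := h.2 (e i) (e.orthonormal.ne_zero i)
    rw [hAe, inner_smul_left, real_inner_self_eq_norm_sq, e.orthonormal.1 i] at h1
    simpa using h1
  let S : E →ₗ[ℝ] E := e.toBasis.constr ℝ (fun i => (Real.sqrt (l i))⁻¹ • e i)
  have hS : ∀ i, S (e i) = (Real.sqrt (l i))⁻¹ • e i := by
    intro i
    have := e.toBasis.constr_basis ℝ (fun i => (Real.sqrt (l i))⁻¹ • e i) i
    rwa [e.coe_toBasis] at this
  refine ⟨S, ?_⟩
  refine e.toBasis.ext fun i => ?_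
  refine ext_inner_right ℝ fun w => ?_
  have : ∀ j, ⟪(LinearMap.adjoint S * A * S) (e i), e j⟫ = ⟪e i, e j⟫ := by
    intro j
    simp only [Module.End.mul_apply, LinearMap.adjoint_inner_left, hS, map_smul, hAe,
      inner_smul_left, inner_smul_right]
    rcases eq_or_ne i j with rfl | hij
    · have h2 := Real.mul_self_sqrt (hl i).le
      have h3 : Real.sqrt (l i) ≠ 0 := (Real.sqrt_pos.2 (hl i)).ne'
      simp
      field_simp
      nlinarith
    · rw [e.orthonormal.2 hij]; simp
  have h4 : (innerₗ E ((LinearMap.adjoint S * A * S) (e i))) = innerₗ E (e i) := by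
    refine e.toBasis.ext fun j => ?_
    exact this j
  have := LinearMap.congr_fun h4 w
  simpa using this

lemma PosDef.det_pos {A : E →ₗ[ℝ] E} (h : PosDef A) : 0 < LinearMap.det A := by
  obtain ⟨S, hS⟩ := h.exists_root
  have := congrArg LinearMap.det hS
  rw [map_mul, map_mul, det_adjoint_real, map_one] at this
  by_contra hneg
  push Not at hneg
  nlinarith [sq_nonneg (LinearMap.det S)]

lemma linMA_eq_trace {A S : E →ₗ[ℝ] E} (hS : LinearMap.adjoint S * A * S = 1) (C : E →ₗ[ℝ] E) :
    linMA A C = LinearMap.trace ℝ E (LinearMap.adjoint S * C * S) := by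
  have h1 : (LinearMap.adjoint S * A) * S = 1 := hS
  have h2 : S * (LinearMap.adjoint S * A) = 1 := by
    rwa [mul_eq_one_comm] at h1
  have h3 : (S * LinearMap.adjoint S) * A = 1 := by rw [mul_assoc]; exact h2
  have h4 : A * (S * LinearMap.adjoint S) = 1 := by
    rwa [mul_eq_one_comm] at h3
  have h5 : Ring.inverse A = S * LinearMap.adjoint S := by
    have : IsUnit A := ⟨⟨A, S * LinearMap.adjoint S, h4, h3⟩, rfl⟩
    calc Ring.inverse A = Ring.inverse A * (A * (S * LinearMap.adjoint S)) := by rw [h4, mul_one]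
      _ = _ := by rw [← mul_assoc, Ring.inverse_mul_cancel A this, one_mul]
  rw [linMA, h5, mul_assoc, mul_assoc, LinearMap.trace_mul_comm, mul_assoc]

/-- Simultaneous diagonalisation of a positive definite and a symmetric form. -/
lemma exists_frame {A B : E →ₗ[ℝ] E} (hA : PosDef A) (hB : B.IsSymmetric) :
    ∃ (ξ : Fin (finrank ℝ E) → E) (l : Fin (finrank ℝ E) → ℝ),
      (∀ i j, ⟪A (ξ i), ξ j⟫ = if i = j then 1 else 0) ∧
      (∀ i j, ⟪B (ξ i), ξ j⟫ = if i = j then l i else 0) ∧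
      LinearMap.det B = LinearMap.det A * ∏ i, l i ∧
      (∀ C, linMA A C = ∑ i, ⟪C (ξ i), ξ i⟫) ∧
      (∀ x p, ⟪p, x⟫ = ∑ i, ⟪ξ i, p⟫ * ⟪A (ξ i), x⟫) ∧ 
      (∀ i, ξ i ≠ 0) ∧ (∀ i, ⟪B (ξ i), ξ i⟫ = l i) := by
  obtain ⟨S, hS⟩ := hA.exists_root
  set M := LinearMap.adjoint S * B * S with hM
  have hMs : M.IsSymmetric := by
    intro x y
    simp only [hM, Module.End.mul_apply, LinearMap.adjoint_inner_left, LinearMap.adjoint_inner_right]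
    exact hB _ _
  let e := hMs.eigenvectorBasis (n := finrank ℝ E) rfl
  let l := hMs.eigenvalues (n := finrank ℝ E) rfl
  have hMe : ∀ i, M (e i) = l i • e i := fun i => hMs.apply_eigenvectorBasis rfl i
  have hon : ∀ i j, ⟪e i, e j⟫ = if i = j then (1:ℝ) else 0 := orthonormal_iff_ite.1 e.orthonormal
  have hdet := congrArg LinearMap.det hS
  rw [map_mul, map_mul, det_adjoint_real, map_one] at hdet
  have hAA : ∀ i j, ⟪A (S (e i)), S (e j)⟫ = if i = j then (1:ℝ) else 0 := by
    intro i j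
    rw [← LinearMap.adjoint_inner_left, ← hon]
    exact congrArg (fun z => ⟪z, e j⟫) (LinearMap.congr_fun hS (e i))
  have hBB : ∀ i j, ⟪B (S (e i)), S (e j)⟫ = if i = j then l i else 0 := by
    intro i j
    rw [← LinearMap.adjoint_inner_left]
    have : (LinearMap.adjoint S) (B (S (e i))) = M (e i) := rfl
    rw [this, hMe, inner_smul_left, hon]
    split_ifs <;> simp
  refine ⟨fun i => S (e i), l, hAA, hBB, ?_, ?_, ?_, ?_, ?_⟩
  · have h1 : LinearMap.det M = ∏ i, l i := by
      have := hMs.det_eq_prod_eigenvalues (n := finrank ℝ E) rfl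
      simpa using this
    rw [← h1, hM, map_mul, map_mul, det_adjoint_real]
    linear_combination (-LinearMap.det B) * hdet
  · intro C
    rw [linMA_eq_trace hS, LinearMap.trace_eq_sum_inner _ e]
    refine Finset.sum_congr rfl fun i _ => ?_
    simp only [Module.End.mul_apply, LinearMap.adjoint_inner_right]
    rw [real_inner_comm]
  · intro x p
    have h2 : S * (LinearMap.adjoint S * A) = 1 := by
      rwa [mul_eq_one_comm] at hS
    have h3 : S ((LinearMap.adjoint S) (A x)) = x := LinearMap.congr_fun h2 x
    conv_lhs => rw [← h3, ← LinearMap.adjoint_inner_left, ← e.sum_inner_mul_inner]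
    refine Finset.sum_congr rfl fun i _ => ?_
    rw [LinearMap.adjoint_inner_left, LinearMap.adjoint_inner_right, real_inner_comm, hA.1]
  · intro i h0
    have := hAA i i
    simp only at h0
    rw [h0] at this
    simp at this
  · intro i
    simpa using hBB i i

lemma linMA_add (A B C : E →ₗ[ℝ] E) : linMA A (B + C) = linMA A B + linMA A C := by
  simp [linMA, mul_add]

lemma linMA_smul (A B : E →ₗ[ℝ] E) (c : ℝ) : linMA A (c • B) = c * linMA A B := by
  simp [linMA]

lemma linMA_self {A : E →ₗ[ℝ] E} (hA : PosDef A) : linMA A A = finrank ℝ E := by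
  obtain ⟨ξ, l, h1, -, -, h4, -⟩ := exists_frame hA hA.1
  rw [h4]
  simp [h1]

lemma linMA_conj (A B : E →ₗ[ℝ] E) (T : E ≃ₗ[ℝ] E) (hA : PosDef A) :
    linMA (LinearMap.adjoint (T : E →ₗ[ℝ] E) * A * (T : E →ₗ[ℝ] E))
      (LinearMap.adjoint (T : E →ₗ[ℝ] E) * B * (T : E →ₗ[ℝ] E))
      = linMA A B := by
  obtain ⟨S, hS⟩ := hA.exists_root
  have hT : (T : E →ₗ[ℝ] E) * (T.symm : E →ₗ[ℝ] E) = 1 := by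
    ext x; simp
  have hadj : LinearMap.adjoint (T.symm : E →ₗ[ℝ] E) * LinearMap.adjoint (T : E →ₗ[ℝ] E) = 1 := by
    have h := congrArg LinearMap.adjoint hT
    have h1 : LinearMap.adjoint ((T : E →ₗ[ℝ] E) * (T.symm : E →ₗ[ℝ] E)) =
      LinearMap.adjoint (T.symm : E →ₗ[ℝ] E) * LinearMap.adjoint (T : E →ₗ[ℝ] E) :=
      LinearMap.adjoint_comp _ _
    have h2 : LinearMap.adjoint (1 : E →ₗ[ℝ] E) = 1 := by
      ext x; refine ext_inner_right ℝ fun y => ?_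
      rw [LinearMap.adjoint_inner_left]; rfl
    rw [← h1, h, h2]
  have key : ∀ C : E →ₗ[ℝ] E, LinearMap.adjoint ((T.symm : E →ₗ[ℝ] E) * S) *
      (LinearMap.adjoint (T : E →ₗ[ℝ] E) * C * (T : E →ₗ[ℝ] E)) * ((T.symm : E →ₗ[ℝ] E) * S) =
      LinearMap.adjoint S * C * S := by
    intro C
    have h1 : LinearMap.adjoint ((T.symm : E →ₗ[ℝ] E) * S) =
      LinearMap.adjoint S * LinearMap.adjoint (T.symm : E →ₗ[ℝ] E) :=
      LinearMap.adjoint_comp _ _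
    calc _ = LinearMap.adjoint S * (LinearMap.adjoint (T.symm : E →ₗ[ℝ] E) *
            LinearMap.adjoint (T : E →ₗ[ℝ] E)) * C * ((T : E →ₗ[ℝ] E) * (T.symm : E →ₗ[ℝ] E)) * S := by
          rw [h1]; simp only [mul_assoc]
      _ = _ := by rw [hadj, hT]; simp only [mul_one]
  rw [linMA_eq_trace (S := (T.symm : E →ₗ[ℝ] E) * S) (by rw [key, hS]), key,
    ← linMA_eq_trace hS]

lemma PosSemi.frame_nonneg {B : E →ₗ[ℝ] E} (hB : PosSemi B) {ξ : Fin (finrank ℝ E) → E}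
    {l : Fin (finrank ℝ E) → ℝ} (h : ∀ i, ⟪B (ξ i), ξ i⟫ = l i) (i) : 0 ≤ l i :=
  h i ▸ hB.2 _

/-- Concavity of `log det`: the linearisation dominates the increment. -/
lemma log_det_sub_le_linMA {A B : E →ₗ[ℝ] E} (hA : PosDef A) (hB : PosDef B) :
    Real.log (LinearMap.det B) - Real.log (LinearMap.det A) ≤ linMA A B - finrank ℝ E := by
  obtain ⟨ξ, l, h1, h2, h3, h4, -, h6, h7⟩ := exists_frame hA hB.1
  have hl : ∀ i, 0 < l i := fun i => by rw [← h7 i]; exact hB.2 _ (h6 i)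
  have hp : 0 < ∏ i, l i := Finset.prod_pos fun i _ => hl i
  rw [h3, Real.log_mul hA.det_pos.ne' hp.ne', Real.log_prod (fun i _ => (hl i).ne'), h4]
  have : ∑ i, Real.log (l i) ≤ ∑ i, (l i - 1) :=
    Finset.sum_le_sum fun i _ => Real.log_le_sub_one_of_pos (hl i)
  simp only [h7]
  simp [Finset.sum_sub_distrib] at this
  linarith

lemma det_le_exp_of_linMA_le {A B : E →ₗ[ℝ] E} (hA : PosDef A) (hB : PosSemi B) {ε : ℝ}
    (h : linMA A B ≤ finrank ℝ E + ε) : LinearMap.det B ≤ LinearMap.det A * Real.exp ε := by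
  obtain ⟨ξ, l, h1, h2, h3, h4, -, h6, h7⟩ := exists_frame hA hB.1
  rw [h3]
  refine mul_le_mul_of_nonneg_left ?_ hA.det_pos.le
  have hl := hB.frame_nonneg h7
  calc ∏ i, l i ≤ ∏ i, Real.exp (l i - 1) :=
        Finset.prod_le_prod (fun i _ => hl i) fun i _ => by
          linarith [Real.add_one_le_exp (l i - 1)]
    _ = Real.exp (∑ i, (l i - 1)) := (Real.exp_sum _ _).symm
    _ ≤ Real.exp ε := by
        apply Real.exp_le_exp.2
        rw [h4] at h
        simp only [h7] at h
        simp [Finset.sum_sub_distrib]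
        linarith

lemma det_nonneg_of_posSemi {B : E →ₗ[ℝ] E} (hB : PosSemi B) : 0 ≤ LinearMap.det B := by
  have hI : PosDef (1 : E →ₗ[ℝ] E) := ⟨fun x y => rfl, fun v hv => real_inner_self_pos.2 hv⟩
  obtain ⟨ξ, l, h1, h2, h3, h4, -, h6, h7⟩ := exists_frame hI hB.1
  rw [h3]
  exact mul_nonneg hI.det_pos.le (Finset.prod_nonneg fun i _ => hB.frame_nonneg h7 i)

lemma det_le_det_of_le {A B : E →ₗ[ℝ] E} (hA : PosDef A) (hB : B.IsSymmetric)
    (h : ∀ v, ⟪A v, v⟫ ≤ ⟪B v, v⟫) : LinearMap.det A ≤ LinearMap.det B := by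
  obtain ⟨ξ, l, h1, h2, h3, h4, -, h6, h7⟩ := exists_frame hA hB
  rw [h3]
  refine le_mul_of_one_le_right hA.det_pos.le ?_
  have hl : ∀ i, 1 ≤ l i := fun i => by
    have := h (ξ i)
    rw [h7, h1] at this
    simpa using this
  calc (1:ℝ) = ∏ _i : Fin (finrank ℝ E), 1 := by simp
    _ ≤ _ := Finset.prod_le_prod (fun _ _ => zero_le_one) fun i _ => hl i

lemma posDef_of_posSemi_of_det_ne_zero {B : E →ₗ[ℝ] E} (hB : PosSemi B)
    (h : LinearMap.det B ≠ 0) : PosDef B := by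
  refine ⟨hB.1, fun v hv => ?_⟩
  have hI : PosDef (1 : E →ₗ[ℝ] E) := ⟨fun x y => rfl, fun v hv => real_inner_self_pos.2 hv⟩
  rcases (hB.2 v).lt_or_eq with h0 | h0
  · exact h0
  exfalso
  have hBv : B v = 0 := by
    by_contra hne
    have hpos : 0 < ⟪B v, B v⟫ := real_inner_self_pos.2 hne
    have hq : ∀ t : ℝ, 0 ≤ 2 * t * ⟪B v, B v⟫ + t ^ 2 * ⟪B (B v), B v⟫ := by
      intro t
      have h1 := hB.2 (v + t • B v)
      have h2 : ⟪B (B v), v⟫ = ⟪B v, B v⟫ := by rw [hB.1]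
      simp only [map_add, map_smul, inner_add_left, inner_add_right, inner_smul_left,
        inner_smul_right, h2] at h1
      simp at h1 h0 ⊢
      nlinarith
    have hc := hB.2 (B v)
    set a := ⟪B v, B v⟫
    set c := ⟪B (B v), B v⟫
    have := hq (-(a / (c + 1)))
    have hc1 : 0 < c + 1 := by linarith
    have e : 2 * (-(a / (c + 1))) * a + (-(a / (c + 1))) ^ 2 * c
      = - (a ^ 2 * (c + 2)) / (c + 1) ^ 2 := by field_simp; ring
    rw [e] at this
    have : 0 < (a ^ 2 * (c + 2)) / (c + 1) ^ 2 := by positivity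
    rw [neg_div] at *
    linarith
  have := LinearMap.bot_lt_ker_of_det_eq_zero (f := B)
  have hk : LinearMap.ker B = ⊥ := by
    have hu : IsUnit (LinearMap.det B) := isUnit_iff_ne_zero.2 h
    have := (LinearMap.equivOfDetNeZero B h).ker
    exact this
  exact hv ((LinearMap.ker_eq_bot'.1 hk) v hBv)

lemma det_smul_id_add_rankOne (ν : E) (m Λ : ℝ) (hm : m ≠ 0) (hν : ‖ν‖ = 1) :
    LinearMap.det (m • (1 : E →ₗ[ℝ] E) + Λ • (LinearMap.toSpanSingleton ℝ E ν ∘ₗ innerₗ E ν)) =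
      m ^ (finrank ℝ E) * (1 + Λ / m) := by
  have : m • (1 : E →ₗ[ℝ] E) + Λ • (LinearMap.toSpanSingleton ℝ E ν ∘ₗ innerₗ E ν) =
      m • LinearMap.transvection (innerₗ E ν) ((Λ / m) • ν) := by
    ext x
    simp [LinearMap.transvection, smul_smul]
    congr 1
    field_simp
  rw [this, LinearMap.det_smul, LinearMap.transvection.det]
  simp [hν]

end LinAlg

section Basics

set_option linter.unusedSectionVars false

open Module (finrank)
open Filter Topology

variable {E : Type*} [NormedAddCommGroup E] [InnerProductSpace ℝ E] [FiniteDimensional ℝ E]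

/-- A function of class `C²` on `Ω` with gradient `G` and Hessian `H`. -/
structure C2On (Ω : Set E) (w : E → ℝ) (G : E → E) (H : E → E →L[ℝ] E) : Prop where
  grad : ∀ x ∈ Ω, HasFDerivAt w (innerSL ℝ (G x)) x
  hess : ∀ x ∈ Ω, HasFDerivAt G (H x) x
  cont : ContinuousOn H Ω

/-- The Bregman distance: the height at `x` above the tangent plane at `y`. -/
def breg (u : E → ℝ) (G : E → E) (x y : E) : ℝ := u x - u y - ⟪G y, x - y⟫

/-- A classical strictly convex function with positive Monge-Ampère determinant on an open
convex set. -/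
structure MASol (Ω : Set E) (u : E → ℝ) (G : E → E) (H : E → E →L[ℝ] E) : Prop
    extends C2On Ω u G H where
  isOpen : IsOpen Ω
  convex : Convex ℝ Ω
  strict : ∀ x ∈ Ω, ∀ y ∈ Ω, x ≠ y → 0 < breg u G x y
  det_pos : ∀ x ∈ Ω, 0 < (H x).det

variable {Ω : Set E} {u w : E → ℝ} {G Gw : E → E} {H Hw : E → E →L[ℝ] E}

lemma breg_self (y : E) : breg u G y y = 0 := by simp [breg]

lemma breg_add_swap (x y : E) : breg u G x y + breg u G y x = ⟪x - y, G x - G y⟫ := by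
  simp only [breg, inner_sub_left, inner_sub_right, real_inner_comm]; ring

lemma breg_three (x y z : E) :
    breg u G x y = breg u G x z + breg u G z y - ⟪x - z, G y - G z⟫ := by
  simp only [breg, inner_sub_left, inner_sub_right, real_inner_comm]; ring

lemma breg_second (x h : E) : breg u G (x + h) x + breg u G (x - h) x =
    u (x + h) + u (x - h) - 2 * u x := by
  simp only [breg, inner_sub_right, inner_add_right]; ring

/-! ### Second derivative test -/

lemma second_deriv_nonneg {φ φ' : ℝ → ℝ} {b : ℝ} (h1 : ∀ᶠ t in 𝓝 (0:ℝ), HasDerivAt φ (φ' t) t)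
    (h2 : HasDerivAt φ' b 0) (hmin : IsLocalMin φ 0) : 0 ≤ b := by
  by_contra hb
  push Not at hb
  have h0 : φ' 0 = 0 := hmin.hasDerivAt_eq_zero h1.self_of_nhds
  have hneg : ∀ᶠ t in 𝓝[≠] (0:ℝ), t⁻¹ • (φ' (0 + t) - φ' 0) < 0 :=
    (hasDerivAt_iff_tendsto_slope_zero.1 h2).eventually_lt_const hb
  rw [eventually_nhdsWithin_iff] at hneg
  obtain ⟨δ, hδ, hall⟩ := Metric.eventually_nhds_iff.1 (hneg.and (h1.and hmin))
  set t := δ / 2 with ht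
  have htpos : 0 < t := by positivity
  have hd : ∀ s ∈ Icc 0 t, dist s 0 < δ := by
    intro s hs
    rw [Real.dist_eq, sub_zero, abs_of_nonneg hs.1]; linarith [hs.2]
  obtain ⟨c, hc, hc'⟩ := exists_hasDerivAt_eq_slope φ φ' htpos
    (fun s hs => ((hall (hd s hs)).2.1).continuousAt.continuousWithinAt)
    (fun s hs => (hall (hd s (Ioo_subset_Icc_self hs))).2.1)
  have h3 := (hall (hd t ⟨htpos.le, le_rfl⟩)).2.2
  have h4 := (hall (hd c (Ioo_subset_Icc_self hc))).1 hc.1.ne'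
  rw [h0, zero_add, sub_zero, smul_eq_mul] at h4
  have h5 : φ' c < 0 := by
    by_contra h6
    push Not at h6
    have := mul_nonneg (inv_nonneg.2 hc.1.le) h6
    linarith
  rw [hc'] at h5
  have : 0 ≤ (φ t - φ 0) / (t - 0) := div_nonneg (by linarith) (by linarith)
  linarith

lemma hasDerivAt_line (x v : E) (t : ℝ) : HasDerivAt (fun s : ℝ => x + s • v) v t := by
  simpa using ((hasDerivAt_id t).smul_const v).const_add x

lemma C2On.deriv_line (hw : C2On Ω w Gw Hw) {x v : E} {t : ℝ} (hx : x + t • v ∈ Ω) :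
    HasDerivAt (fun s : ℝ => w (x + s • v)) ⟪Gw (x + t • v), v⟫ t := by
  exact (hw.grad _ hx).comp_hasDerivAt t (hasDerivAt_line x v t)

lemma C2On.deriv_grad_line (hw : C2On Ω w Gw Hw) {x v : E} {t : ℝ} (hx : x + t • v ∈ Ω) :
    HasDerivAt (fun s : ℝ => Gw (x + s • v)) (Hw (x + t • v) v) t :=
  (hw.hess _ hx).comp_hasDerivAt t (hasDerivAt_line x v t)

lemma C2On.isSymmetric (hw : C2On Ω w Gw Hw) (hΩ : IsOpen Ω) {x : E} (hx : x ∈ Ω) :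
    (Hw x : E →ₗ[ℝ] E).IsSymmetric := by
  intro v v'
  have h1 : ∀ᶠ y in 𝓝 x, HasFDerivAt w ((fun y => innerSL ℝ (Gw y)) y) y := by
    filter_upwards [hΩ.mem_nhds hx] with y hy using hw.grad y hy
  have h2 : HasFDerivAt (fun y => innerSL ℝ (Gw y)) ((innerSL ℝ).comp (Hw x)) x :=
    (innerSL ℝ).hasFDerivAt.comp x (hw.hess x hx)
  have := second_derivative_symmetric_of_eventually h1 h2 v v'
  simp only [ContinuousLinearMap.comp_apply, innerSL_apply_apply] at this
  simp only [ContinuousLinearMap.coe_coe]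
  rw [this, real_inner_comm]

lemma C2On.eventually_line (hΩ : IsOpen Ω) {x : E} (hx : x ∈ Ω) (v : E) :
    ∀ᶠ t in 𝓝 (0:ℝ), x + t • v ∈ Ω := by
  have : ContinuousAt (fun t : ℝ => x + t • v) 0 := by fun_prop
  exact this.eventually_mem (hΩ.mem_nhds (by simpa using hx))

lemma C2On.grad_eq_zero (hw : C2On Ω w Gw Hw) {x : E} (hx : x ∈ Ω) (hmin : IsLocalMin w x) :
    Gw x = 0 := by
  have := hmin.hasFDerivAt_eq_zero (hw.grad x hx)
  have h := congrArg (fun f => f (Gw x)) this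
  simpa using h

lemma C2On.hess_nonneg (hw : C2On Ω w Gw Hw) (hΩ : IsOpen Ω) {x : E} (hx : x ∈ Ω)
    (hmin : IsLocalMin w x) (v : E) : 0 ≤ ⟪Hw x v, v⟫ := by
  refine second_deriv_nonneg (φ := fun t => w (x + t • v)) (φ' := fun t => ⟪Gw (x + t • v), v⟫) ?_ ?_ ?_
  · filter_upwards [C2On.eventually_line hΩ hx v] with t ht using hw.deriv_line ht
  · have := (hw.deriv_grad_line (x := x) (v := v) (t := 0) (by simpa using hx)).inner ℝ
      (hasDerivAt_const (0:ℝ) v)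
    simpa using this
  · have : ContinuousAt (fun t : ℝ => x + t • v) 0 := by fun_prop
    have h2 : Tendsto (fun t : ℝ => x + t • v) (𝓝 0) (𝓝 x) := by simpa [ContinuousAt] using this
    have := h2.eventually hmin
    simpa [IsLocalMin, IsMinFilter] using this

lemma C2On.posSemi (hw : C2On Ω w Gw Hw) (hΩ : IsOpen Ω) {x : E} (hx : x ∈ Ω)
    (hmin : IsLocalMin w x) : PosSemi (Hw x : E →ₗ[ℝ] E) :=
  ⟨hw.isSymmetric hΩ hx, fun v => hw.hess_nonneg hΩ hx hmin v⟩

lemma C2On.continuousOn_fun (hw : C2On Ω w Gw Hw) : ContinuousOn w Ω :=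
  fun x hx => (hw.grad x hx).continuousAt.continuousWithinAt

lemma C2On.continuousOn_grad (hw : C2On Ω w Gw Hw) : ContinuousOn Gw Ω :=
  fun x hx => (hw.hess x hx).continuousAt.continuousWithinAt

/-! ### Operations on `C²` functions -/

lemma C2On.mono (hw : C2On Ω w Gw Hw) {Ω' : Set E} (h : Ω' ⊆ Ω) : C2On Ω' w Gw Hw :=
  ⟨fun x hx => hw.grad x (h hx), fun x hx => hw.hess x (h hx), hw.cont.mono h⟩

lemma C2On.add (hu : C2On Ω u G H) (hw : C2On Ω w Gw Hw) :
    C2On Ω (fun x => u x + w x) (fun x => G x + Gw x) (fun x => H x + Hw x) := by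
  refine ⟨fun x hx => ?_, fun x hx => (hu.hess x hx).add (hw.hess x hx), hu.cont.add hw.cont⟩
  rw [map_add]
  exact (hu.grad x hx).add (hw.grad x hx)

lemma C2On.smul (hw : C2On Ω w Gw Hw) (c : ℝ) :
    C2On Ω (fun x => c * w x) (fun x => c • Gw x) (fun x => c • Hw x) := by
  refine ⟨fun x hx => ?_, fun x hx => (hw.hess x hx).const_smul c, hw.cont.const_smul c⟩
  have := (hw.grad x hx).const_mul c
  rwa [map_smul]

lemma C2On.const (c : ℝ) :
    C2On Ω (fun _ => c) (fun _ => 0) (fun _ => 0) := by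
  refine ⟨fun x hx => ?_, fun x hx => hasFDerivAt_const _ _, continuousOn_const⟩
  rw [map_zero]
  exact hasFDerivAt_const _ _

lemma C2On.inner (a y : E) :
    C2On Ω (fun x => ⟪a, x - y⟫) (fun _ => a) (fun _ => 0) := by
  refine ⟨fun x hx => ?_, fun x hx => hasFDerivAt_const _ _, continuousOn_const⟩
  exact (innerSL ℝ a).hasFDerivAt.comp x ((hasFDerivAt_id (𝕜 := ℝ) x).sub_const y)

lemma C2On.normSq (y : E) :
    C2On Ω (fun x => ‖x - y‖ ^ 2 / 2) (fun x => x - y) (fun _ => ContinuousLinearMap.id ℝ E) := by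
  refine ⟨fun x hx => ?_, fun x hx => (hasFDerivAt_id x).sub_const y, continuousOn_const⟩
  have h1 : HasFDerivAt (fun x : E => x - y) (ContinuousLinearMap.id ℝ E) x :=
    (hasFDerivAt_id x).sub_const y
  have h2 : (fun x : E => ‖x - y‖ ^ 2 / 2) = fun x => (1/2 : ℝ) * ‖x - y‖ ^ 2 := by ext x; ring
  rw [h2]
  refine ((h1.norm_sq).const_mul (1/2 : ℝ)).congr_fderiv ?_
  ext v; simp

lemma C2On.innerSq (ν y : E) :
    C2On Ω (fun x => ⟪ν, x - y⟫ ^ 2 / 2) (fun x => ⟪ν, x - y⟫ • ν)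
      (fun _ => (ContinuousLinearMap.toSpanSingleton ℝ ν).comp (innerSL ℝ ν)) := by
  have h1 : ∀ x : E, HasFDerivAt (fun x : E => ⟪ν, x - y⟫) (innerSL ℝ ν) x := fun x => by
    exact (innerSL ℝ ν).hasFDerivAt.comp x ((hasFDerivAt_id (𝕜 := ℝ) x).sub_const y)
  refine ⟨fun x hx => ?_, fun x hx => ?_, continuousOn_const⟩
  · have h2 : (fun x : E => ⟪ν, x - y⟫ ^ 2 / 2) = fun x => (1/2 : ℝ) * ⟪ν, x - y⟫ ^ 2 := by
      ext x; ring
    rw [h2]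
    refine (((h1 x).pow 2).const_mul (1/2 : ℝ)).congr_fderiv ?_
    ext v; simp; ring
  · have := (h1 x).smul_const ν
    exact this

lemma C2On.comp_affine (hw : C2On Ω w Gw Hw) (x0 : E) (T : E ≃L[ℝ] E) :
    C2On ((fun x => x0 + T x) ⁻¹' Ω) (fun x => w (x0 + T x))
      (fun x => ContinuousLinearMap.adjoint (𝕜 := ℝ) (T : E →L[ℝ] E) (Gw (x0 + T x)))
      (fun x => (ContinuousLinearMap.adjoint (𝕜 := ℝ) (T : E →L[ℝ] E)).comp ((Hw (x0 + T x)).comp (T : E →L[ℝ] E))) := by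
  have hT : ∀ x, HasFDerivAt (fun x => x0 + T x) (T : E →L[ℝ] E) x := fun x =>
    T.hasFDerivAt.const_add x0
  refine ⟨fun x hx => ?_, fun x hx => ?_, ?_⟩
  · refine ((hw.grad _ hx).comp x (hT x)).congr_fderiv ?_
    ext v
    simp [ContinuousLinearMap.adjoint_inner_left]
  · exact (ContinuousLinearMap.hasFDerivAt _).comp x ((hw.hess _ hx).comp x (hT x))
  · have hc : ContinuousOn (fun x => Hw (x0 + T x)) ((fun x => x0 + T x) ⁻¹' Ω) :=
      hw.cont.comp (by fun_prop) (fun x hx => hx)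
    exact continuousOn_const.clm_comp (hc.clm_comp continuousOn_const)

lemma C2On.comp_add (hw : C2On Ω w Gw Hw) (h : E) :
    C2On ((fun x => x + h) ⁻¹' Ω) (fun x => w (x + h)) (fun x => Gw (x + h))
      (fun x => Hw (x + h)) := by
  have hT : ∀ x : E, HasFDerivAt (fun x => x + h) (ContinuousLinearMap.id ℝ E) x := fun x =>
    (hasFDerivAt_id x).add_const h
  refine ⟨fun x hx => ?_, fun x hx => ?_, hw.cont.comp (by fun_prop) (fun x hx => hx)⟩
  · exact ((hw.grad _ hx).comp x (hT x)).congr_fderiv (by ext; simp)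
  · exact ((hw.hess _ hx).comp x (hT x)).congr_fderiv (by ext; simp)

lemma C2On.breg_left (hu : C2On Ω u G H) (y : E) :
    C2On Ω (fun x => breg u G x y) (fun x => G x - G y) H := by
  have h := (hu.add (C2On.const (Ω := Ω) (-u y))).add (C2On.inner (Ω := Ω) (-G y) y)
  have e1 : (fun x => u x + -u y + ⟪-G y, x - y⟫) = fun x => breg u G x y := by
    ext x; simp [breg, inner_neg_left]; ring
  have e2 : (fun x => G x + 0 + -G y) = fun x => G x - G y := by ext x; abel_nf
  have e3 : (fun x => H x + 0 + 0) = H := by ext x; simp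
  rwa [e1, e2, e3] at h

lemma C2On.second_diff (hu : C2On Ω u G H) (h : E) {Ω' : Set E}
    (hΩ' : ∀ x ∈ Ω', x ∈ Ω ∧ x + h ∈ Ω ∧ x - h ∈ Ω) :
    C2On Ω' (fun x => u (x + h) + u (x - h) - 2 * u x)
      (fun x => G (x + h) + G (x - h) - (2:ℝ) • G x)
      (fun x => H (x + h) + H (x - h) - (2:ℝ) • H x) := by
  have h1 := (hu.comp_add h).mono (Ω' := Ω') fun x hx => (hΩ' x hx).2.1
  have h2 := (hu.comp_add (-h)).mono (Ω' := Ω') fun x hx => by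
    simpa [sub_eq_add_neg] using (hΩ' x hx).2.2
  have h3 := (hu.smul (-2)).mono (Ω' := Ω') fun x hx => (hΩ' x hx).1
  have := (h1.add h2).add h3
  simpa only [← sub_eq_add_neg, neg_smul, neg_mul] using this

/-! ### Elementary properties of solutions -/

namespace MASol

variable (hu : MASol Ω u G H)
include hu

lemma breg_nonneg {x y : E} (hx : x ∈ Ω) (hy : y ∈ Ω) : 0 ≤ breg u G x y := by
  rcases eq_or_ne x y with rfl | h
  · rw [breg_self]
  · exact (hu.strict x hx y hy h).le

lemma inner_nonneg {x y : E} (hx : x ∈ Ω) (hy : y ∈ Ω) : 0 ≤ ⟪x - y, G x - G y⟫ := by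
  rw [← breg_add_swap (u := u)]
  exact add_nonneg (hu.breg_nonneg hx hy) (hu.breg_nonneg hy hx)

lemma posDef {x : E} (hx : x ∈ Ω) : PosDef (H x : E →ₗ[ℝ] E) := by
  refine posDef_of_posSemi_of_det_ne_zero ?_ (hu.det_pos x hx).ne'
  refine (hu.breg_left x).posSemi hu.isOpen hx ?_
  filter_upwards [hu.isOpen.mem_nhds hx] with z hz
  rw [breg_self]
  exact hu.breg_nonneg hz hx

lemma continuousOn_breg_left {y : E} : ContinuousOn (fun x => breg u G x y) Ω :=
  (hu.breg_left y).continuousOn_fun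

lemma continuousOn_breg_right {x : E} : ContinuousOn (fun y => breg u G x y) Ω := by
  have h1 := hu.toC2On.continuousOn_fun
  have h2 := hu.toC2On.continuousOn_grad
  unfold breg
  exact (continuousOn_const.sub h1).sub (h2.inner (continuousOn_const.sub continuousOn_id))

lemma continuousOn_breg : ContinuousOn (fun p : E × E => breg u G p.1 p.2) (Ω ×ˢ Ω) := by
  have h1 := hu.toC2On.continuousOn_fun
  have h2 := hu.toC2On.continuousOn_grad
  have f1 : ContinuousOn (fun p : E × E => u p.1) (Ω ×ˢ Ω) :=
    h1.comp continuousOn_fst fun p hp => hp.1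
  have f2 : ContinuousOn (fun p : E × E => u p.2) (Ω ×ˢ Ω) :=
    h1.comp continuousOn_snd fun p hp => hp.2
  have f3 : ContinuousOn (fun p : E × E => G p.2) (Ω ×ˢ Ω) :=
    h2.comp continuousOn_snd fun p hp => hp.2
  unfold breg
  exact (f1.sub f2).sub (f3.inner (continuousOn_fst.sub continuousOn_snd))

lemma breg_segment {x y : E} (hx : x ∈ Ω) (hy : y ∈ Ω) {t : ℝ} (h0 : 0 ≤ t) (h1 : t ≤ 1) :
    y + t • (x - y) ∈ Ω ∧ breg u G (y + t • (x - y)) y ≤ t * breg u G x y := by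
  have hm : y + t • (x - y) ∈ Ω := hu.convex.add_smul_sub_mem hy hx ⟨h0, h1⟩
  refine ⟨hm, ?_⟩
  set m := y + t • (x - y) with hmdef
  have a1 := hu.breg_nonneg hx hm
  have a2 := hu.breg_nonneg hy hm
  have e1 : x - m = (1 - t) • (x - y) := by rw [hmdef]; module
  have e2 : y - m = (-t) • (x - y) := by rw [hmdef]; module
  have e3 : m - y = t • (x - y) := by rw [hmdef]; module
  simp only [breg, e1, e2, e3, inner_smul_right] at a1 a2 ⊢
  nlinarith [mul_le_mul_of_nonneg_left a1 h0, mul_le_mul_of_nonneg_left a2 (sub_nonneg.2 h1)]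

lemma convex_sublevel (y : E) (t : ℝ) : Convex ℝ {x ∈ Ω | breg u G x y ≤ t} := by
  intro x hx z hz a b ha hb hab
  have hm : a • x + b • z ∈ Ω := hu.convex hx.1 hz.1 ha hb hab
  refine ⟨hm, ?_⟩
  set m := a • x + b • z with hmdef
  have a1 := hu.breg_nonneg hx.1 hm
  have a2 := hu.breg_nonneg hz.1 hm
  have h1 := hx.2
  have h2 := hz.2
  have hb' : b = 1 - a := by linarith
  have e1 : x - m = b • (x - z) := by rw [hmdef, hb']; module
  have e2 : z - m = (-a) • (x - z) := by rw [hmdef, hb']; module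
  have e3 : m - y = a • (x - y) + b • (z - y) := by rw [hmdef, hb']; module
  simp only [breg, e1, e2, e3, inner_smul_right, inner_add_right] at a1 a2 h1 h2 ⊢
  subst hb'
  nlinarith [mul_le_mul_of_nonneg_left a1 ha, mul_le_mul_of_nonneg_left a2 hb,
    mul_le_mul_of_nonneg_left h1 ha, mul_le_mul_of_nonneg_left h2 hb]

lemma linMA_second_diff {x h : E} (hx : x ∈ Ω) (h1 : x + h ∈ Ω) (h2 : x - h ∈ Ω) :
    Real.log (H (x + h)).det + Real.log (H (x - h)).det - 2 * Real.log (H x).det ≤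
      linMA (H x : E →ₗ[ℝ] E) ((H (x + h) + H (x - h) - (2:ℝ) • H x : E →L[ℝ] E) : E →ₗ[ℝ] E) := by
  have e : ((H (x + h) + H (x - h) - (2:ℝ) • H x : E →L[ℝ] E) : E →ₗ[ℝ] E) =
      ((H (x + h) : E →ₗ[ℝ] E) + (H (x - h) : E →ₗ[ℝ] E)) + (-2 : ℝ) • (H x : E →ₗ[ℝ] E) := by
    ext v; simp [sub_eq_add_neg]
  rw [e, linMA_add, linMA_add, linMA_smul, linMA_self (hu.posDef hx)]
  have a1 := log_det_sub_le_linMA (hu.posDef hx) (hu.posDef h1)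
  have a2 := log_det_sub_le_linMA (hu.posDef hx) (hu.posDef h2)
  simp only [ContinuousLinearMap.det] at *
  linarith

end MASol

lemma linMA_smul_smul {A : E →ₗ[ℝ] E} (hA : PosDef A) (B : E →ₗ[ℝ] E) {c : ℝ} (hc : 0 < c) :
    linMA (c • A) (c • B) = linMA A B := by
  obtain ⟨S, hS⟩ := hA.exists_root
  have hcs := Real.mul_self_sqrt hc.le
  have hne : Real.sqrt c ≠ 0 := (Real.sqrt_pos.2 hc).ne'
  have key : ∀ C : E →ₗ[ℝ] E, LinearMap.adjoint ((Real.sqrt c)⁻¹ • S) * (c • C) *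
      ((Real.sqrt c)⁻¹ • S) = LinearMap.adjoint S * C * S := by
    intro C
    have : (Real.sqrt c)⁻¹ * (c * (Real.sqrt c)⁻¹) = 1 := by
      field_simp; nlinarith
    simp only [map_smulₛₗ, smul_mul_assoc, mul_smul_comm, smul_smul]
    simp only [conj_trivial]
    rw [show (√c)⁻¹ * (c * (√c)⁻¹) = 1 from this, one_smul]
  rw [linMA_eq_trace (S := (Real.sqrt c)⁻¹ • S) (by rw [key, hS]), key, ← linMA_eq_trace hS]

/-! ### Affine rescaling -/

/-- The gradient of `x ↦ c * w (x0 + T x)`. -/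
def affG (x0 : E) (T : E ≃L[ℝ] E) (c : ℝ) (G : E → E) (x : E) : E :=
  c • ContinuousLinearMap.adjoint (𝕜 := ℝ) (T : E →L[ℝ] E) (G (x0 + T x))

/-- The Hessian of `x ↦ c * w (x0 + T x)`. -/
def affH (x0 : E) (T : E ≃L[ℝ] E) (c : ℝ) (H : E → E →L[ℝ] E) (x : E) : E →L[ℝ] E :=
  c • (ContinuousLinearMap.adjoint (𝕜 := ℝ) (T : E →L[ℝ] E)).comp
    ((H (x0 + T x)).comp (T : E →L[ℝ] E))

lemma C2On.affine (hw : C2On Ω w Gw Hw) (x0 : E) (T : E ≃L[ℝ] E) (c : ℝ) :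
    C2On ((fun x => x0 + T x) ⁻¹' Ω) (fun x => c * w (x0 + T x)) (affG x0 T c Gw)
      (affH x0 T c Hw) :=
  (hw.comp_affine x0 T).smul c

lemma breg_affine (x0 : E) (T : E ≃L[ℝ] E) (c : ℝ) (x y : E) :
    breg (fun x => c * u (x0 + T x)) (affG x0 T c G) x y =
      c * breg u G (x0 + T x) (x0 + T y) := by
  simp only [breg, affG, inner_smul_left, ContinuousLinearMap.adjoint_inner_left]
  simp
  ring

lemma det_affH (x0 : E) (T : E ≃L[ℝ] E) (c : ℝ) (x : E) :
    (affH x0 T c H x).det = c ^ (finrank ℝ E) * (T : E →L[ℝ] E).det ^ 2 * (H (x0 + T x)).det := by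
  have : ((affH x0 T c H x : E →L[ℝ] E) : E →ₗ[ℝ] E) =
    c • (LinearMap.adjoint ((T : E →L[ℝ] E) : E →ₗ[ℝ] E) * (H (x0 + T x) : E →ₗ[ℝ] E) *
      ((T : E →L[ℝ] E) : E →ₗ[ℝ] E)) := by
    ext v; rfl
  simp only [ContinuousLinearMap.det]
  rw [this, LinearMap.det_smul, map_mul, map_mul, det_adjoint_real]
  ring

lemma linMA_affH (x0 : E) (T : E ≃L[ℝ] E) {c : ℝ} (hc : 0 < c) {x : E}
    (hA : PosDef (H (x0 + T x) : E →ₗ[ℝ] E)) :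
    linMA (affH x0 T c H x : E →ₗ[ℝ] E) (affH x0 T c Hw x : E →ₗ[ℝ] E) =
      linMA (H (x0 + T x) : E →ₗ[ℝ] E) (Hw (x0 + T x) : E →ₗ[ℝ] E) := by
  have key : ∀ H : E → E →L[ℝ] E, ((affH x0 T c H x : E →L[ℝ] E) : E →ₗ[ℝ] E) =
    c • (LinearMap.adjoint (T.toLinearEquiv : E →ₗ[ℝ] E) * (H (x0 + T x) : E →ₗ[ℝ] E) *
      (T.toLinearEquiv : E →ₗ[ℝ] E)) := by
    intro H; ext v; rfl
  have hpd : PosDef (LinearMap.adjoint (T.toLinearEquiv : E →ₗ[ℝ] E) * (H (x0 + T x) : E →ₗ[ℝ] E) *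
      (T.toLinearEquiv : E →ₗ[ℝ] E)) := by
    refine ⟨fun v v' => ?_, fun v hv => ?_⟩
    · simp only [Module.End.mul_apply, LinearMap.adjoint_inner_left, LinearMap.adjoint_inner_right]
      exact hA.1 _ _
    · simp only [Module.End.mul_apply, LinearMap.adjoint_inner_left]
      exact hA.2 _ (by simpa using hv)
  rw [key, key, linMA_smul_smul hpd _ hc, linMA_conj _ _ _ hA]

lemma MASol.affine (hu : MASol Ω u G H) (x0 : E) (T : E ≃L[ℝ] E) {c : ℝ} (hc : 0 < c) :
    MASol ((fun x => x0 + T x) ⁻¹' Ω) (fun x => c * u (x0 + T x)) (affG x0 T c G)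
      (affH x0 T c H) where
  toC2On := hu.toC2On.affine x0 T c
  isOpen := hu.isOpen.preimage (by fun_prop)
  convex := by
    intro x hx y hy a b ha hb hab
    have := hu.convex hx hy ha hb hab
    simp only [mem_preimage, map_add, map_smul] at this ⊢
    convert this using 1
    have hb' : b = 1 - a := by linarith
    subst hb'; module
  strict := by
    intro x hx y hy hxy
    rw [breg_affine]
    exact mul_pos hc (hu.strict _ hx _ hy (by simpa using hxy))
  det_pos := by
    intro x hx
    rw [det_affH]
    have h2 : (T : E →L[ℝ] E).det ≠ 0 := by
      have := T.toLinearEquiv.isUnit_det'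
      exact this.ne_zero
    have := hu.det_pos _ hx
    positivity

end Basics

section Geometry

set_option linter.unusedSectionVars false

open Module (finrank)
open Filter Topology

variable {E : Type*} [NormedAddCommGroup E] [InnerProductSpace ℝ E] [FiniteDimensional ℝ E]
variable {Ω : Set E} {u w : E → ℝ} {G Gw : E → E} {H Hw : E → E →L[ℝ] E}

/-- If the height over a tangent plane is at most `1` on a ball, the determinant is controlled at
some point of the ball. -/
lemma MASol.exists_det_le (hu : MASol Ω u G H) {y c0 : E} {ρ : ℝ} (hρ : 0 < ρ) (hy : y ∈ Ω)
    (hb : closedBall c0 ρ ⊆ Ω) (h1 : ∀ x ∈ closedBall c0 ρ, breg u G x y ≤ 1) :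
    ∃ p ∈ closedBall c0 ρ, (H p).det ≤ (3 / ρ ^ 2) ^ finrank ℝ E := by
  have hc2 := (((C2On.normSq (Ω := Ω) c0).smul (3 / ρ ^ 2)).add
    ((hu.breg_left y).smul (-1)))
  obtain ⟨p, hp, hmin⟩ := (isCompact_closedBall c0 ρ).exists_isMinOn ⟨c0, mem_closedBall_self hρ.le⟩
    (hc2.continuousOn_fun.mono hb)
  have hp0 := hmin (mem_closedBall_self hρ.le)
  simp only [mem_ofPred_eq, sub_self, norm_zero] at hp0
  have hd0 := hu.breg_nonneg (hb (mem_closedBall_self hρ.le)) hy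
  have hpc : p ∈ ball c0 ρ := by
    rcases (mem_closedBall.1 hp).lt_or_eq with h | h
    · exact h
    exfalso
    rw [dist_eq_norm] at h
    rw [h] at hp0
    have := h1 p hp
    have e : 3 / ρ ^ 2 * (ρ ^ 2 / 2) = 3 / 2 := by field_simp
    rw [e] at hp0
    norm_num at hp0
    linarith
  refine ⟨p, hp, ?_⟩
  have hloc := hmin.isLocalMin (mem_of_superset (isOpen_ball.mem_nhds hpc) ball_subset_closedBall)
  have hps := hc2.posSemi hu.isOpen (hb hp) hloc
  have hb0 : 0 < 3 / ρ ^ 2 := by positivity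
  have hle : LinearMap.det (H p : E →ₗ[ℝ] E) ≤ LinearMap.det ((3 / ρ ^ 2) • (1 : E →ₗ[ℝ] E)) := by
    refine det_le_det_of_le (hu.posDef (hb hp)) (fun x y => by simp [inner_smul_left, inner_smul_right]) fun v => ?_
    have := hps.2 v
    simp [inner_add_left, inner_smul_left] at this ⊢
    linarith
  rw [LinearMap.det_smul, map_one, mul_one] at hle
  exact hle

/-- A segment leaving a compact sublevel set meets the corresponding level set. -/
lemma exists_exit {Ω : Set E} (hΩ : IsOpen Ω) {g : E → ℝ} (hg : ContinuousOn g Ω) {a : ℝ}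
    (hS : IsCompact {x ∈ Ω | g x ≤ a}) {x v : E} (hx : x ∈ Ω) (hxa : g x ≤ a)
    (hv : ¬ (x + v ∈ Ω ∧ g (x + v) ≤ a)) :
    ∃ s ∈ Icc (0:ℝ) 1, x + s • v ∈ Ω ∧ g (x + s • v) = a := by
  have hcont : Continuous fun s : ℝ => x + s • v := by fun_prop
  set A := Icc (0:ℝ) 1 ∩ (fun s : ℝ => x + s • v) ⁻¹' {x ∈ Ω | g x ≤ a} with hA
  have hAc : IsCompact A := isCompact_Icc.inter_right (hS.isClosed.preimage hcont)
  have h0 : (0:ℝ) ∈ A := ⟨by simp, by simpa using ⟨hx, hxa⟩⟩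
  obtain ⟨s, hs⟩ := hAc.exists_isGreatest ⟨0, h0⟩
  obtain ⟨⟨hs01, hsΩ, hsa⟩, hmax⟩ := hs
  refine ⟨s, hs01, hsΩ, ?_⟩
  by_contra hne
  have hlt : g (x + s • v) < a := lt_of_le_of_ne hsa hne
  have hs1 : s < 1 := by
    rcases hs01.2.lt_or_eq with h | h
    · exact h
    · subst h; simp only [one_smul] at hsΩ hsa; exact absurd ⟨hsΩ, hsa⟩ hv
  have hnb : Ω ∈ 𝓝 (x + s • v) := hΩ.mem_nhds hsΩ
  have ev1 : ∀ᶠ p in 𝓝 (x + s • v), p ∈ Ω ∧ g p < a :=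
    Filter.Eventually.and hnb ((ContinuousOn.continuousAt hg (IsOpen.mem_nhds hΩ hsΩ)).eventually_lt_const hlt)
  have ev2 : ∀ᶠ t in 𝓝 s, x + t • v ∈ Ω ∧ g (x + t • v) < a := hcont.continuousAt.eventually ev1
  have ev3 : ∀ᶠ t in 𝓝[>] s, t ∈ A := by
    filter_upwards [nhdsWithin_le_nhds ev2, self_mem_nhdsWithin,
      nhdsWithin_le_nhds (Iio_mem_nhds hs1)] with t h1 h2 h3
    exact ⟨⟨hs01.1.trans (mem_Ioi.1 h2).le, (mem_Iio.1 h3).le⟩, h1.1, h1.2.le⟩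
  obtain ⟨t, ht1, ht2⟩ := (ev3.and self_mem_nhdsWithin).exists
  exact absurd (hmax ht1) (not_le.2 ht2)

/-- Depth of a half-height section inside the section, for normalised sections. -/
lemma exists_depth (R F : ℝ) (hR : 0 < R) (hF : 0 < F) : ∃ c > 0,
    ∀ (Ω : Set E) (u : E → ℝ) (G : E → E) (H : E → E →L[ℝ] E), MASol Ω u G H →
    ∀ y ∈ Ω, IsCompact {x ∈ Ω | breg u G x y ≤ 1} →
    (∀ x ∈ Ω, breg u G x y ≤ 1 → ‖x - y‖ ≤ R) →
    (∀ x ∈ Ω, breg u G x y ≤ 1 → (H x).det ≤ F) →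
    ∀ x ∈ Ω, breg u G x y ≤ 1 / 2 → ∀ v, ‖v‖ ≤ c → x + v ∈ Ω ∧ breg u G (x + v) y ≤ 1 := by
  set m : ℝ := 1 / (2 * R ^ 2) with hm
  have hm0 : 0 < m := by positivity
  set L : ℝ := m * (F / m ^ finrank ℝ E) with hL
  have hL0 : 0 < L := by positivity
  refine ⟨1 / (8 * (L * R)), by positivity, ?_⟩
  intro Ω u G H hu y hy hS hSR hSF x hx hx2 v hv
  by_contra hout
  obtain ⟨s, hs, hsΩ, hs1⟩ := exists_exit hu.isOpen hu.continuousOn_breg_left hS hx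
    (hx2.trans (by norm_num)) hout
  set x' := x + s • v with hx'
  have hz : 1 ≤ ⟪x' - y, G x' - G y⟫ := by
    rw [← breg_add_swap (u := u), hs1]
    linarith [hu.breg_nonneg hy hsΩ]
  have hGne : G x' - G y ≠ 0 := by
    intro h
    rw [h, inner_zero_right] at hz
    norm_num at hz
  have hGn : 0 < ‖G x' - G y‖ := norm_pos_iff.2 hGne
  set ν : E := ‖G x' - G y‖⁻¹ • (G x' - G y) with hν
  have hν1 : ‖ν‖ = 1 := norm_smul_inv_norm hGne
  have htS : ∀ z ∈ Ω, breg u G z y ≤ 1 → ⟪ν, z - x'⟫ ≤ 0 := by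
    intro z hz hz1
    have h3 := breg_three (u := u) (G := G) z y x'
    have h4 := hu.breg_nonneg hz hsΩ
    have h5 : ⟪G x' - G y, z - x'⟫ ≤ 0 := by
      have : ⟪z - x', G y - G x'⟫ = -⟪G x' - G y, z - x'⟫ := by
        rw [← neg_sub (G x') (G y), inner_neg_right, real_inner_comm]
      rw [this] at h3
      linarith
    rw [hν, inner_smul_left]
    simp only [conj_trivial]
    exact mul_nonpos_of_nonneg_of_nonpos (by positivity) h5
  have hx'R : ‖x' - y‖ ≤ R := hSR x' hsΩ hs1.le
  have htR : ∀ z ∈ Ω, breg u G z y ≤ 1 → -⟪ν, z - x'⟫ ≤ 2 * R := by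
    intro z hz hz1
    have h1 := abs_real_inner_le_norm ν (z - x')
    rw [hν1, one_mul] at h1
    have h2 : ‖z - x'‖ ≤ ‖z - y‖ + ‖x' - y‖ := by
      have := norm_sub_le (z - y) (x' - y)
      simpa using this
    have h3 := hSR z hz hz1
    linarith [neg_abs_le ⟪ν, z - x'⟫]
  -- the barrier
  set Q : E → ℝ := fun z => 1 + L * R * ⟪ν, z - x'⟫ + L * (⟪ν, z - x'⟫ ^ 2 / 2) +
    m * (‖z - y‖ ^ 2 / 2) - m * R ^ 2 / 2 with hQ
  have hmR : m * R ^ 2 / 2 = 1 / 4 := by rw [hm]; field_simp; norm_num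
  have hQ1 : ∀ z ∈ Ω, breg u G z y ≤ 1 → Q z ≤ 1 := by
    intro z hz hz1
    have a1 := htS z hz hz1
    have a2 := htR z hz hz1
    have a3 := hSR z hz hz1
    have a4 : ‖z - y‖ ^ 2 ≤ R ^ 2 := by gcongr
    have a5 : L * R * ⟪ν, z - x'⟫ + L * (⟪ν, z - x'⟫ ^ 2 / 2) ≤ 0 := by
      have : L * R * ⟪ν, z - x'⟫ + L * (⟪ν, z - x'⟫ ^ 2 / 2) =
        (L / 2) * (⟪ν, z - x'⟫ * (2 * R + ⟪ν, z - x'⟫)) := by ring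
      rw [this]
      exact mul_nonpos_of_nonneg_of_nonpos (by positivity)
        (mul_nonpos_of_nonpos_of_nonneg a1 (by linarith))
    have a6 := mul_le_mul_of_nonneg_left a4 hm0.le
    simp only [hQ]
    linarith
  have hc2 := ((((hu.breg_left y).add ((C2On.inner (Ω := Ω) ν x').smul (-(L * R)))).add
    ((C2On.innerSq (Ω := Ω) ν x').smul (-L))).add ((C2On.normSq (Ω := Ω) y).smul (-m)))
  obtain ⟨z, ⟨hzΩ, hz1⟩, hmin⟩ := hS.exists_isMinOn ⟨x, hx, hx2.trans (by norm_num)⟩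
    (hc2.continuousOn_fun.mono fun z hz => hz.1)
  have hbd : breg u G z y = 1 := by
    by_contra hne
    have hlt : breg u G z y < 1 := lt_of_le_of_ne hz1 hne
    have hnb : {x ∈ Ω | breg u G x y ≤ 1} ∈ 𝓝 z := by
      filter_upwards [hu.isOpen.mem_nhds hzΩ, (hu.continuousOn_breg_left.continuousAt
        (hu.isOpen.mem_nhds hzΩ)).eventually_lt_const hlt] with p h1 h2 using ⟨h1, h2.le⟩
    have hps := hc2.posSemi hu.isOpen hzΩ (hmin.isLocalMin hnb)
    have hdet := det_smul_id_add_rankOne ν m L hm0.ne' hν1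
    set M := m • (1 : E →ₗ[ℝ] E) + L • (LinearMap.toSpanSingleton ℝ E ν ∘ₗ innerₗ E ν) with hM
    have hMf : ∀ v, ⟪M v, v⟫ = m * ‖v‖ ^ 2 + L * ⟪ν, v⟫ ^ 2 := by
      intro v
      simp [hM, inner_add_left, inner_smul_left]
      left; ring
    have hMpd : PosDef M := by
      refine ⟨fun v v' => ?_, fun v hv => ?_⟩
      · simp [hM, inner_add_left, inner_smul_left, inner_add_right, inner_smul_right]
        left; rw [real_inner_comm ν v]; ring
      · rw [hMf]
        have : 0 < ‖v‖ := norm_pos_iff.2 hv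
        positivity
    have hle := det_le_det_of_le hMpd (hu.posDef hzΩ).1 (fun v => by
      rw [hMf]
      have := hps.2 v
      simp [inner_add_left, inner_smul_left] at this ⊢
      linarith)
    rw [hdet] at hle
    have h6 := hSF z hzΩ hz1
    have h7 : m ^ finrank ℝ E * (1 + L / m) = m ^ finrank ℝ E + F := by
      rw [hL]; field_simp
    rw [h7] at hle
    have h8 : 0 < m ^ finrank ℝ E := by positivity
    simp only [ContinuousLinearMap.det] at h6
    linarith
  have hfin := hmin (a := x) ⟨hx, hx2.trans (by norm_num)⟩
  have hQz := hQ1 z hzΩ hz1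
  simp only [mem_ofPred_eq, hQ] at hfin hQz
  have e1 : ⟪ν, x - x'⟫ ≥ -‖v‖ := by
    have h1 := abs_real_inner_le_norm ν (x - x')
    have h2 : ‖x - x'‖ ≤ ‖v‖ := by
      have : x - x' = (-s) • v := by rw [hx']; module
      rw [this, norm_smul, norm_neg, Real.norm_of_nonneg hs.1]
      exact mul_le_of_le_one_left (norm_nonneg _) hs.2
    rw [hν1, one_mul] at h1
    linarith [neg_abs_le ⟪ν, x - x'⟫]
  have e2 : L * R * ⟪ν, x - x'⟫ ≥ -(1/8) := by
    have : L * R * ⟪ν, x - x'⟫ ≥ L * R * (-(1 / (8 * (L * R)))) :=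
      mul_le_mul_of_nonneg_left (by linarith) (by positivity)
    have h2 : L * R * (-(1 / (8 * (L * R)))) = -(1/8) := by field_simp
    linarith
  have e3 : 0 ≤ L * (⟪ν, x - x'⟫ ^ 2 / 2) := by positivity
  have e4 : 0 ≤ m * (‖x - y‖ ^ 2 / 2) := by positivity
  linarith

/-- A simplex of maximal volume with one vertex at the origin in a compact set. -/
lemma exists_max_simplex {S : Set E} (hS : IsCompact S) {r : ℝ} (hr : 0 < r)
    (hball : closedBall 0 r ⊆ S) :
    ∃ A : E ≃L[ℝ] E, (∀ i, A (stdOrthonormalBasis ℝ E i) ∈ S) ∧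
      ∀ b ∈ S, ‖A.symm b‖ ≤ Real.sqrt (finrank ℝ E) := by
  classical
  set e := stdOrthonormalBasis ℝ E with he
  have hcont : Continuous fun w : Fin (finrank ℝ E) → E => |e.toBasis.det w| := by
    have : Continuous fun w : Fin (finrank ℝ E) → E => e.toBasis.det w := ?_
    · exact continuous_abs.comp this
    simp only [Module.Basis.det_apply]
    refine Continuous.matrix_det (continuous_matrix fun i j => ?_)
    simp only [Module.Basis.toMatrix_apply, OrthonormalBasis.coe_toBasis_repr_apply,
      OrthonormalBasis.repr_apply_apply]
    fun_prop
  have hK : IsCompact (univ.pi fun _ : Fin (finrank ℝ E) => S) := isCompact_univ_pi fun _ => hS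
  have hmem : (fun i => r • e i) ∈ (univ.pi fun _ : Fin (finrank ℝ E) => S) := by
    intro i _
    refine hball ?_
    rw [mem_closedBall_zero_iff, norm_smul, e.orthonormal.1 i, Real.norm_of_nonneg hr.le, mul_one]
  obtain ⟨w, hwS, hmax⟩ := hK.exists_isMaxOn ⟨_, hmem⟩ hcont.continuousOn
  have hpos : 0 < |e.toBasis.det w| := by
    refine lt_of_lt_of_le ?_ (hmax hmem)
    have : e.toBasis.det (fun i => r • e i) = r ^ finrank ℝ E := by
      have h1 := e.toBasis.det.map_smul_univ (fun _ => r) (fun i => e i)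
      rw [h1]
      have h2 := e.toBasis.det_self
      rw [e.coe_toBasis] at h2
      simp [h2]
    change 0 < |e.toBasis.det fun i => r • e i|
    rw [this]
    positivity
  have hne : e.toBasis.det w ≠ 0 := abs_pos.1 hpos
  obtain ⟨hli, hsp⟩ := (e.toBasis.is_basis_iff_det).2 (isUnit_iff_ne_zero.2 hne)
  set bw := Module.Basis.mk hli hsp.ge with hbw
  let A := e.toBasis.equiv bw (Equiv.refl _)
  refine ⟨A.toContinuousLinearEquiv, fun i => ?_, fun b hb => ?_⟩
  · have : A (e i) = w i := by
      have h1 : A (e.toBasis i) = bw i := by simp only [A, Module.Basis.equiv_apply, Equiv.refl_apply]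
      rw [e.coe_toBasis] at h1
      rw [h1, hbw, Module.Basis.mk_apply]
    change A (e i) ∈ S
    rw [this]
    exact hwS i (mem_univ i)
  · change ‖A.symm b‖ ≤ _
    have hco : ∀ i, ⟪e i, A.symm b⟫ = bw.coord i b := by
      intro i
      rw [← e.repr_apply_apply, ← e.coe_toBasis_repr_apply]
      have : A.symm b = bw.equiv e.toBasis (Equiv.refl _) b := rfl
      rw [this]
      have h2 : bw.equiv e.toBasis (Equiv.refl _) b = e.toBasis.repr.symm (bw.repr b) := by
        simp [Module.Basis.equiv]
      rw [h2, LinearEquiv.apply_symm_apply]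
      rfl
    have hle : ∀ i, |bw.coord i b| ≤ 1 := by
      intro i
      have h1 := congrArg (fun f => f b) (e.toBasis.det_smul_mk_coord_eq_det_update hli hsp.ge i)
      simp only [LinearMap.smul_apply, smul_eq_mul] at h1
      have h2 : |e.toBasis.det (Function.update w i b)| ≤ |e.toBasis.det w| := by
        refine hmax (a := Function.update w i b) ?_
        intro j _
        rcases eq_or_ne j i with rfl | hj
        · simpa using hb
        · rw [Function.update_of_ne hj]; exact hwS j (mem_univ j)
      have h3 : |e.toBasis.det w| * |bw.coord i b| ≤ |e.toBasis.det w| * 1 := by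
        rw [← abs_mul, h1, mul_one]; exact h2
      exact le_of_mul_le_mul_left h3 hpos
    have h4 : ‖A.symm b‖ ^ 2 = ∑ i, ⟪e i, A.symm b⟫ ^ 2 := by
      rw [← e.sum_sq_norm_inner_right]
      simp
    rw [← Real.sqrt_sq (norm_nonneg (A.symm b)), h4]
    refine Real.sqrt_le_sqrt ?_
    calc ∑ i, ⟪e i, A.symm b⟫ ^ 2 ≤ ∑ _i : Fin (finrank ℝ E), (1:ℝ) := by
          refine Finset.sum_le_sum fun i _ => ?_
          rw [hco, ← sq_abs]
          have := hle i
          have := abs_nonneg (bw.coord i b)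
          nlinarith
      _ = finrank ℝ E := by simp

lemma closedBall_subset_of_simplex [Nontrivial E] {S : Set E} (hS : Convex ℝ S) (h0 : (0:E) ∈ S)
    (h1 : ∀ i, stdOrthonormalBasis ℝ E i ∈ S) :
    closedBall ((1 / (2 * finrank ℝ E : ℝ)) • ∑ i, stdOrthonormalBasis ℝ E i)
      (1 / (2 * finrank ℝ E)) ⊆ S := by
  set e := stdOrthonormalBasis ℝ E with he
  set g := (1 / (2 * finrank ℝ E : ℝ)) • ∑ i, e i with hg
  have hn : (0:ℝ) < finrank ℝ E := by exact_mod_cast Module.finrank_pos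
  intro p hp
  rw [mem_closedBall, dist_eq_norm] at hp
  have hgi : ∀ i, ⟪e i, g⟫ = 1 / (2 * finrank ℝ E) := by
    intro i
    rw [hg, inner_smul_right, inner_sum]
    simp [orthonormal_iff_ite.1 e.orthonormal]
  have hpi : ∀ i, 0 ≤ ⟪e i, p⟫ ∧ ⟪e i, p⟫ ≤ 1 / finrank ℝ E := by
    intro i
    have h2 := abs_real_inner_le_norm (e i) (p - g)
    rw [e.orthonormal.1 i, one_mul, inner_sub_right, hgi] at h2
    have h3 := abs_le.1 (h2.trans hp)
    have h4 : 1 / (finrank ℝ E : ℝ) = 1 / (2 * finrank ℝ E) + 1 / (2 * finrank ℝ E) := by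
      field_simp; norm_num
    constructor <;> linarith
  have hsum : ∑ i, ⟪e i, p⟫ ≤ 1 := by
    calc ∑ i, ⟪e i, p⟫ ≤ ∑ _i : Fin (finrank ℝ E), 1 / (finrank ℝ E : ℝ) :=
          Finset.sum_le_sum fun i _ => (hpi i).2
      _ = 1 := by simp; field_simp
  have hp2 : p = ∑ i : Option (Fin (finrank ℝ E)),
      (i.elim (1 - ∑ i, ⟪e i, p⟫) fun i => ⟪e i, p⟫) • (i.elim (0:E) fun i => e i) := by
    rw [Fintype.sum_option]
    simp [e.sum_repr' p]
  rw [hp2]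
  refine hS.sum_mem ?_ ?_ ?_
  · rintro (_ | i) _
    · simpa using hsum
    · exact (hpi i).1
  · rw [Fintype.sum_option]; simp
  · rintro (_ | i) _
    · exact h0
    · exact h1 i

/-- Sections with controlled oscillation of the determinant become round after an affine map. -/
lemma exists_normalization [Nontrivial E] (κ : ℝ) (hκ : 0 < κ) : ∃ c > 0,
    ∀ (Ω : Set E) (u : E → ℝ) (G : E → E) (H : E → E →L[ℝ] E), MASol Ω u G H →
    ∀ y ∈ Ω, ∀ t > 0, IsCompact {x ∈ Ω | breg u G x y ≤ 2 * t} →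
    (∀ x ∈ Ω, breg u G x y ≤ 2 * t → ∀ x' ∈ Ω, breg u G x' y ≤ 2 * t →
      (H x).det ≤ κ * (H x').det) →
    ∃ A : E ≃L[ℝ] E,
      (∀ b ∈ Ω, breg u G b y ≤ 2 * t → ‖A.symm (b - y)‖ ≤ Real.sqrt (finrank ℝ E)) ∧
      (∀ x ∈ Ω, breg u G x y ≤ t → ∀ v, ‖v‖ ≤ c →
        x + A v ∈ Ω ∧ breg u G (x + A v) y ≤ 2 * t) := by
  have hn : (0:ℝ) < finrank ℝ E := by exact_mod_cast Module.finrank_pos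
  obtain ⟨c, hc, hdepth⟩ := exists_depth (E := E) (Real.sqrt (finrank ℝ E))
    (κ * (3 / (1 / (2 * finrank ℝ E)) ^ 2) ^ finrank ℝ E) (by positivity) (by positivity)
  refine ⟨c, hc, ?_⟩
  intro Ω u G H hu y hy t ht hS hosc
  -- a small ball around `y` inside the section
  obtain ⟨r, hr, hrS⟩ : ∃ r > 0, ∀ v, ‖v‖ ≤ r → y + v ∈ Ω ∧ breg u G (y + v) y ≤ 2 * t := by
    have h1 : ∀ᶠ x in 𝓝 y, x ∈ Ω ∧ breg u G x y < 2 * t := by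
      refine (show ∀ᶠ x in 𝓝 y, x ∈ Ω from hu.isOpen.mem_nhds hy).and ((hu.continuousOn_breg_left.continuousAt
        (hu.isOpen.mem_nhds hy)).eventually_lt_const ?_)
      simp only [breg_self]; positivity
    obtain ⟨r, hr, h2⟩ := Metric.eventually_nhds_iff.1 h1
    refine ⟨r / 2, by positivity, fun v hv => ?_⟩
    have := h2 (y := y + v) (by rw [dist_eq_norm]; simp; linarith)
    exact ⟨this.1, this.2.le⟩
  have hS' : IsCompact ((fun x => y + x) ⁻¹' {x ∈ Ω | breg u G x y ≤ 2 * t}) :=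
    (Homeomorph.addLeft y).isCompact_preimage.2 hS
  obtain ⟨A, hA1, hA2⟩ := exists_max_simplex hS' hr fun v hv => hrS v (by simpa using hv)
  have hc0 : 0 < 1 / (2 * t) := by positivity
  have hb : ∀ x, breg (fun x => 1 / (2 * t) * u (y + A x)) (affG y A (1 / (2 * t)) G) x 0 =
      1 / (2 * t) * breg u G (y + A x) y := by
    intro x
    rw [breg_affine]
    simp
  have hle : ∀ x s, breg (fun x => 1 / (2 * t) * u (y + A x)) (affG y A (1 / (2 * t)) G) x 0 ≤ s ↔
      breg u G (y + A x) y ≤ 2 * t * s := by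
    intro x s
    rw [hb, one_div, inv_mul_le_iff₀ (by positivity)]
  have hn1 : ∀ b ∈ Ω, breg u G b y ≤ 2 * t → ‖A.symm (b - y)‖ ≤ Real.sqrt (finrank ℝ E) := by
    intro b hb hb2
    refine hA2 _ ?_
    simpa using ⟨hb, hb2⟩
  refine ⟨A, hn1, ?_⟩
  have hu' := hu.affine y A hc0
  have h0Ω : (0:E) ∈ (fun x => y + A x) ⁻¹' Ω := by simpa using hy
  have hcomp : IsCompact {x ∈ (fun x => y + A x) ⁻¹' Ω |
      breg (fun x => 1 / (2 * t) * u (y + A x)) (affG y A (1 / (2 * t)) G) x 0 ≤ 1} := by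
    have h2 : IsCompact (A ⁻¹' ((fun x => y + x) ⁻¹' {x ∈ Ω | breg u G x y ≤ 2 * t})) :=
      A.toHomeomorph.isCompact_preimage.2 hS'
    convert h2 using 1
    ext x
    simp only [mem_ofPred_eq, mem_preimage, hle, mul_one]
  have hball := closedBall_subset_of_simplex (hu'.convex_sublevel 0 1)
    ⟨h0Ω, by rw [breg_self]; norm_num⟩ (fun i => by
      have := hA1 i
      simp only [mem_ofPred_eq, mem_preimage, hle, mul_one] at this ⊢
      exact this)
  obtain ⟨p, hp, hpdet⟩ := hu'.exists_det_le (by positivity) h0Ω (fun x hx => (hball hx).1)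
    fun x hx => (hball hx).2
  have hp' := hball hp
  have key := hdepth _ _ _ _ hu' 0 h0Ω hcomp (fun x hx hx1 => by
      rw [hle, mul_one] at hx1
      have := hn1 _ hx hx1
      simpa using this) (fun x hx hx1 => by
      refine le_trans ?_ (mul_le_mul_of_nonneg_left hpdet hκ.le)
      rw [hle, mul_one] at hx1
      have h2 := hp'.2
      rw [hle, mul_one] at h2
      have := hosc _ hx hx1 _ hp'.1 h2
      rw [det_affH, det_affH]
      calc _ ≤ (1 / (2 * t)) ^ finrank ℝ E * (A : E →L[ℝ] E).det ^ 2 *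
            (κ * (H (y + A p)).det) := mul_le_mul_of_nonneg_left this (by positivity)
        _ = _ := by ring)
  intro x hx hx1 v hv
  have := key (A.symm (x - y)) (by simpa using hx) (by rw [hle]; simp only [map_sub, A.apply_symm_apply, add_sub_cancel]; linarith) v hv
  rw [hle] at this
  have e : y + A (A.symm (x - y) + v) = x + A v := by simp; abel
  simp only [mem_preimage, e, mul_one] at this
  exact this

/-- Engulfing-type estimates for sections. -/
lemma exists_section_estimates [Nontrivial E] (κ : ℝ) (hκ : 0 < κ) : ∃ C > (0:ℝ), ∃ c > (0:ℝ),
    ∀ (Ω : Set E) (u : E → ℝ) (G : E → E) (H : E → E →L[ℝ] E), MASol Ω u G H →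
    ∀ y ∈ Ω, ∀ t > 0, IsCompact {x ∈ Ω | breg u G x y ≤ 2 * t} →
    (∀ x ∈ Ω, breg u G x y ≤ 2 * t → ∀ x' ∈ Ω, breg u G x' y ≤ 2 * t →
      (H x).det ≤ κ * (H x').det) →
    ∀ x ∈ Ω, breg u G x y ≤ t →
      (∀ b ∈ Ω, breg u G b y ≤ 2 * t → |⟪G x - G y, b - y⟫| ≤ C * t) ∧
      (y + (1 + c) • (x - y) ∈ Ω ∧ breg u G (y + (1 + c) • (x - y)) y ≤ 2 * t) := by
  obtain ⟨c, hc, hnorm⟩ := exists_normalization (E := E) κ hκ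
  have hn : (0:ℝ) < finrank ℝ E := by exact_mod_cast Module.finrank_pos
  set R := Real.sqrt (finrank ℝ E) with hR
  have hR0 : 0 < R := Real.sqrt_pos.2 hn
  refine ⟨2 * R / c, by positivity, c / R, by positivity, ?_⟩
  intro Ω u G H hu y hy t ht hS hosc x hx hxt
  obtain ⟨A, hA1, hA2⟩ := hnorm Ω u G H hu y hy t ht hS hosc
  have hscale : ∀ b ∈ Ω, breg u G b y ≤ 2 * t → ‖(c / R) • A.symm (b - y)‖ ≤ c := by
    intro b hb hb2
    rw [norm_smul, Real.norm_of_nonneg (by positivity)]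
    calc c / R * ‖A.symm (b - y)‖ ≤ c / R * R :=
          mul_le_mul_of_nonneg_left (hA1 b hb hb2) (by positivity)
      _ = c := by field_simp
  have hin : ∀ v, ‖v‖ ≤ c → ⟪G x - G y, A v⟫ ≤ 2 * t := by
    intro v hv
    obtain ⟨h1, h2⟩ := hA2 x hx hxt v hv
    have h3 := breg_three (u := u) (G := G) (x + A v) y x
    have h4 := hu.breg_nonneg h1 hx
    have h5 := hu.breg_nonneg hx hy
    have e : ⟪x + A v - x, G y - G x⟫ = - ⟪G x - G y, A v⟫ := by
      rw [add_sub_cancel_left, real_inner_comm, ← inner_neg_left, neg_sub]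
    rw [e] at h3
    linarith
  constructor
  · intro b hb hb2
    have h1 := hin _ (hscale b hb hb2)
    have h2 := hin (-((c / R) • A.symm (b - y))) (by rw [norm_neg]; exact hscale b hb hb2)
    simp only [map_neg, map_smul, A.apply_symm_apply, inner_neg_right, inner_smul_right] at h1 h2
    have h3 : c / R * |⟪G x - G y, b - y⟫| ≤ 2 * t := by
      rcases abs_cases ⟪G x - G y, b - y⟫ with ⟨h, -⟩ | ⟨h, -⟩ <;> rw [h] <;> linarith
    have h4 : |⟪G x - G y, b - y⟫| = R / c * (c / R * |⟪G x - G y, b - y⟫|) := by field_simp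
    rw [h4]
    calc R / c * (c / R * |⟪G x - G y, b - y⟫|) ≤ R / c * (2 * t) :=
          mul_le_mul_of_nonneg_left h3 (by positivity)
      _ = _ := by ring
  · have h1 := hA2 x hx hxt _ (hscale x hx (by linarith))
    have e : x + A ((c / R) • A.symm (x - y)) = y + (1 + c / R) • (x - y) := by
      simp only [map_smul, A.apply_symm_apply]; module
    rwa [e] at h1

end Geometry

section Barrier
set_option linter.unusedSectionVars false
open Module (finrank)
open Filter Topology
variable {E : Type*} [NormedAddCommGroup E] [InnerProductSpace ℝ E] [FiniteDimensional ℝ E]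
variable {Ω : Set E} {u w : E → ℝ} {G Gw : E → E} {H Hw : E → E →L[ℝ] E}

/-- A local inverse of the gradient map. -/
lemma MASol.exists_local_inverse (hu : MASol Ω u G H) {y : E} (hy : y ∈ Ω) :
    ∃ Y : E → E, Y (G y) = y ∧ ∀ᶠ p in 𝓝 (G y), Y p ∈ Ω ∧ G (Y p) = p ∧
      ∃ B : E →L[ℝ] E, HasFDerivAt Y B p ∧ (∀ v, B (H (Y p) v) = v) := by
  have hdet : ∀ x ∈ Ω, (H x).det ≠ 0 := fun x hx => (hu.det_pos x hx).ne'
  have hstrict : HasStrictFDerivAt G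
      ((H y).toContinuousLinearEquivOfDetNeZero (hdet y hy) : E →L[ℝ] E) y := by
    rw [ContinuousLinearMap.coe_toContinuousLinearEquivOfDetNeZero]
    refine hasStrictFDerivAt_of_hasFDerivAt_of_continuousAt (f' := H) ?_
      (hu.cont.continuousAt (hu.isOpen.mem_nhds hy))
    filter_upwards [hu.isOpen.mem_nhds hy] with x hx using hu.hess x hx
  set Φ := hstrict.toOpenPartialHomeomorph with hΦ
  have hΦG : ∀ x, Φ x = G x := fun x => rfl
  have hsrc : y ∈ Φ.source := hstrict.mem_toOpenPartialHomeomorph_source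
  have htgt : G y ∈ Φ.target := Φ.map_source hsrc
  have hinv : Φ.symm (G y) = y := Φ.left_inv hsrc
  refine ⟨Φ.symm, hinv, ?_⟩
  have h1 : ∀ᶠ p in 𝓝 (G y), Φ.symm p ∈ Ω := by
    have := Φ.symm.continuousAt (x := G y) htgt
    refine this.eventually_mem ?_
    rw [hinv]; exact hu.isOpen.mem_nhds hy
  filter_upwards [h1, Φ.open_target.mem_nhds htgt] with p hp hpt
  refine ⟨hp, Φ.right_inv hpt, _, Φ.hasFDerivAt_symm
    (f' := (H (Φ.symm p)).toContinuousLinearEquivOfDetNeZero (hdet _ hp)) hpt ?_, fun v => ?_⟩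
  · rw [ContinuousLinearMap.coe_toContinuousLinearEquivOfDetNeZero]
    exact hu.hess _ hp
  · exact ((H (Φ.symm p)).toContinuousLinearEquivOfDetNeZero (hdet _ hp)).symm_apply_apply v

/-- The second-order condition at a minimum of the doubled functional, in one direction. -/
lemma MASol.doubled_second_order (hu : MASol Ω u G H) {W : Set E} (hW : IsOpen W)
    (hw : C2On W w Gw Hw) {x1 y1 y0 : E} (hx1 : x1 ∈ Ω) (hx1W : x1 ∈ W) (hy1 : y1 ∈ Ω)
    {g g1 : ℝ → ℝ} {g2 κ : ℝ}
    (hg : ∀ᶠ z in 𝓝 ⟪x1 - y0, G y1 - G y0⟫, HasDerivAt g (g1 z) z)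
    (hg1 : HasDerivAt g1 g2 ⟪x1 - y0, G y1 - G y0⟫)
    (hmin : IsLocalMin (fun q : E × E => w q.1 + g ⟪q.1 - y0, G q.2 - G y0⟫ +
      κ * breg u G q.1 q.2) (x1, y1)) (ξ ζ : E) :
    0 ≤ ⟪Hw x1 ξ, ξ⟫ + (g2 * (⟪ξ, G y1 - G y0⟫ + ⟪x1 - y0, H y1 ζ⟫) ^ 2 +
      g1 ⟪x1 - y0, G y1 - G y0⟫ * (2 * ⟪ξ, H y1 ζ⟫)) +
      κ * (⟪H x1 ξ, ξ⟫ + ⟪H y1 ζ, ζ⟫ - 2 * ⟪ξ, H y1 ζ⟫) := by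
  obtain ⟨Y, hY0, hYe⟩ := hu.exists_local_inverse hy1
  set η := H y1 ζ with hη
  set p1 := G y1 with hp1
  have hpe : Tendsto (fun t : ℝ => p1 + t • η) (𝓝 0) (𝓝 p1) := by
    have : ContinuousAt (fun t : ℝ => p1 + t • η) 0 := by fun_prop
    simpa [ContinuousAt] using this
  have hxe : Tendsto (fun t : ℝ => x1 + t • ξ) (𝓝 0) (𝓝 x1) := by
    have : ContinuousAt (fun t : ℝ => x1 + t • ξ) 0 := by fun_prop
    simpa [ContinuousAt] using this
  set Z : ℝ → ℝ := fun t => ⟪x1 + t • ξ - y0, p1 + t • η - G y0⟫ with hZ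
  set Z' : ℝ → ℝ := fun t => ⟪x1 + t • ξ - y0, η⟫ + ⟪ξ, p1 + t • η - G y0⟫ with hZ'
  have hZd : ∀ t, HasDerivAt Z (Z' t) t := fun t =>
    ((hasDerivAt_line x1 ξ t).sub_const y0).inner ℝ ((hasDerivAt_line p1 η t).sub_const (G y0))
  have hZ'd : HasDerivAt Z' (2 * ⟪ξ, η⟫) 0 := by
    have h1 := (((hasDerivAt_line x1 ξ 0).sub_const y0).inner ℝ (hasDerivAt_const (0:ℝ) η)).add
      ((hasDerivAt_const (0:ℝ) ξ).inner ℝ ((hasDerivAt_line p1 η 0).sub_const (G y0)))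
    refine h1.congr_deriv ?_
    simp; ring
  have hZ0 : Z 0 = ⟪x1 - y0, p1 - G y0⟫ := by simp [hZ]
  set φ : ℝ → ℝ := fun t => w (x1 + t • ξ) + g (Z t) + κ * (u (x1 + t • ξ) - u (Y (p1 + t • η))
    - ⟪p1 + t • η, x1 + t • ξ - Y (p1 + t • η)⟫) with hφ
  set φ' : ℝ → ℝ := fun t => ⟪Gw (x1 + t • ξ), ξ⟫ + g1 (Z t) * Z' t + κ * (⟪G (x1 + t • ξ), ξ⟫
    - (⟪p1 + t • η, ξ⟫ + ⟪η, x1 + t • ξ - Y (p1 + t • η)⟫)) with hφ'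
  have hgZ : ∀ᶠ t in 𝓝 (0:ℝ), HasDerivAt g (g1 (Z t)) (Z t) := by
    have : Tendsto Z (𝓝 0) (𝓝 ⟪x1 - y0, p1 - G y0⟫) := by
      rw [← hZ0]; exact (hZd 0).continuousAt
    exact this.eventually hg
  have d1 : ∀ᶠ t in 𝓝 (0:ℝ), HasDerivAt φ (φ' t) t := by
    filter_upwards [C2On.eventually_line hu.isOpen hx1 ξ, C2On.eventually_line hW hx1W ξ, hgZ,
      hpe.eventually hYe] with t h1 h2 h3 h4
    obtain ⟨h5, h6, B, hB, -⟩ := h4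
    have hy := hB.comp_hasDerivAt t (hasDerivAt_line p1 η t)
    have huY := (hu.grad _ h5).comp_hasDerivAt t hy
    have hd := ((hw.deriv_line h2).add (h3.comp t (hZd t))).add
      ((((hu.toC2On.deriv_line h1).sub huY).sub
        ((hasDerivAt_line p1 η t).inner ℝ ((hasDerivAt_line x1 ξ t).sub hy))).const_mul κ)
    refine hd.congr_deriv ?_
    simp only [hφ', h6, innerSL_apply_apply, inner_sub_right, Function.comp_def, Pi.sub_apply]
    ring
  have d2 : HasDerivAt φ' (⟪Hw x1 ξ, ξ⟫ + (g2 * (⟪ξ, p1 - G y0⟫ + ⟪x1 - y0, η⟫) ^ 2 +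
      g1 ⟪x1 - y0, p1 - G y0⟫ * (2 * ⟪ξ, η⟫)) +
      κ * (⟪H x1 ξ, ξ⟫ + ⟪η, ζ⟫ - 2 * ⟪ξ, η⟫)) 0 := by
    obtain ⟨h5, h6, B, hB, hB2⟩ := hYe.self_of_nhds
    have hBη : B η = ζ := by rw [← hB2 ζ, hY0]
    have hy : HasDerivAt (fun t : ℝ => Y (p1 + t • η)) (B η) 0 := by
      have hB' : HasFDerivAt Y B (p1 + (0:ℝ) • η) := by simpa using hB
      exact hB'.comp_hasDerivAt (0:ℝ) (hasDerivAt_line p1 η 0)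
    have k1 := (hw.deriv_grad_line (x := x1) (v := ξ) (t := 0) (by simpa using hx1W)).inner ℝ
      (hasDerivAt_const (0:ℝ) ξ)
    have k2 := (hu.toC2On.deriv_grad_line (x := x1) (v := ξ) (t := 0) (by simpa using hx1)).inner ℝ
      (hasDerivAt_const (0:ℝ) ξ)
    have hg1' : HasDerivAt g1 g2 (Z 0) := by rw [hZ0]; exact hg1
    have k3 := (hg1'.comp (0:ℝ) (hZd 0)).mul hZ'd
    have k4 := (hasDerivAt_line p1 η 0).inner ℝ (hasDerivAt_const (0:ℝ) ξ)
    have k5 := (hasDerivAt_const (0:ℝ) η).inner ℝ ((hasDerivAt_line x1 ξ 0).sub hy)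
    refine ((k1.add k3).add ((k2.sub (k4.add k5)).const_mul κ)).congr_deriv ?_
    simp only [hZ0, hZ', hBη, Function.comp_def, zero_smul, add_zero, inner_zero_right,
      inner_zero_left, zero_add, inner_sub_right, inner_sub_left, real_inner_comm]
    ring
  have hlm : IsLocalMin φ 0 := by
    have hcurve : Tendsto (fun t : ℝ => (x1 + t • ξ, Y (p1 + t • η))) (𝓝 0) (𝓝 (x1, y1)) := by
      refine hxe.prodMk_nhds ?_
      obtain ⟨-, -, B, hB, -⟩ := hYe.self_of_nhds
      have := hB.continuousAt.tendsto
      rw [hY0] at this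
      exact this.comp hpe
    filter_upwards [hcurve.eventually hmin, hpe.eventually hYe] with t h1 h2
    simp only [breg, h2.2.1] at h1
    simpa [hφ, hZ, hY0] using h1
  have := second_deriv_nonneg d1 d2 hlm
  exact this

/-- The second-order condition at a minimum of the doubled functional, in a common frame. -/
lemma MASol.doubled_frame (hu : MASol Ω u G H) {W : Set E} (hW : IsOpen W)
    (hw : C2On W w Gw Hw) {x1 y1 y0 : E} (hx1 : x1 ∈ Ω) (hx1W : x1 ∈ W) (hy1 : y1 ∈ Ω)
    {g g1 : ℝ → ℝ} {g2 κ : ℝ}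
    (hg : ∀ᶠ z in 𝓝 ⟪x1 - y0, G y1 - G y0⟫, HasDerivAt g (g1 z) z)
    (hg1 : HasDerivAt g1 g2 ⟪x1 - y0, G y1 - G y0⟫)
    (hmin : IsLocalMin (fun q : E × E => w q.1 + g ⟪q.1 - y0, G q.2 - G y0⟫ +
      κ * breg u G q.1 q.2) (x1, y1)) :
    ∃ l P X : Fin (finrank ℝ E) → ℝ, (∀ i, 0 < l i) ∧
      2 * ∑ i, Real.log (l i) = Real.log (H y1).det - Real.log (H x1).det ∧
      ∑ i, P i * X i = ⟪x1 - y0, G y1 - G y0⟫ ∧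
      0 ≤ linMA (H x1 : E →ₗ[ℝ] E) (Hw x1 : E →ₗ[ℝ] E) + g2 * ∑ i, (P i + l i * X i) ^ 2 +
        2 * g1 ⟪x1 - y0, G y1 - G y0⟫ * ∑ i, l i + 2 * κ * (finrank ℝ E - ∑ i, l i) := by
  obtain ⟨ξ, l, hA, hB, hdet, htr, hexp, hξ, hBl⟩ := exists_frame (hu.posDef hx1) (hu.posDef hy1).1
  have hl : ∀ i, 0 < l i := fun i => by rw [← hBl i]; exact (hu.posDef hy1).2 _ (hξ i)
  have hsl : ∀ i, 0 < Real.sqrt (l i) := fun i => Real.sqrt_pos.2 (hl i)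
  have hBA : ∀ i, H y1 (ξ i) = l i • H x1 (ξ i) := by
    intro i
    refine ext_inner_left ℝ fun x => ?_
    rw [real_inner_comm, real_inner_comm (l i • H x1 (ξ i)) x, hexp x, hexp x]
    refine Finset.sum_congr rfl fun j _ => ?_
    congr 1
    have h1 := hB i j
    have h2 := hA i j
    simp only [ContinuousLinearMap.coe_coe] at h1 h2
    rw [real_inner_comm, real_inner_comm (l i • _), h1, inner_smul_left, h2]
    simp
  refine ⟨fun i => Real.sqrt (l i), fun i => ⟪ξ i, G y1 - G y0⟫, fun i => ⟪H x1 (ξ i), x1 - y0⟫,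
    hsl, ?_, ?_, ?_⟩
  · have hp : 0 < ∏ i, l i := Finset.prod_pos fun i _ => hl i
    simp only [ContinuousLinearMap.det]
    rw [hdet, Real.log_mul (hu.posDef hx1).det_pos.ne' hp.ne', Real.log_prod (fun i _ => (hl i).ne'),
      Finset.mul_sum, add_sub_cancel_left]
    refine Finset.sum_congr rfl fun i _ => ?_
    rw [Real.log_sqrt (hl i).le]; ring
  · rw [real_inner_comm]
    exact (hexp _ _).symm
  · have hdir : ∀ i, 0 ≤ ⟪Hw x1 (ξ i), ξ i⟫ +
        (g2 * (⟪ξ i, G y1 - G y0⟫ + Real.sqrt (l i) * ⟪H x1 (ξ i), x1 - y0⟫) ^ 2 +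
          g1 ⟪x1 - y0, G y1 - G y0⟫ * (2 * Real.sqrt (l i))) + κ * (1 + 1 - 2 * Real.sqrt (l i)) := by
      intro i
      have h := hu.doubled_second_order hW hw hx1 hx1W hy1 hg hg1 hmin (ξ i)
        ((Real.sqrt (l i))⁻¹ • ξ i)
      have hss := Real.mul_self_sqrt (hl i).le
      have e1 : H y1 ((Real.sqrt (l i))⁻¹ • ξ i) = Real.sqrt (l i) • H x1 (ξ i) := by
        rw [map_smul, hBA, smul_smul]
        congr 1
        have := (hsl i).ne'
        field_simp
        nlinarith
      have e2 := hA i i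
      simp only [ContinuousLinearMap.coe_coe, if_true] at e2
      rw [e1] at h
      simp only [inner_smul_left, inner_smul_right, e2, real_inner_comm (H x1 (ξ i)) (ξ i),
        real_inner_comm (H x1 (ξ i)) (x1 - y0)] at h
      have e3 : (Real.sqrt (l i)) * (Real.sqrt (l i))⁻¹ = 1 := mul_inv_cancel₀ (hsl i).ne'
      simp only [conj_trivial, mul_one] at h
      rw [mul_comm (Real.sqrt (l i))⁻¹, e3] at h
      exact h
    have hsum := Finset.sum_nonneg fun i (_ : i ∈ Finset.univ) => hdir i
    rw [htr]
    simp only [ContinuousLinearMap.coe_coe]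
    simp only [Finset.sum_add_distrib, ← Finset.mul_sum, Finset.sum_sub_distrib] at hsum
    simp at hsum
    linarith

lemma half_le_of_sub_one_sub_log_le {l : ℝ} (hl : 0 < l) (h : l - 1 - Real.log l ≤ 3 / 100) :
    1 / 2 ≤ l := by
  by_contra hlt
  push Not at hlt
  have hs : 0 < Real.sqrt l := Real.sqrt_pos.2 hl
  have hss := Real.mul_self_sqrt hl.le
  have h1 := Real.log_le_sub_one_of_pos hs
  have h2 : Real.log l = 2 * Real.log (Real.sqrt l) := by rw [Real.log_sqrt hl.le]; ring
  have h3 : Real.sqrt l < 3 / 4 := by nlinarith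
  nlinarith

lemma two_mul_le_sq_add {p x l : ℝ} (hl : 1 / 2 ≤ l) : 2 * (p * x) ≤ (p + l * x) ^ 2 := by
  rcases le_or_gt 0 (p * x) with h2 | h2
  · have := mul_le_mul_of_nonneg_right hl h2
    nlinarith [sq_nonneg (p - l * x)]
  · nlinarith [sq_nonneg (p + l * x)]

lemma barrier_arith_large {n a μ γ κ Q S L : ℝ} (hn : 0 ≤ n) (ha : 0 < a) (hμ : 0 < μ)
    (hγ0 : 0 < γ) (hγ1 : γ ≤ μ * a) (hQ : 0 ≤ Q)
    (hκ : μ * (100 * (2 * a * (n + 1) + 2)) ≤ κ) (hL : L ≤ μ) (hS : 1 / 50 ≤ S - n)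
    (hm : 0 ≤ L + -a * γ * Q + 2 * γ * S + 2 * κ * (n - S)) : False := by
  obtain ⟨δ, rfl⟩ : ∃ δ, S = n + δ := ⟨S - n, by ring⟩
  rw [add_sub_cancel_left] at hS
  have k1 : 0 ≤ a * γ * Q := by positivity
  have k2 : 0 ≤ (μ * a - γ) * (n + δ) := mul_nonneg (by linarith) (by linarith)
  have k3 : 0 ≤ (κ - μ * (100 * (2 * a * (n + 1) + 2))) * δ :=
    mul_nonneg (by linarith) (by linarith)
  have k5 : 0 ≤ μ * a * (δ - 1 / 50) := mul_nonneg (by positivity) (by linarith)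
  have k6 : 0 ≤ μ * a * n * (δ - 1 / 50) := mul_nonneg (by positivity) (by linarith)
  have k7 : 0 ≤ μ * (δ - 1 / 50) := mul_nonneg hμ.le (by linarith)
  have k8 : 0 ≤ μ * a * n := by positivity
  have k9 : 0 < μ * a := by positivity
  linarith

lemma barrier_arith_small {n a s γ κ Q S L m : ℝ} (ha : 0 < a) (hγ0 : 0 < γ)
    (hγ : m ≤ γ) (has : a * s = 2 * n + 4) (hQ : s ≤ Q) (hL : L ≤ m / 2)
    (hκ : κ * (n - S) ≤ m / 2) (hS : S ≤ n + 1)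
    (hm : 0 ≤ L + -a * γ * Q + 2 * γ * S + 2 * κ * (n - S)) : False := by
  have k1 : 0 ≤ a * γ * (Q - s) := mul_nonneg (by positivity) (by linarith)
  have k2 : γ * (a * s) = γ * (2 * n + 4) := by rw [has]
  have k3 : 0 ≤ γ * (n + 1 - S) := mul_nonneg hγ0.le (by linarith)
  linarith

/-- A supersolution which is large in a small section is large in the whole section. -/
lemma barrier {s t : ℝ} (hs : 0 < s) (ht : 0 < t) :
    ∃ ε0 > (0:ℝ), ∃ c0 > (0:ℝ), ∃ c1 > (0:ℝ),
    ∀ (Ω : Set E) (u : E → ℝ) (G : E → E) (H : E → E →L[ℝ] E), MASol Ω u G H →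
    ∀ y0 ∈ Ω, IsCompact {x ∈ Ω | breg u G x y0 ≤ 2 * t + 1} →
    IsCompact {y ∈ Ω | breg u G y0 y ≤ 2 * t + 1} →
    (∀ x ∈ Ω, breg u G x y0 ≤ 2 * t + 1 → ∀ y ∈ Ω, breg u G y0 y ≤ 2 * t + 1 →
      Real.log (H x).det - ε0 ≤ Real.log (H y).det) →
    ∀ (W : Set E) (w : E → ℝ) (Gw : E → E) (Hw : E → E →L[ℝ] E), IsOpen W → C2On W w Gw Hw →
    {x ∈ Ω | breg u G x y0 ≤ 2 * t + 1} ⊆ W →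
    ∀ μ ω : ℝ, 0 < μ → ω ≤ c0 * μ →
    (∀ x ∈ Ω, breg u G x y0 ≤ 2 * t + 1 → 0 ≤ w x ∧
      linMA (H x : E →ₗ[ℝ] E) (Hw x : E →ₗ[ℝ] E) ≤ ω) →
    (∀ x ∈ Ω, breg u G x y0 ≤ s → μ ≤ w x) →
    ∀ x ∈ Ω, ⟪x - y0, G x - G y0⟫ ≤ t → c1 * μ ≤ w x := by
  set n : ℝ := (finrank ℝ E : ℝ) with hn
  have hn0 : 0 ≤ n := Nat.cast_nonneg _
  set a : ℝ := (2 * n + 4) / s with ha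
  have ha0 : 0 < a := by positivity
  set q : ℝ := a * Real.exp (-(a * (2 * t))) with hq
  have hq0 : 0 < q := by positivity
  set e0 : ℝ := min (min 1 (s / 2)) (1 / (100 * (2 * a * (n + 1) + 2))) with he0
  have he0p : 0 < e0 := by positivity
  have he1 : e0 ≤ 1 := (min_le_left _ _).trans (min_le_left _ _)
  have he2 : e0 ≤ s / 2 := (min_le_left _ _).trans (min_le_right _ _)
  have he3 : 100 * (2 * a * (n + 1) + 2) ≤ 1 / e0 := by
    rw [le_one_div (by positivity) he0p]
    exact min_le_right _ _
  refine ⟨min (1 / 50) (e0 * q), by positivity, min 1 (q / 2), by positivity,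
    Real.exp (-(a * t)) - Real.exp (-(a * (2 * t))), ?_, ?_⟩
  · rw [gt_iff_lt, sub_pos, Real.exp_lt_exp]
    nlinarith [mul_pos ha0 ht]
  intro Ω u G H hu y0 hy0 hK1 hK2 hosc W w Gw Hw hW hw hKW μ ω hμ hω hwK hws x hx hxt
  set K1 := {x ∈ Ω | breg u G x y0 ≤ 2 * t + 1} with hK1d
  set K2 := {y ∈ Ω | breg u G y0 y ≤ 2 * t + 1} with hK2d
  set κ := μ / e0 with hκ
  have hκ0 : 0 < κ := by positivity
  set g : ℝ → ℝ := fun z => -μ * (Real.exp (-(a * max z 0)) - Real.exp (-(a * (2 * t)))) with hgd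
  set Ψ : E × E → ℝ := fun q => w q.1 + g ⟪q.1 - y0, G q.2 - G y0⟫ + κ * breg u G q.1 q.2 with hΨ
  have hsum := breg_add_swap (u := u) (G := G) x y0
  have hb1 := hu.breg_nonneg hx hy0
  have hb2 := hu.breg_nonneg hy0 hx
  have hxK1 : x ∈ K1 := ⟨hx, by linarith⟩
  have hxK2 : x ∈ K2 := ⟨hx, by linarith⟩
  have hcont : ContinuousOn Ψ (K1 ×ˢ K2) := by
    have f1 : ContinuousOn (fun q : E × E => w q.1) (K1 ×ˢ K2) :=
      (hw.continuousOn_fun.mono hKW).comp continuousOn_fst fun p hp => hp.1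
    have f2 : ContinuousOn (fun q : E × E => G q.2) (K1 ×ˢ K2) :=
      hu.toC2On.continuousOn_grad.comp continuousOn_snd fun p hp => hp.2.1
    have f3 : ContinuousOn (fun q : E × E => breg u G q.1 q.2) (K1 ×ˢ K2) :=
      hu.continuousOn_breg.mono fun p hp => ⟨hp.1.1, hp.2.1⟩
    have f4 : Continuous g := by fun_prop
    exact (f1.add (f4.comp_continuousOn ((continuousOn_fst.sub continuousOn_const).inner
      (f2.sub continuousOn_const)))).add (continuousOn_const.mul f3)
  obtain ⟨⟨x1, y1⟩, ⟨⟨hx1, hx1t⟩, hy1, hy1t⟩, hmin⟩ :=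
    (hK1.prod hK2).exists_isMinOn ⟨(x, x), hxK1, hxK2⟩ hcont
  simp only at hx1 hx1t hy1 hy1t
  rcases le_or_gt 0 (Ψ (x1, y1)) with hnn | hneg
  · have h1 : 0 ≤ Ψ (x, x) := hnn.trans (hmin (a := (x, x)) ⟨hxK1, hxK2⟩)
    simp only [hΨ, breg_self, hgd] at h1
    have h2 : max ⟪x - y0, G x - G y0⟫ 0 ≤ t := max_le hxt ht.le
    have h3 : Real.exp (-(a * t)) ≤ Real.exp (-(a * max ⟪x - y0, G x - G y0⟫ 0)) :=
      Real.exp_le_exp.2 (neg_le_neg (mul_le_mul_of_nonneg_left h2 ha0.le))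
    nlinarith [mul_le_mul_of_nonneg_left h3 hμ.le]
  exfalso
  set Z := ⟪x1 - y0, G y1 - G y0⟫ with hZ
  have hD : 0 ≤ breg u G x1 y1 := hu.breg_nonneg hx1 hy1
  obtain ⟨hw0, hLw⟩ := hwK x1 hx1 hx1t
  have hneg' : w x1 + κ * breg u G x1 y1 <
      μ * (Real.exp (-(a * max Z 0)) - Real.exp (-(a * (2 * t)))) := by
    simp only [hΨ, hgd] at hneg
    linarith
  have hex1 : Real.exp (-(a * max Z 0)) ≤ 1 := by
    rw [Real.exp_le_one_iff, neg_nonpos]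
    have := le_max_right Z 0
    positivity
  have hex0 := Real.exp_pos (-(a * (2 * t)))
  have hlt1 : μ * (Real.exp (-(a * max Z 0)) - Real.exp (-(a * (2 * t)))) < μ * 1 :=
    mul_lt_mul_of_pos_left (by linarith) hμ
  have hκD := mul_nonneg hκ0.le hD
  have hDe : breg u G x1 y1 < e0 := by
    have h1 : κ * breg u G x1 y1 < κ * e0 := by
      have : κ * e0 = μ := by rw [hκ]; field_simp
      linarith
    exact lt_of_mul_lt_mul_left h1 hκ0.le
  have hZt : Z < 2 * t := by
    by_contra hge
    push Not at hge
    have : Real.exp (-(a * max Z 0)) ≤ Real.exp (-(a * (2 * t))) :=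
      Real.exp_le_exp.2 (neg_le_neg (mul_le_mul_of_nonneg_left (hge.trans (le_max_left _ _)) ha0.le))
    nlinarith
  have hid : breg u G x1 y0 + breg u G y0 y1 = breg u G x1 y1 + Z := by
    simp only [hZ, breg, inner_sub_left, inner_sub_right, real_inner_comm]; ring
  have hn1 := hu.breg_nonneg hx1 hy0
  have hn2 := hu.breg_nonneg hy0 hy1
  have hsx : s < breg u G x1 y0 := by
    by_contra hle
    push Not at hle
    have := hws x1 hx1 hle
    linarith
  have hZs : s / 2 < Z := by linarith
  have hZ0 : 0 < Z := by linarith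
  -- the second order condition
  have hlm : IsLocalMin Ψ (x1, y1) := by
    refine hmin.isLocalMin (prod_mem_nhds ?_ ?_)
    · filter_upwards [hu.isOpen.mem_nhds hx1, (hu.continuousOn_breg_left.continuousAt
        (hu.isOpen.mem_nhds hx1)).eventually_lt_const (show breg u G x1 y0 < 2 * t + 1 by linarith)]
        with p h1 h2 using ⟨h1, h2.le⟩
    · filter_upwards [hu.isOpen.mem_nhds hy1, (hu.continuousOn_breg_right.continuousAt
        (hu.isOpen.mem_nhds hy1)).eventually_lt_const (show breg u G y0 y1 < 2 * t + 1 by linarith)]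
        with p h1 h2 using ⟨h1, h2.le⟩
  have hdexp : ∀ z, HasDerivAt (fun z => Real.exp (-(a * z))) (-a * Real.exp (-(a * z))) z := by
    intro z
    have := ((hasDerivAt_id z).const_mul a).neg.exp
    refine this.congr_deriv ?_
    simp; ring
  have hg1 : ∀ᶠ z in 𝓝 Z, HasDerivAt g (μ * a * Real.exp (-(a * z))) z := by
    filter_upwards [lt_mem_nhds hZ0] with z hz
    have h1 : HasDerivAt (fun z => -μ * (Real.exp (-(a * z)) - Real.exp (-(a * (2 * t)))))
        (μ * a * Real.exp (-(a * z))) z := by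
      refine (((hdexp z).sub_const _).const_mul (-μ)).congr_deriv ?_
      ring
    refine h1.congr_of_eventuallyEq ?_
    filter_upwards [lt_mem_nhds hz] with z' hz'
    simp only [hgd, max_eq_left hz'.le]
  have hg2 : HasDerivAt (fun z => μ * a * Real.exp (-(a * z)))
      (-a * (μ * a * Real.exp (-(a * Z)))) Z := by
    refine ((hdexp Z).const_mul (μ * a)).congr_deriv ?_
    ring
  obtain ⟨l, P, X, hl, hlog, hPX, hmain⟩ :=
    hu.doubled_frame hW hw hx1 (hKW ⟨hx1, hx1t⟩) hy1 hg1 hg2 hlm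
  rw [← hZ] at hmain hPX
  rw [← hn] at hmain
  set γ := μ * a * Real.exp (-(a * Z)) with hγ
  set S := ∑ i, l i with hS
  have hγ0 : 0 < γ := by positivity
  have hγ1 : γ ≤ μ * a := by
    have : Real.exp (-(a * Z)) ≤ 1 := by
      rw [Real.exp_le_one_iff, neg_nonpos]; positivity
    exact mul_le_of_le_one_right (by positivity) this
  have hγ2 : μ * q ≤ γ := by
    have : Real.exp (-(a * (2 * t))) ≤ Real.exp (-(a * Z)) :=
      Real.exp_le_exp.2 (neg_le_neg (mul_le_mul_of_nonneg_left hZt.le ha0.le))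
    have := mul_le_mul_of_nonneg_left this (show 0 ≤ μ * a by positivity)
    rw [hγ, hq]; linarith
  have hω1 : ω ≤ μ := by
    have := mul_le_mul_of_nonneg_right (min_le_left 1 (q / 2)) hμ.le
    linarith
  have hω2 : ω ≤ μ * q / 2 := by
    have := mul_le_mul_of_nonneg_right (min_le_right 1 (q / 2)) hμ.le
    linarith
  have hεlog : -min (1 / 50) (e0 * q) ≤ 2 * ∑ i, Real.log (l i) := by
    have := hosc x1 hx1 hx1t y1 hy1 hy1t
    rw [hlog]; linarith
  have hε1 := min_le_left (1 / 50) (e0 * q)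
  have hε2 := min_le_right (1 / 50) (e0 * q)
  have hterm : ∀ i, 0 ≤ l i - 1 - Real.log (l i) := fun i => by
    have := Real.log_le_sub_one_of_pos (hl i); linarith
  have hsumterm : ∑ i, (l i - 1 - Real.log (l i)) = S - n - ∑ i, Real.log (l i) := by
    simp [Finset.sum_sub_distrib, hS, hn]
  have hSn : -min (1 / 50) (e0 * q) / 2 ≤ S - n := by
    have := Finset.sum_nonneg fun i (_ : i ∈ Finset.univ) => hterm i
    linarith
  have hsq : 0 ≤ ∑ i, (P i + l i * X i) ^ 2 := Finset.sum_nonneg fun i _ => sq_nonneg _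
  have hκe : κ = μ * (1 / e0) := by rw [hκ]; ring
  have hκbig : μ * (100 * (2 * a * (n + 1) + 2)) ≤ κ := by
    rw [hκe]; exact mul_le_mul_of_nonneg_left he3 hμ.le
  rcases le_or_gt (1 / 50) (S - n) with hbig | hsmall
  · exact barrier_arith_large hn0 ha0 hμ hγ0 hγ1 hsq hκbig (hLw.trans hω1) hbig hmain
  · have hlhalf : ∀ i, 1 / 2 ≤ l i := by
      intro i
      refine half_le_of_sub_one_sub_log_le (hl i) ?_
      have h1 := Finset.single_le_sum (f := fun i => l i - 1 - Real.log (l i))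
        (fun i _ => hterm i) (Finset.mem_univ i)
      simp only [hsumterm] at h1
      linarith
    have hsq2 : 2 * Z ≤ ∑ i, (P i + l i * X i) ^ 2 := by
      rw [← hPX, Finset.mul_sum]
      exact Finset.sum_le_sum fun i _ => two_mul_le_sq_add (hlhalf i)
    have hκq : κ * (e0 * q) = μ * q := by rw [hκ]; field_simp
    have hκq2 : κ * (n - S) ≤ κ * (e0 * q / 2) := mul_le_mul_of_nonneg_left (by linarith) hκ0.le
    exact barrier_arith_small ha0 hγ0 hγ2 (show a * s = 2 * n + 4 by
      rw [ha]; field_simp) (by linarith : s ≤ ∑ i, (P i + l i * X i) ^ 2) (hLw.trans hω2)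
      (by linarith) (by linarith) hmain

end Barrier

section LocalDensity

set_option linter.unusedSectionVars false

open Module (finrank)
open Filter Topology

variable {E : Type*} [NormedAddCommGroup E] [InnerProductSpace ℝ E] [FiniteDimensional ℝ E]
variable {Ω : Set E} {u w : E → ℝ} {G Gw : E → E} {H Hw : E → E →L[ℝ] E}

lemma MASol.injOn (hu : MASol Ω u G H) : InjOn G Ω := by
  intro x hx y hy hxy
  by_contra hne
  have h1 := hu.strict x hx y hy hne
  have h2 := hu.strict y hy x hx (Ne.symm hne)
  have h3 := breg_add_swap (u := u) (G := G) x y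
  rw [hxy, sub_self, inner_zero_right] at h3
  linarith

/-- Comparison of the volume of a set `T` with that of a set `S` of contact points. -/
lemma abp_measure [MeasurableSpace E] [BorelSpace E] (hu : MASol Ω u G H) {W : Set E}
    (hw : C2On W w Gw Hw) {S T : Set E} (hS : MeasurableSet S) (hT : MeasurableSet T)
    (hSΩ : S ⊆ Ω) (hSW : S ⊆ W) (hTΩ : T ⊆ Ω) {κ ε m M : ℝ} (hκ : 0 < κ)
    (hcov : ∀ y ∈ T, ∃ x ∈ S, Gw x + κ • (G x - G y) = 0)
    (hdT : ∀ y ∈ T, m ≤ (H y).det) (hdS : ∀ x ∈ S, (H x).det ≤ M)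
    (hpos : ∀ x ∈ S, PosSemi ((Hw x + κ • H x : E →L[ℝ] E) : E →ₗ[ℝ] E))
    (hL : ∀ x ∈ S, linMA (H x : E →ₗ[ℝ] E) (Hw x) ≤ ε * κ) :
    ENNReal.ofReal m * volume T ≤ ENNReal.ofReal (M * Real.exp ε) * volume S := by
  set F : E → E := fun x => G x + κ⁻¹ • Gw x with hF
  set F' : E → E →L[ℝ] E := fun x => H x + κ⁻¹ • Hw x with hF'
  have hGT : ∀ y ∈ T, HasFDerivWithinAt G (H y) T y := fun y hy =>
    (hu.hess y (hTΩ hy)).hasFDerivWithinAt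
  have hFS : ∀ x ∈ S, HasFDerivWithinAt F (F' x) S x := fun x hx =>
    ((hu.hess x (hSΩ hx)).add ((hw.hess x (hSW hx)).const_smul κ⁻¹)).hasFDerivWithinAt
  have himg : G '' T ⊆ F '' S := by
    rintro _ ⟨y, hy, rfl⟩
    obtain ⟨x, hx, h⟩ := hcov y hy
    refine ⟨x, hx, ?_⟩
    have h' : Gw x = κ • (G y - G x) := by
      rw [eq_neg_of_add_eq_zero_left h, ← smul_neg, neg_sub]
    simp only [hF, h', smul_smul, inv_mul_cancel₀ hκ.ne', one_smul]
    abel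
  have hdetF : ∀ x ∈ S, |(F' x).det| ≤ M * Real.exp ε := by
    intro x hx
    have hA := hu.posDef (hSΩ hx)
    have heq : ((F' x : E →L[ℝ] E) : E →ₗ[ℝ] E) =
        κ⁻¹ • ((Hw x + κ • H x : E →L[ℝ] E) : E →ₗ[ℝ] E) := by
      ext v
      simp [hF', smul_smul, inv_mul_cancel₀ hκ.ne', add_comm]
    have hB : PosSemi ((F' x : E →L[ℝ] E) : E →ₗ[ℝ] E) := by
      rw [heq]
      refine ⟨fun a b => ?_, fun v => ?_⟩
      · have := (hpos x hx).1 a b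
        simp only [LinearMap.smul_apply, inner_smul_left, inner_smul_right]
        rw [this]; simp
      · rw [LinearMap.smul_apply, inner_smul_left]
        exact mul_nonneg (by simpa using hκ.le) ((hpos x hx).2 v)
    have hlin : linMA (H x : E →ₗ[ℝ] E) ((F' x : E →L[ℝ] E) : E →ₗ[ℝ] E)
        ≤ finrank ℝ E + ε := by
      have : ((F' x : E →L[ℝ] E) : E →ₗ[ℝ] E) =
          (H x : E →ₗ[ℝ] E) + κ⁻¹ • (Hw x : E →ₗ[ℝ] E) := by ext v; simp [hF']
      rw [this, linMA_add, linMA_smul, linMA_self hA]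
      have h1 := hL x hx
      have h2 : κ⁻¹ * linMA (H x : E →ₗ[ℝ] E) (Hw x) ≤ ε := by
        rw [inv_mul_le_iff₀ hκ]; linarith
      linarith
    have h0 := det_nonneg_of_posSemi hB
    have h1 := det_le_exp_of_linMA_le hA hB hlin
    change |LinearMap.det ((F' x : E →L[ℝ] E) : E →ₗ[ℝ] E)| ≤ _
    rw [abs_of_nonneg h0]
    exact h1.trans (mul_le_mul_of_nonneg_right (hdS x hx) (Real.exp_pos _).le)
  calc ENNReal.ofReal m * volume T = ∫⁻ _ in T, ENNReal.ofReal m := by simp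
    _ ≤ ∫⁻ y in T, ENNReal.ofReal |(H y).det| :=
        setLIntegral_mono' hT fun y hy =>
          ENNReal.ofReal_le_ofReal ((hdT y hy).trans (le_abs_self _))
    _ = volume (G '' T) := lintegral_abs_det_fderiv_eq_addHaar_image volume hT hGT
        (hu.injOn.mono hTΩ)
    _ ≤ volume (F '' S) := measure_mono himg
    _ ≤ ∫⁻ x in S, ENNReal.ofReal |(F' x).det| :=
        addHaar_image_le_lintegral_abs_det_fderiv volume hS hFS
    _ ≤ ∫⁻ _ in S, ENNReal.ofReal (M * Real.exp ε) :=
        setLIntegral_mono' hS fun x hx => ENNReal.ofReal_le_ofReal (hdetF x hx)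
    _ = ENNReal.ofReal (M * Real.exp ε) * volume S := by simp

/-- A set almost filling a ball contains a centre of every short symmetric configuration. -/
lemma exists_symmetric_triple [MeasurableSpace E] [BorelSpace E] {S : Set E}
    (hS : MeasurableSet S) {ρ δ r : ℝ} (hρ : 0 < ρ)
    (hr : 0 < r) (hsub : S ⊆ closedBall 0 (ρ * r)) (hρr : ρ ≤ ρ * r)
    (hr1 : r ^ finrank ℝ E ≤ 1 + δ)
    (hvol : ENNReal.ofReal (1 - δ) * volume (closedBall (0:E) ρ) ≤ volume S)
    (hδn : 8 * δ ≤ (1 / 2) ^ finrank ℝ E) {h : E} (hh : ‖h‖ ≤ ρ / 2) :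
    ∃ x, x ∈ S ∧ x + h ∈ S ∧ x - h ∈ S := by
  set V := (volume (ball (0:E) 1)).toReal with hV
  have hVfin : volume (ball (0:E) 1) ≠ ⊤ := measure_ball_lt_top.ne
  have hV0 : 0 < V := ENNReal.toReal_pos (measure_ball_pos volume 0 one_pos).ne' hVfin
  have hball : ∀ a, 0 ≤ a → volume.real (closedBall (0:E) a) = a ^ finrank ℝ E * V := by
    intro a ha
    rw [measureReal_def, Measure.addHaar_closedBall _ _ ha, ENNReal.toReal_mul,
      ENNReal.toReal_ofReal (by positivity)]
  by_contra hno
  push Not at hno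
  set N := closedBall (0:E) (ρ * r) \ S with hN
  have hSfin : volume S ≠ ⊤ := measure_ne_top_of_subset hsub measure_closedBall_lt_top.ne
  have hNfin : volume N ≠ ⊤ := measure_ne_top_of_subset sdiff_subset measure_closedBall_lt_top.ne
  have hNv : volume.real N = (ρ * r) ^ finrank ℝ E * V - volume.real S := by
    rw [hN, measureReal_sdiff hsub hS measure_closedBall_lt_top.ne, hball _ (by positivity)]
  have hSv : (1 - δ) * (ρ ^ finrank ℝ E * V) ≤ volume.real S := by
    rcases le_total (1 - δ) 0 with h0 | h0
    · exact (mul_nonpos_of_nonpos_of_nonneg h0 (by positivity)).trans measureReal_nonneg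
    · have := ENNReal.toReal_mono hSfin hvol
      rwa [ENNReal.toReal_mul, ENNReal.toReal_ofReal h0, ← measureReal_def, ← measureReal_def,
        hball _ hρ.le] at this
  have htr : ∀ a : E, volume.real ((fun x => x + a) ⁻¹' N) = volume.real N := by
    intro a
    rw [measureReal_def, measure_preimage_add_right, measureReal_def]
  have hcover : closedBall (0:E) (ρ / 2) ⊆
      (N ∪ (fun x => x + h) ⁻¹' N) ∪ (fun x => x + -h) ⁻¹' N := by
    intro x hx
    rw [mem_closedBall_zero_iff] at hx
    have h1 : x ∈ closedBall (0:E) (ρ * r) := by rw [mem_closedBall_zero_iff]; linarith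
    have h2 : x + h ∈ closedBall (0:E) (ρ * r) := by
      rw [mem_closedBall_zero_iff]; linarith [norm_add_le x h]
    have h3 : x + -h ∈ closedBall (0:E) (ρ * r) := by
      rw [mem_closedBall_zero_iff, ← sub_eq_add_neg]; linarith [norm_sub_le x h]
    by_cases hx1 : x ∈ S
    · by_cases hx2 : x + h ∈ S
      · have := hno x hx1 hx2
        exact Or.inr ⟨h3, by simpa only [← sub_eq_add_neg] using this⟩
      · exact Or.inl (Or.inr ⟨h2, hx2⟩)
    · exact Or.inl (Or.inl ⟨h1, hx1⟩)
  have hfin : ∀ a : E, volume ((fun x => x + a) ⁻¹' N) ≠ ⊤ := by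
    intro a; rwa [measure_preimage_add_right]
  have hle : volume.real (closedBall (0:E) (ρ / 2)) ≤ 3 * volume.real N := by
    calc _ ≤ volume.real ((N ∪ (fun x => x + h) ⁻¹' N) ∪ (fun x => x + -h) ⁻¹' N) :=
          measureReal_mono hcover (measure_union_ne_top (measure_union_ne_top hNfin (hfin _))
            (hfin _))
      _ ≤ volume.real N + volume.real ((fun x => x + h) ⁻¹' N)
          + volume.real ((fun x => x + -h) ⁻¹' N) :=
          (measureReal_union_le _ _).trans (add_le_add_left (measureReal_union_le _ _) _)
      _ = 3 * volume.real N := by rw [htr, htr]; ring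
  rw [hball _ (by positivity), hNv, mul_pow, div_pow] at hle
  rw [one_div, inv_pow] at hδn
  have hP : 0 < ρ ^ finrank ℝ E * V := by positivity
  have h2 : 0 < ((2:ℝ) ^ finrank ℝ E)⁻¹ := by positivity
  have e1 : ρ ^ finrank ℝ E / 2 ^ finrank ℝ E * V
      = ((2:ℝ) ^ finrank ℝ E)⁻¹ * (ρ ^ finrank ℝ E * V) := by ring
  have e2 : ρ ^ finrank ℝ E * r ^ finrank ℝ E * V
      = r ^ finrank ℝ E * (ρ ^ finrank ℝ E * V) := by ring
  rw [e1, e2] at hle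
  set P := ρ ^ finrank ℝ E * V
  have h3 : r ^ finrank ℝ E * P ≤ (1 + δ) * P := mul_le_mul_of_nonneg_right hr1 hP.le
  have h4 : 8 * δ * P ≤ ((2:ℝ) ^ finrank ℝ E)⁻¹ * P := mul_le_mul_of_nonneg_right hδn hP.le
  have h5 := mul_pos h2 hP
  nlinarith

end LocalDensity

section LocalDensity

set_option linter.unusedSectionVars false

open Module (finrank)
open Filter Topology

variable {E : Type*} [NormedAddCommGroup E] [InnerProductSpace ℝ E] [FiniteDimensional ℝ E]
variable {Ω : Set E} {u w : E → ℝ} {G Gw : E → E} {H Hw : E → E →L[ℝ] E}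

/-- A solution whose section at the origin of height one is comparable to a ball, and whose sections
of height four around the points of `Q` stay in a compact set `Z` on which the determinant has
small oscillation. -/
structure LocalSol (R c ε : ℝ) (Ω Z Q : Set E) (u : E → ℝ) (G : E → E) (H : E → E →L[ℝ] E) :
    Prop where
  sol : MASol Ω u G H
  zero_mem : (0:E) ∈ Ω
  compact : IsCompact Z
  subset : Z ⊆ Ω
  norm_le : ∀ b ∈ Ω, breg u G b 0 ≤ 1 → ‖b‖ ≤ R
  ball : ∀ v, ‖v‖ ≤ c → v ∈ Ω ∧ breg u G v 0 ≤ 1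
  near : ∀ x ∈ Ω, breg u G x 0 ≤ 4 → x ∈ Q
  cont : ∀ x ∈ Ω, ∀ y ∈ Ω, breg u G x y ≤ 4 → (x ∈ Q ∨ y ∈ Q) → x ∈ Z ∧ y ∈ Z
  osc : ∀ x ∈ Z, ∀ y ∈ Z, Real.log (H x).det - ε ≤ Real.log (H y).det

namespace LocalSol

variable {R c ε : ℝ} {Z Q : Set E} (hl : LocalSol R c ε Ω Z Q u G H)
include hl

lemma zero_mem_Q : (0:E) ∈ Q := hl.near 0 hl.zero_mem (by rw [breg_self]; norm_num)

lemma compact_left {y : E} (hy : y ∈ Ω) (hyQ : y ∈ Q) {a : ℝ} (ha : a ≤ 4) :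
    IsCompact {x ∈ Ω | breg u G x y ≤ a} := by
  have h1 : IsClosed (Z ∩ (fun x => breg u G x y) ⁻¹' Iic a) :=
    (hl.sol.continuousOn_breg_left.mono hl.subset).preimage_isClosed_of_isClosed
      hl.compact.isClosed isClosed_Iic
  have h2 : {x ∈ Ω | breg u G x y ≤ a} = Z ∩ (fun x => breg u G x y) ⁻¹' Iic a := by
    ext x
    exact ⟨fun h => ⟨(hl.cont x h.1 y hy (h.2.trans ha) (Or.inr hyQ)).1, h.2⟩,
      fun h => ⟨hl.subset h.1, h.2⟩⟩
  rw [h2]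
  exact hl.compact.of_isClosed_subset h1 inter_subset_left

lemma compact_right {y : E} (hy : y ∈ Ω) (hyQ : y ∈ Q) {a : ℝ} (ha : a ≤ 4) :
    IsCompact {x ∈ Ω | breg u G y x ≤ a} := by
  have h1 : IsClosed (Z ∩ (fun x => breg u G y x) ⁻¹' Iic a) :=
    (hl.sol.continuousOn_breg_right.mono hl.subset).preimage_isClosed_of_isClosed
      hl.compact.isClosed isClosed_Iic
  have h2 : {x ∈ Ω | breg u G y x ≤ a} = Z ∩ (fun x => breg u G y x) ⁻¹' Iic a := by
    ext x
    exact ⟨fun h => ⟨(hl.cont y hy x h.1 (h.2.trans ha) (Or.inl hyQ)).2, h.2⟩,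
      fun h => ⟨hl.subset h.1, h.2⟩⟩
  rw [h2]
  exact hl.compact.of_isClosed_subset h1 inter_subset_left

lemma det_le {x y : E} (hx : x ∈ Z) (hy : y ∈ Z) : (H x).det ≤ Real.exp ε * (H y).det := by
  have h1 := hl.osc x hx y hy
  have hx0 := hl.sol.det_pos x (hl.subset hx)
  have hy0 := hl.sol.det_pos y (hl.subset hy)
  rw [← Real.log_le_log_iff hx0 (by positivity), Real.log_mul (Real.exp_pos _).ne' hy0.ne',
    Real.log_exp]
  linarith

lemma det_le_two (hε : ε ≤ Real.log 2) {y : E} (hy : y ∈ Ω) (hyQ : y ∈ Q) {a : ℝ} (ha : a ≤ 4) :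
    ∀ x ∈ Ω, breg u G x y ≤ a → ∀ x' ∈ Ω, breg u G x' y ≤ a → (H x).det ≤ 2 * (H x').det := by
  intro x hx hxa x' hx' hxa'
  have h1 := hl.det_le (hl.cont x hx y hy (hxa.trans ha) (Or.inr hyQ)).1
    (hl.cont x' hx' y hy (hxa'.trans ha) (Or.inr hyQ)).1
  have h2 : Real.exp ε ≤ 2 := by
    rw [← Real.exp_log (show (0:ℝ) < 2 by norm_num)]; exact Real.exp_le_exp.2 hε
  exact h1.trans (mul_le_mul_of_nonneg_right h2 (hl.sol.det_pos x' hx').le)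

end LocalSol

/-- Sections of small height around points close to the origin have small diameter. -/
lemma exists_small_sections [Nontrivial E] {R c : ℝ} (hc : 0 < c) : ∃ ρ > 0, ρ ≤ c ∧
    (∀ ε Ω Z Q u G H, ε ≤ Real.log 2 → LocalSol (E := E) R c ε Ω Z Q u G H →
      ∀ y, ‖y‖ ≤ ρ → ⟪(0:E) - y, G 0 - G y⟫ ≤ 1) ∧
    ∀ η > 0, ∃ s > 0, s ≤ 1 ∧ ∀ ε Ω Z Q u G H, ε ≤ Real.log 2 →
      LocalSol (E := E) R c ε Ω Z Q u G H →
      ∀ y, ‖y‖ ≤ ρ → ∀ x ∈ Ω, breg u G x y ≤ 2 * s → ‖x - y‖ ≤ η := by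
  obtain ⟨C, hC, b, hb, hsec⟩ := exists_section_estimates (E := E) 2 (by norm_num)
  set c3 : ℝ := 1 / (2 + C) with hc3
  have hc30 : 0 < c3 := by positivity
  have hc3le : c3 ≤ 1 / 2 := by
    rw [hc3]; exact one_div_le_one_div_of_le (by norm_num) (by linarith)
  have hc3C : (2 + C) * c3 = 1 := by rw [hc3]; field_simp
  set ρ : ℝ := min c (c3 * c / C) with hρ
  have hρ0 : 0 < ρ := lt_min hc (by positivity)
  have hρC : ρ * (C / c) ≤ c3 := by
    calc ρ * (C / c) ≤ c3 * c / C * (C / c) :=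
          mul_le_mul_of_nonneg_right (min_le_right _ _) (by positivity)
      _ = c3 := by field_simp
  have hsmall : ∀ ε Ω Z Q u G H, ε ≤ Real.log 2 → LocalSol (E := E) R c ε Ω Z Q u G H →
      ∀ y, ‖y‖ ≤ ρ → ⟪(0:E) - y, G 0 - G y⟫ ≤ c3 := by
    intro ε Ω Z Q u G H hε hl y hy
    have hyb := hl.ball y (hy.trans (min_le_left _ _))
    have hs := (hsec Ω u G H hl.sol 0 hl.zero_mem 1 one_pos
      (hl.compact_left hl.zero_mem hl.zero_mem_Q (by norm_num))
      (hl.det_le_two hε hl.zero_mem hl.zero_mem_Q (by norm_num)) y hyb.1 hyb.2).1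
    have hbd : ‖G y - G 0‖ ≤ C / c := by
      rcases eq_or_ne (G y - G 0) 0 with h0 | h0
      · rw [h0, norm_zero]; positivity
      have hn : 0 < ‖G y - G 0‖ := norm_pos_iff.2 h0
      have hb' := hl.ball ((c / ‖G y - G 0‖) • (G y - G 0)) (by
        rw [norm_smul, Real.norm_of_nonneg (by positivity), div_mul_cancel₀ _ hn.ne'])
      have h1 := hs _ hb'.1 (hb'.2.trans (by norm_num))
      rw [sub_zero, inner_smul_right, real_inner_self_eq_norm_sq, mul_one] at h1
      have h2 := (le_abs_self _).trans h1
      rw [le_div_iff₀ hc]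
      calc ‖G y - G 0‖ * c = c / ‖G y - G 0‖ * ‖G y - G 0‖ ^ 2 := by field_simp
        _ ≤ C := h2
    calc ⟪(0:E) - y, G 0 - G y⟫ = ⟪y, G y - G 0⟫ := by
          rw [zero_sub, inner_neg_left, ← inner_neg_right, neg_sub]
      _ ≤ ‖y‖ * ‖G y - G 0‖ := real_inner_le_norm _ _
      _ ≤ ρ * (C / c) := mul_le_mul hy hbd (norm_nonneg _) hρ0.le
      _ ≤ c3 := hρC
  refine ⟨ρ, hρ0, min_le_left _ _, fun ε Ω Z Q u G H hε hl y hy =>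
    (hsmall ε Ω Z Q u G H hε hl y hy).trans (by linarith), ?_⟩
  intro η hη
  obtain ⟨k, hk⟩ := pow_unbounded_of_one_lt (2 * R / η) (show 1 < 1 + b by linarith)
  refine ⟨c3 / 2 ^ k / 2, by positivity, ?_, ?_⟩
  · have : c3 / 2 ^ k ≤ c3 := div_le_self hc30.le (one_le_pow₀ (by norm_num))
    linarith
  intro ε Ω Z Q u G H hε hl y hy
  have hyb := hl.ball y (hy.trans (min_le_left _ _))
  have hyΩ := hyb.1
  have hyQ : y ∈ Q := hl.near y hyΩ (hyb.2.trans (by norm_num))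
  have hz := hsmall ε Ω Z Q u G H hε hl y hy
  have hsw := breg_add_swap (u := u) (G := G) 0 y
  have hD1 := hl.sol.breg_nonneg hyΩ hl.zero_mem
  have hD2 := hl.sol.breg_nonneg hl.zero_mem hyΩ
  have hsec' : ∀ t > 0, t ≤ c3 → _ := fun t ht0 ht => hsec Ω u G H hl.sol y hyΩ t ht0
      (hl.compact_left hyΩ hyQ (by linarith))
      (hl.det_le_two hε hyΩ hyQ (by linarith))
  have hind : ∀ j : ℕ, ∀ x ∈ Ω, breg u G x y ≤ c3 / 2 ^ j → (1 + b) ^ j * ‖x - y‖ ≤ 2 * R := by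
    intro j
    induction j with
    | zero =>
      intro x hx hxy
      rw [pow_zero, div_one] at hxy
      have h3 := breg_three (u := u) (G := G) x 0 y
      have h4 := ((hsec' c3 hc30 le_rfl) 0 hl.zero_mem (by linarith)).1 x hx (by linarith)
      have h4' := (abs_le.1 h4)
      have h5 : ⟪x - y, G 0 - G y⟫ = ⟪G 0 - G y, x - y⟫ := real_inner_comm _ _
      have h6 : breg u G x 0 ≤ 1 := by
        rw [h3, h5]; nlinarith
      have h7 := hl.norm_le x hx h6
      have h8 := hl.norm_le y hyΩ hyb.2
      rw [pow_zero, one_mul]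
      linarith [norm_sub_le x y]
    | succ j ih =>
      intro x hx hxy
      have ht : c3 / 2 ^ (j + 1) ≤ c3 := div_le_self hc30.le (one_le_pow₀ (by norm_num))
      obtain ⟨h1, h2⟩ := ((hsec' _ (by positivity) ht) x hx hxy).2
      have h3 := ih _ h1 (h2.trans (by rw [pow_succ]; apply le_of_eq; field_simp))
      rw [add_sub_cancel_left, norm_smul, Real.norm_of_nonneg (by linarith)] at h3
      calc (1 + b) ^ (j + 1) * ‖x - y‖ = (1 + b) ^ j * ((1 + b) * ‖x - y‖) := by ring
        _ ≤ 2 * R := h3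
  intro x hx hxy
  have h1 := hind k x hx (by linarith)
  rw [div_lt_iff₀ hη] at hk
  have hp : 0 < (1 + b) ^ k := by positivity
  by_contra hcon
  push Not at hcon
  have := mul_lt_mul_of_pos_left hcon hp
  linarith

end LocalDensity

section LocalDensity

set_option linter.unusedSectionVars false

open Module (finrank)
open Filter Topology

variable {E : Type*} [NormedAddCommGroup E] [InnerProductSpace ℝ E] [FiniteDimensional ℝ E]
variable {Ω : Set E} {u w : E → ℝ} {G Gw : E → E} {H Hw : E → E →L[ℝ] E}

/-- A touching point of `w` by a multiple of `-breg u G · y` from below. -/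
lemma MASol.exists_contact (hu : MASol Ω u G H) {W : Set E} (hW : IsOpen W)
    (hw : C2On W w Gw Hw) {y : E} {K : ℝ}
    (hc : IsCompact {x ∈ Ω | breg u G x y ≤ K}) (hKW : {x ∈ Ω | breg u G x y ≤ K} ⊆ W)
    (hw0 : ∀ x ∈ Ω, breg u G x y ≤ K → 0 ≤ w x) {s μ : ℝ} (hs : 0 < s) (hsK : 2 * s < K)
    (hμ : 0 < μ) {x0 : E} (hx0 : x0 ∈ Ω) (hx0s : breg u G x0 y ≤ s) (hx0μ : w x0 < μ)
    (hy : y ∈ Ω) :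
    ∃ x ∈ Ω, breg u G x y ≤ 2 * s ∧ w x ≤ 2 * μ ∧ Gw x + (μ / s) • (G x - G y) = 0 ∧
      PosSemi ((Hw x + (μ / s) • H x : E →L[ℝ] E) : E →ₗ[ℝ] E) := by
  set κ := μ / s with hκ
  have hκ0 : 0 < κ := by positivity
  have hκs : κ * s = μ := by rw [hκ]; field_simp
  set S := {x ∈ Ω | breg u G x y ≤ K} with hS
  have hC := (hw.mono (Ω' := Ω ∩ W) inter_subset_right).add
    (((hu.breg_left y).mono (Ω' := Ω ∩ W) inter_subset_left).smul κ)
  have hSsub : S ⊆ Ω ∩ W := fun x hx => ⟨hx.1, hKW hx⟩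
  have hx0S : x0 ∈ S := ⟨hx0, by linarith⟩
  obtain ⟨x, hxS, hmin⟩ := hc.exists_isMinOn ⟨x0, hx0S⟩ (hC.continuousOn_fun.mono hSsub)
  have h1 : w x + κ * breg u G x y ≤ w x0 + κ * breg u G x0 y := hmin hx0S
  have h2 : κ * breg u G x0 y ≤ μ := by rw [← hκs]; exact mul_le_mul_of_nonneg_left hx0s hκ0.le
  have hwx := hw0 x hxS.1 hxS.2
  have hDx := hu.breg_nonneg hxS.1 hy
  have h3 : breg u G x y ≤ 2 * s := by
    have : κ * breg u G x y ≤ κ * (2 * s) := by nlinarith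
    exact le_of_mul_le_mul_left this hκ0
  have hloc : IsLocalMin (fun x => w x + κ * breg u G x y) x := by
    refine hmin.isLocalMin ?_
    have ho : IsOpen (Ω ∩ (fun x => breg u G x y) ⁻¹' Iio K) :=
      hu.continuousOn_breg_left.isOpen_inter_preimage hu.isOpen isOpen_Iio
    refine mem_of_superset (ho.mem_nhds ⟨hxS.1, show breg u G x y < K by linarith⟩) ?_
    exact fun z hz => ⟨hz.1, le_of_lt hz.2⟩
  refine ⟨x, hxS.1, h3, ?_, ?_, ?_⟩
  · nlinarith [mul_nonneg hκ0.le hDx]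
  · exact hC.grad_eq_zero (hSsub hxS) hloc
  · exact hC.posSemi (hu.isOpen.inter hW) (hSsub hxS) hloc

/-- If a nonnegative almost-supersolution of the linearised equation is small at the origin, then
it is small at some symmetric triple of points of prescribed small step. -/
lemma exists_symmetric_small [Nontrivial E] {R c : ℝ} (hc : 0 < c) :
    ∃ ρ > (0:ℝ), ∃ ε > (0:ℝ), ∃ C > (0:ℝ), ∀ Ω Z Q u G H, LocalSol (E := E) R c ε Ω Z Q u G H →
    ∀ W w Gw Hw, IsOpen W → C2On (E := E) W w Gw Hw → Z ⊆ W → ∀ τ ω, 0 < τ → 0 ≤ ω →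
    (∀ x ∈ Z, 0 ≤ w x ∧ linMA (H x : E →ₗ[ℝ] E) (Hw x) ≤ ω) → w 0 ≤ τ → ∀ h : E, ‖h‖ ≤ ρ / 2 →
    ∃ x, (x ∈ Z ∧ w x ≤ C * (τ + ω)) ∧ (x + h ∈ Z ∧ w (x + h) ≤ C * (τ + ω)) ∧
      (x - h ∈ Z ∧ w (x - h) ≤ C * (τ + ω)) := by
  borelize E
  obtain ⟨ρ, hρ, hρc, hz, hsec⟩ := exists_small_sections (E := E) (R := R) hc
  set δ : ℝ := (1 / 2) ^ finrank ℝ E / 8 with hδ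
  have hδ0 : 0 < δ := by positivity
  obtain ⟨r, hr1, hrn⟩ : ∃ r : ℝ, 1 < r ∧ r ^ finrank ℝ E ≤ 1 + δ := by
    have hcont : Tendsto (fun r : ℝ => r ^ finrank ℝ E) (𝓝[>] 1) (𝓝 1) := by
      have : Tendsto (fun r : ℝ => r ^ finrank ℝ E) (𝓝 1) (𝓝 (1 ^ finrank ℝ E)) :=
        (continuous_pow _).tendsto 1
      rw [one_pow] at this
      exact this.mono_left nhdsWithin_le_nhds
    have h1 := hcont.eventually (eventually_lt_nhds (show (1:ℝ) < 1 + δ by linarith))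
    obtain ⟨r, hr⟩ := (h1.and self_mem_nhdsWithin).exists
    exact ⟨r, hr.2, hr.1.le⟩
  obtain ⟨s0, hs00, hs01, hsmall⟩ := hsec (ρ * (r - 1)) (mul_pos hρ (by linarith))
  set s : ℝ := min s0 (δ / 2) with hs
  have hs0 : 0 < s := lt_min hs00 (by positivity)
  have hs1 : s ≤ 1 := (min_le_left _ _).trans hs01
  obtain ⟨εb, hεb, c0, hc0, c1, hc1, hbar⟩ := barrier (E := E) hs0 one_pos
  set ε : ℝ := min (min εb (Real.log 2)) (δ / 4) with hε
  have hε0 : 0 < ε := lt_min (lt_min hεb (Real.log_pos (by norm_num))) (by positivity)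
  have hε1 : ε ≤ εb := (min_le_left _ _).trans (min_le_left _ _)
  have hε2 : ε ≤ Real.log 2 := (min_le_left _ _).trans (min_le_right _ _)
  set Cs : ℝ := 1 / c0 + 2 / c1 + 1 with hCs
  have hCs0 : 0 < Cs := by positivity
  have hCs1 : 1 ≤ c0 * Cs := by
    have : c0 * Cs = 1 + c0 * (2 / c1 + 1) := by rw [hCs]; field_simp; ring
    rw [this]; linarith [show 0 < c0 * (2 / c1 + 1) by positivity]
  have hCs2 : 2 ≤ c1 * Cs := by
    have : c1 * Cs = 2 + c1 * (1 / c0 + 1) := by rw [hCs]; field_simp; ring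
    rw [this]; linarith [show 0 < c1 * (1 / c0 + 1) by positivity]
  have hCs3 : 1 ≤ Cs := by
    rw [hCs]; linarith [show 0 < 1 / c0 + 2 / c1 by positivity]
  refine ⟨ρ, hρ, ε, hε0, 2 * Cs, by positivity, ?_⟩
  intro Ω Z Q u G H hl W w Gw Hw hW hw hZW τ ω hτ hω hwZ hw0 h hh
  set μ : ℝ := Cs * (τ + ω) with hμ
  have hμ0 : 0 < μ := by positivity
  have hωμ : ω ≤ c0 * μ := by
    rw [hμ, ← mul_assoc]; nlinarith
  have hτμ : τ < c1 * μ := by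
    rw [hμ, ← mul_assoc]; nlinarith
  have hωμ' : ω ≤ μ := by rw [hμ]; nlinarith
  have hu := hl.sol
  -- contact points
  have hcontact : ∀ y, ‖y‖ ≤ ρ → ∃ x ∈ Ω, breg u G x y ≤ 2 * s ∧ w x ≤ 2 * μ ∧
      Gw x + (μ / s) • (G x - G y) = 0 ∧
      PosSemi ((Hw x + (μ / s) • H x : E →L[ℝ] E) : E →ₗ[ℝ] E) := by
    intro y hy
    have hyb := hl.ball y (hy.trans hρc)
    have hyΩ := hyb.1
    have hyQ : y ∈ Q := hl.near y hyΩ (hyb.2.trans (by norm_num))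
    have hin : ∀ x ∈ Ω, breg u G x y ≤ 3 → x ∈ Z := fun x hx hxy =>
      (hl.cont x hx y hyΩ (hxy.trans (by norm_num)) (Or.inr hyQ)).1
    have hin' : ∀ x ∈ Ω, breg u G y x ≤ 3 → x ∈ Z := fun x hx hxy =>
      (hl.cont y hyΩ x hx (hxy.trans (by norm_num)) (Or.inl hyQ)).2
    have hpt : ∃ x0 ∈ Ω, breg u G x0 y ≤ s ∧ w x0 < μ := by
      by_contra hno
      push Not at hno
      have h3 : (2:ℝ) * 1 + 1 = 3 := by norm_num
      have := hbar Ω u G H hu y hyΩ (by rw [h3]; exact hl.compact_left hyΩ hyQ (by norm_num))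
        (by rw [h3]; exact hl.compact_right hyΩ hyQ (by norm_num))
        (by
          rw [h3]
          intro x hx hxy x' hx' hxy'
          linarith [hl.osc x (hin x hx hxy) x' (hin' x' hx' hxy')])
        W w Gw Hw hW hw (by rw [h3]; exact fun x hx => hZW (hin x hx.1 hx.2)) μ ω hμ0 hωμ
        (by rw [h3]; exact fun x hx hxy => hwZ x (hin x hx hxy)) hno 0 hl.zero_mem
        (hz ε Ω Z Q u G H hε2 hl y hy)
      linarith
    obtain ⟨x0, hx0, hx0s, hx0μ⟩ := hpt
    exact hu.exists_contact hW hw (K := 3) (hl.compact_left hyΩ hyQ (by norm_num))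
      (fun x hx => hZW (hin x hx.1 hx.2)) (fun x hx hxy => (hwZ x (hin x hx hxy)).1) hs0
      (by linarith) hμ0 hx0 hx0s hx0μ hyΩ
  -- the contact set
  set S : Set E := (Z ∩ closedBall 0 (ρ * r)) ∩ (Z ∩ w ⁻¹' Iic (2 * μ)) ∩
    ⋂ v : E, (Z ∩ (fun x => ⟪(Hw x + (μ / s) • H x) v, v⟫) ⁻¹' Ici 0) with hSdef
  have hS : IsClosed S := by
    have hZc := hl.compact.isClosed
    refine ((hZc.inter isClosed_closedBall).inter
      ((hw.continuousOn_fun.mono hZW).preimage_isClosed_of_isClosed hZc isClosed_Iic)).inter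
      (isClosed_iInter fun v => ContinuousOn.preimage_isClosed_of_isClosed ?_ hZc isClosed_Ici)
    exact ((((hw.cont.mono hZW).add ((hu.cont.mono hl.subset).const_smul (μ / s))).clm_apply
      continuousOn_const).inner (𝕜 := ℝ) continuousOn_const)
  have hSZ : S ⊆ Z := fun x hx => hx.1.1.1
  have hcov : ∀ y ∈ closedBall (0:E) ρ, ∃ x ∈ S, Gw x + (μ / s) • (G x - G y) = 0 := by
    intro y hy
    rw [mem_closedBall_zero_iff] at hy
    obtain ⟨x, hx, hxs, hxμ, hxg, hxp⟩ := hcontact y hy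
    have hyb := hl.ball y (hy.trans hρc)
    have hyQ : y ∈ Q := hl.near y hyb.1 (hyb.2.trans (by norm_num))
    have hxZ : x ∈ Z := (hl.cont x hx y hyb.1 (by linarith) (Or.inr hyQ)).1
    refine ⟨x, ⟨⟨⟨hxZ, ?_⟩, hxZ, hxμ⟩, mem_iInter.2 fun v => ⟨hxZ, hxp.2 v⟩⟩, hxg⟩
    rw [mem_closedBall_zero_iff]
    have h1 := hsmall ε Ω Z Q u G H hε2 hl y hy x hx
      (hxs.trans (mul_le_mul_of_nonneg_left (min_le_left _ _) (by norm_num)))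
    have h2 := norm_add_le (x - y) y
    rw [sub_add_cancel] at h2
    linarith
  have h0Z : (0:E) ∈ Z := (hl.cont 0 hl.zero_mem 0 hl.zero_mem (by rw [breg_self]; norm_num)
    (Or.inl hl.zero_mem_Q)).1
  have hballΩ : closedBall (0:E) ρ ⊆ Ω := fun y hy =>
    (hl.ball y ((mem_closedBall_zero_iff.1 hy).trans hρc)).1
  have hballZ : closedBall (0:E) ρ ⊆ Z := by
    intro y hy
    have hyb := hl.ball y ((mem_closedBall_zero_iff.1 hy).trans hρc)
    exact (hl.cont y hyb.1 0 hl.zero_mem (hyb.2.trans (by norm_num)) (Or.inr hl.zero_mem_Q)).1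
  have hf0 := hu.det_pos 0 hl.zero_mem
  have hmeas := abp_measure hu hw hS.measurableSet measurableSet_closedBall
    (hSZ.trans hl.subset) (hSZ.trans hZW) hballΩ (show 0 < μ / s by positivity) (ε := s)
    (m := Real.exp (-ε) * (H 0).det) (M := Real.exp ε * (H 0).det) hcov
    (by
      intro y hy
      have := hl.det_le h0Z (hballZ hy)
      calc Real.exp (-ε) * (H 0).det ≤ Real.exp (-ε) * (Real.exp ε * (H y).det) :=
            mul_le_mul_of_nonneg_left this (Real.exp_pos _).le
        _ = (H y).det := by rw [← mul_assoc, ← Real.exp_add]; simp)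
    (fun x hx => hl.det_le (hSZ hx) h0Z)
    (by
      intro x hx
      refine ⟨?_, fun v => (mem_iInter.1 hx.2 v).2⟩
      have h1 := hw.isSymmetric hW (hZW (hSZ hx))
      have h2 := hu.toC2On.isSymmetric hu.isOpen (hl.subset (hSZ hx))
      intro a b
      have h1' := h1 a b
      have h2' := h2 a b
      simp only [ContinuousLinearMap.coe_coe] at h1' h2'
      simp [inner_add_left, inner_add_right, inner_smul_left, inner_smul_right, h1', h2'])
    (by
      intro x hx
      have : s * (μ / s) = μ := by field_simp
      rw [this]
      exact (hwZ x (hSZ hx)).2.trans hωμ')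
  have hvol : ENNReal.ofReal (1 - δ) * volume (closedBall (0:E) ρ) ≤ volume S := by
    set a := Real.exp ε * (H 0).det * Real.exp s with ha
    have ha0 : 0 < a := by positivity
    have h1 : (1 - δ) * a ≤ Real.exp (-ε) * (H 0).det := by
      have h2 : 1 - δ ≤ Real.exp (-(2 * ε + s)) := by
        have := Real.add_one_le_exp (-(2 * ε + s))
        have h3 : ε ≤ δ / 4 := min_le_right _ _
        have h4 : s ≤ δ / 2 := min_le_right _ _
        linarith
      calc (1 - δ) * a ≤ Real.exp (-(2 * ε + s)) * a := mul_le_mul_of_nonneg_right h2 ha0.le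
        _ = Real.exp (-ε) * (H 0).det := by
          rw [ha, show Real.exp (-(2 * ε + s)) * (Real.exp ε * (H 0).det * Real.exp s) =
            (Real.exp (-(2 * ε + s)) * Real.exp ε * Real.exp s) * (H 0).det by ring,
            ← Real.exp_add, ← Real.exp_add]
          ring_nf
    have h5 : ENNReal.ofReal a * (ENNReal.ofReal (1 - δ) * volume (closedBall (0:E) ρ)) ≤
        ENNReal.ofReal a * volume S := by
      rw [← mul_assoc, ← ENNReal.ofReal_mul ha0.le, mul_comm a]
      exact (mul_le_mul_left (ENNReal.ofReal_le_ofReal h1) _).trans hmeas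
    exact (ENNReal.mul_le_mul_iff_right (by simpa using ha0) ENNReal.ofReal_ne_top).1 h5
  obtain ⟨x, h1, h2, h3⟩ := exists_symmetric_triple hS.measurableSet hρ (by linarith)
    (fun x hx => hx.1.1.2) (le_mul_of_one_le_right hρ.le hr1.le) hrn hvol
    (le_of_eq (by rw [hδ]; ring)) hh
  have h4 : 2 * μ = 2 * Cs * (τ + ω) := by rw [hμ]; ring
  rw [← h4]
  exact ⟨x, ⟨hSZ h1, h1.1.2.2⟩, ⟨hSZ h2, h2.1.2.2⟩, hSZ h3, h3.1.2.2⟩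

end LocalDensity

section Doubling

set_option linter.unusedSectionVars false

open Module (finrank)
open Filter Topology

variable {E : Type*} [NormedAddCommGroup E] [InnerProductSpace ℝ E] [FiniteDimensional ℝ E]
variable {Ω : Set E} {u w : E → ℝ} {G Gw : E → E} {H Hw : E → E →L[ℝ] E}

/-- The centred second difference of `u` with step `h`. -/
def secondDiff (u : E → ℝ) (h x : E) : ℝ := u (x + h) + u (x - h) - 2 * u x

lemma secondDiff_two_smul (u : E → ℝ) (h x : E) :
    secondDiff u ((2:ℝ) • h) x =
      secondDiff u h (x + h) + 2 * secondDiff u h x + secondDiff u h (x - h) := by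
  have e1 : x + (2:ℝ) • h = x + h + h := by module
  have e2 : x - (2:ℝ) • h = x - h - h := by module
  simp only [secondDiff, e1, e2, add_sub_cancel_right, sub_add_cancel]
  ring

lemma secondDiff_eq_breg (u : E → ℝ) (G : E → E) (h x : E) :
    secondDiff u h x = breg u G (x + h) x + breg u G (x - h) x :=
  (breg_second x h).symm

lemma MASol.breg_le_secondDiff (hu : MASol Ω u G H) {x h : E} (hx : x ∈ Ω) (h2 : x - h ∈ Ω) :
    breg u G (x + h) x ≤ secondDiff u h x := by
  rw [secondDiff_eq_breg u G]
  linarith [hu.breg_nonneg h2 hx]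

lemma MASol.breg_right_segment (hu : MASol Ω u G H) {x y : E} (hx : x ∈ Ω) (hy : y ∈ Ω) {t : ℝ}
    (h0 : 0 ≤ t) (h1 : t ≤ 1) :
    x + t • (y - x) ∈ Ω ∧ breg u G x (x + t • (y - x)) ≤ breg u G x y := by
  have hm : x + t • (y - x) ∈ Ω := hu.convex.add_smul_sub_mem hx hy ⟨h0, h1⟩
  refine ⟨hm, ?_⟩
  rcases h1.eq_or_lt with rfl | h1
  · simp
  set m := x + t • (y - x) with hmdef
  have h3 := breg_three (u := u) (G := G) x y m
  have h4 := hu.breg_nonneg hm hy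
  have h5 := hu.inner_nonneg hy hm
  have e1 : x - m = (-t) • (y - x) := by rw [hmdef]; module
  have e2 : y - m = (1 - t) • (y - x) := by rw [hmdef]; module
  rw [e2, inner_smul_left] at h5
  rw [e1, inner_smul_left] at h3
  simp only [conj_trivial] at h3 h5
  have h6 : 0 ≤ ⟪y - x, G y - G m⟫ := by
    by_contra hneg
    push Not at hneg
    nlinarith [mul_neg_of_pos_of_neg (show 0 < 1 - t by linarith) hneg]
  nlinarith [mul_nonneg h0 h6]

/-- A lower bound for the Bregman distance at scale `b / 8` confines the sections. -/
lemma MASol.norm_le_of_separation (hu : MASol Ω u G H) {x0 : E} {b M : ℝ} (hb : 0 < b)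
    (hsub : ball x0 (2 * b) ⊆ Ω)
    (hsep : ∀ x ∈ closedBall x0 b, ∀ y ∈ closedBall x0 b, b / 8 ≤ ‖x - y‖ → M < breg u G x y)
    {x y : E} (hx : x ∈ Ω) (hy : y ∈ closedBall x0 (b / 2)) :
    (breg u G x y ≤ M → ‖x - y‖ ≤ b / 8) ∧ (breg u G y x ≤ M → ‖x - y‖ ≤ b / 8) := by
  have hyb : y ∈ closedBall x0 b := closedBall_subset_closedBall (by linarith) hy
  have hyΩ : y ∈ Ω := hsub (closedBall_subset_ball (by linarith) hyb)
  rw [mem_closedBall, dist_eq_norm] at hy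
  have key : b / 8 < ‖x - y‖ → ∃ t : ℝ, 0 ≤ t ∧ t ≤ 1 ∧ y + t • (x - y) ∈ closedBall x0 b ∧
      ‖y + t • (x - y) - y‖ = b / 8 := by
    intro hlt
    have h0 : 0 < ‖x - y‖ := by linarith
    refine ⟨b / 8 / ‖x - y‖, by positivity, (div_le_one h0).2 hlt.le, ?_, ?_⟩
    · rw [mem_closedBall, dist_eq_norm]
      have : y + (b / 8 / ‖x - y‖) • (x - y) - x0 = (y - x0) + (b / 8 / ‖x - y‖) • (x - y) := by
        abel
      rw [this]
      refine (norm_add_le _ _).trans ?_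
      rw [norm_smul, Real.norm_of_nonneg (by positivity), div_mul_cancel₀ _ h0.ne']
      linarith
    · rw [add_sub_cancel_left, norm_smul, Real.norm_of_nonneg (by positivity),
        div_mul_cancel₀ _ h0.ne']
  constructor
  · intro hD
    by_contra hlt
    push Not at hlt
    obtain ⟨t, h0, h1, h2, h3⟩ := key hlt
    have h4 := hsep _ h2 y hyb h3.ge
    have h5 := (hu.breg_segment hx hyΩ h0 h1).2
    have h6 := hu.breg_nonneg hx hyΩ
    nlinarith
  · intro hD
    by_contra hlt
    push Not at hlt
    obtain ⟨t, h0, h1, h2, h3⟩ := key hlt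
    have h4 := hsep y hyb _ h2 (by rw [norm_sub_rev]; exact h3.ge)
    have h5 := (hu.breg_right_segment hyΩ hx h0 h1).2
    linarith

lemma secondDiff_dyadic_le {x0 h : E} {b A : ℝ} (hA : ∀ x ∈ closedBall x0 b, secondDiff u h x ≤ A) :
    ∀ k : ℕ, ∀ x, ‖x - x0‖ + 2 ^ k * ‖h‖ ≤ b → secondDiff u ((2:ℝ) ^ k • h) x ≤ 4 ^ k * A := by
  intro k
  induction k with
  | zero =>
    intro x hx
    have := hA x (by
      rw [mem_closedBall, dist_eq_norm]
      have := norm_nonneg h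
      simp only [pow_zero, one_mul] at hx
      linarith)
    simpa using this
  | succ k ih =>
    intro x hx
    have hn : ‖(2:ℝ) ^ k • h‖ = 2 ^ k * ‖h‖ := by
      rw [norm_smul, Real.norm_of_nonneg (by positivity)]
    have hp : 0 ≤ (2:ℝ) ^ k * ‖h‖ := by positivity
    rw [pow_succ] at hx
    rw [show (2:ℝ) ^ (k + 1) • h = (2:ℝ) • ((2:ℝ) ^ k • h) by rw [smul_smul, pow_succ, mul_comm],
      secondDiff_two_smul]
    have h1 := ih x (by linarith)
    have h2 := ih (x + (2:ℝ) ^ k • h) (by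
      have := norm_add_le (x - x0) ((2:ℝ) ^ k • h)
      rw [show x + (2:ℝ) ^ k • h - x0 = x - x0 + (2:ℝ) ^ k • h by abel]
      linarith)
    have h3 := ih (x - (2:ℝ) ^ k • h) (by
      have := norm_sub_le (x - x0) ((2:ℝ) ^ k • h)
      rw [show x - (2:ℝ) ^ k • h - x0 = x - x0 - (2:ℝ) ^ k • h by abel]
      linarith)
    rw [pow_succ]
    linarith

/-- If the second difference with step `h` almost attains its local maximum at `x0`, then the
second difference with step `2 h` is nearly four times as large somewhere nearby. -/
lemma exists_secondDiff_doubling [Nontrivial E] : ∃ M > (0:ℝ), ∃ K > (0:ℝ), ∃ ε > (0:ℝ),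
    ∃ C > (0:ℝ), ∀ (Ω : Set E) u G H, MASol Ω u G H → ∀ (x0 h : E) (b τ ω N : ℝ), 0 < b →
    ball x0 (2 * b) ⊆ Ω → M * ‖h‖ ≤ b → 0 < τ → τ ≤ 1 → 0 ≤ ω → 0 < N → secondDiff u h x0 = N →
    (∀ x ∈ closedBall x0 b, secondDiff u h x ≤ (1 + τ) * N) →
    (∀ x ∈ closedBall x0 b, ∀ y ∈ closedBall x0 b, b / 8 ≤ ‖x - y‖ → K * N < breg u G x y) →
    (∀ x ∈ closedBall x0 b, ∀ y ∈ closedBall x0 b,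
      Real.log (H x).det - ε ≤ Real.log (H y).det) →
    (∀ x ∈ closedBall x0 b, Real.log (H x).det - ω ≤ Real.log (H (x + h)).det ∧
      Real.log (H x).det - ω ≤ Real.log (H (x - h)).det) →
    ∃ x ∈ closedBall x0 b, 4 * N * (1 - C * (τ + ω)) ≤ secondDiff u ((2:ℝ) • h) x := by
  obtain ⟨c, hc, hnorm⟩ := exists_normalization (E := E) 2 (by norm_num)
  have hn : (0:ℝ) < finrank ℝ E := by exact_mod_cast Module.finrank_pos
  set R := Real.sqrt (finrank ℝ E) with hR
  have hR0 : 0 < R := Real.sqrt_pos.2 hn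
  obtain ⟨ρ, hρ, ε, hε, C, hC, hloc⟩ := exists_symmetric_small (E := E) (R := R) hc
  obtain ⟨k, hk⟩ := pow_unbounded_of_one_lt (2 * R / ρ + 2) (show (1:ℝ) < 2 by norm_num)
  set m : ℝ := 2 ^ k with hm
  have hRρ : 0 < 2 * R / ρ := by positivity
  have hm2 : 2 < m := by linarith
  have hmρ : R / m ≤ ρ / 2 := by
    rw [div_le_div_iff₀ (by linarith) (by norm_num)]
    have : 2 * R / ρ < m := by linarith
    rw [div_lt_iff₀ hρ] at this
    linarith
  set K : ℝ := 2 * m ^ 2 with hK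
  have hK0 : 0 < K := by positivity
  refine ⟨m, by linarith, 4 * K, by positivity, min ε (Real.log 2),
    lt_min hε (Real.log_pos (by norm_num)), C * (1 + 2 * K), by positivity, ?_⟩
  intro Ω u G H hu x0 h b τ ω N hb hsub hhb hτ hτ1 hω hN hN0 hv hsep hosc hω'
  have hKN : 0 < K * N := by positivity
  have hcb : closedBall x0 b ⊆ Ω := fun x hx => hsub (closedBall_subset_ball (by linarith) hx)
  have hx0 : x0 ∈ Ω := hcb (mem_closedBall_self hb.le)
  have hh0 := norm_nonneg h
  have hhb2 : ‖h‖ ≤ b / 2 := by nlinarith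
  have hcen : x0 ∈ closedBall x0 (b / 2) := mem_closedBall_self (by linarith)
  have hconf : ∀ {x y : E}, x ∈ Ω → y ∈ closedBall x0 (b / 2) →
      (breg u G x y ≤ 4 * K * N → ‖x - y‖ ≤ b / 8) ∧
      (breg u G y x ≤ 4 * K * N → ‖x - y‖ ≤ b / 8) := fun hx hy =>
    hu.norm_le_of_separation hb hsub hsep hx hy
  have hin : ∀ {x : E}, x ∈ Ω → breg u G x x0 ≤ 4 * K * N → x ∈ closedBall x0 (b / 2) := by
    intro x hx hD
    rw [mem_closedBall, dist_eq_norm]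
    linarith [(hconf hx hcen).1 hD]
  have hhalf : closedBall x0 (b / 2) ⊆ closedBall x0 b := closedBall_subset_closedBall (by linarith)
  -- normalisation of the section of height `K * N`
  have h2t : 2 * (K * N / 2) = K * N := by ring
  obtain ⟨A, hA1, hA2⟩ := hnorm Ω u G H hu x0 hx0 (K * N / 2) (by positivity) (by
      rw [h2t]
      have h1 : IsClosed (closedBall x0 b ∩ (fun x => breg u G x x0) ⁻¹' Iic (K * N)) :=
        (hu.continuousOn_breg_left.mono hcb).preimage_isClosed_of_isClosed
          isClosed_closedBall isClosed_Iic
      have h2 : {x ∈ Ω | breg u G x x0 ≤ K * N} =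
          closedBall x0 b ∩ (fun x => breg u G x x0) ⁻¹' Iic (K * N) := by
        ext x
        refine ⟨fun hx => ⟨hhalf (hin hx.1 (hx.2.trans (by nlinarith))), hx.2⟩,
          fun hx => ⟨hcb hx.1, hx.2⟩⟩
      rw [h2]
      exact (isCompact_closedBall x0 b).of_isClosed_subset h1 inter_subset_left)
    (by
      rw [h2t]
      intro x hx hxD x' hx' hxD'
      have h1 := hosc x (hhalf (hin hx (hxD.trans (by nlinarith)))) x'
        (hhalf (hin hx' (hxD'.trans (by nlinarith))))
      have p1 := hu.det_pos x hx
      have p2 := hu.det_pos x' hx'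
      rw [← Real.log_le_log_iff p1 (by positivity), Real.log_mul (by norm_num) p2.ne']
      linarith [min_le_right ε (Real.log 2)])
  rw [h2t] at hA1 hA2
  set κ : ℝ := 1 / (K * N) with hκ
  have hκ0 : 0 < κ := by positivity
  have hκ1 : κ * (K * N) = 1 := by rw [hκ]; field_simp
  have hscale : ∀ {D a : ℝ}, κ * D ≤ a → D ≤ a * (K * N) := by
    intro D a hD
    have := mul_le_mul_of_nonneg_right hD hKN.le
    calc D = κ * D * (K * N) := by rw [mul_right_comm, hκ1, one_mul]
      _ ≤ a * (K * N) := this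
  have hscale' : ∀ {D a : ℝ}, D ≤ a * (K * N) → κ * D ≤ a := by
    intro D a hD
    have := mul_le_mul_of_nonneg_left hD hκ0.le
    calc κ * D ≤ κ * (a * (K * N)) := this
      _ = a := by rw [mul_left_comm, hκ1, mul_one]
  have hAcont : Continuous fun x => x0 + A x := by fun_prop
  set Z : Set E := (fun x => x0 + A x) ⁻¹' closedBall x0 b with hZ
  set Q : Set E := (fun x => x0 + A x) ⁻¹' closedBall x0 (b / 2) with hQ
  have hl : LocalSol R c ε ((fun x => x0 + A x) ⁻¹' Ω) Z Q (fun x => κ * u (x0 + A x))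
      (affG x0 A κ G) (affH x0 A κ H) := by
    refine ⟨hu.affine x0 A hκ0, by simpa using hx0, ?_, fun x hx => hcb hx, ?_, ?_, ?_, ?_, ?_⟩
    · have : Z = (fun x => A.symm (x - x0)) '' closedBall x0 b := by
        ext x
        constructor
        · intro hx
          exact ⟨x0 + A x, hx, by simp⟩
        · rintro ⟨y, hy, rfl⟩
          simpa [hZ] using hy
      rw [this]
      exact (isCompact_closedBall x0 b).image (by fun_prop)
    · intro x hx hxD
      rw [breg_affine, map_zero, add_zero] at hxD
      have := hA1 _ hx (by simpa using hscale hxD)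
      simpa using this
    · intro v hv
      have := hA2 x0 hx0 (by rw [breg_self]; positivity) v hv
      refine ⟨this.1, ?_⟩
      rw [breg_affine, map_zero, add_zero]
      exact hscale' (by simpa using this.2)
    · intro x hx hxD
      rw [breg_affine, map_zero, add_zero] at hxD
      have := hscale hxD
      exact hin hx (by linarith)
    · intro x hx y hy hD hxy
      rw [breg_affine] at hD
      have hD' : breg u G (x0 + A x) (x0 + A y) ≤ 4 * K * N := by
        have := hscale hD
        linarith
      rcases hxy with h1 | h1
      · have h2 := (hconf hy h1).2 hD'
        refine ⟨hhalf h1, ?_⟩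
        have h1' : ‖x0 + A x - x0‖ ≤ b / 2 := by simpa [hQ] using h1
        show x0 + A y ∈ closedBall x0 b
        rw [mem_closedBall, dist_eq_norm]
        have := norm_add_le (x0 + A y - (x0 + A x)) (x0 + A x - x0)
        rw [sub_add_sub_cancel] at this
        linarith
      · have h2 := (hconf hx h1).1 hD'
        refine ⟨?_, hhalf h1⟩
        have h1' : ‖x0 + A y - x0‖ ≤ b / 2 := by simpa [hQ] using h1
        show x0 + A x ∈ closedBall x0 b
        rw [mem_closedBall, dist_eq_norm]
        have := norm_add_le (x0 + A x - (x0 + A y)) (x0 + A y - x0)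
        rw [sub_add_sub_cancel] at this
        linarith
    · intro x hx y hy
      have hdA : (A : E →L[ℝ] E).det ≠ 0 := A.toLinearEquiv.isUnit_det'.ne_zero
      have p1 := hu.det_pos _ (hcb hx)
      have p2 := hu.det_pos _ (hcb hy)
      have p3 : κ ^ finrank ℝ E * (A : E →L[ℝ] E).det ^ 2 ≠ 0 := by positivity
      rw [det_affH, det_affH, Real.log_mul p3 p1.ne', Real.log_mul p3 p2.ne']
      linarith [hosc _ hx _ hy, min_le_left ε (Real.log 2)]
  -- the step in the normalised picture
  have hstep : ‖A.symm h‖ ≤ ρ / 2 := by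
    have hmpos : 0 < m := by linarith
    have hmh : m * ‖h‖ ≤ b := hhb
    have h1 := secondDiff_dyadic_le hv k x0 (by rw [sub_self, norm_zero, zero_add]; exact hmh)
    have hnm : ‖m • h‖ = m * ‖h‖ := by rw [norm_smul, Real.norm_of_nonneg hmpos.le]
    have hp : x0 + m • h ∈ closedBall x0 b := by
      rw [mem_closedBall, dist_eq_norm, add_sub_cancel_left, hnm]; exact hmh
    have hq : x0 - m • h ∈ closedBall x0 b := by
      rw [mem_closedBall, dist_eq_norm, sub_sub_cancel_left, norm_neg, hnm]; exact hmh
    have h2 := hu.breg_le_secondDiff hx0 (hcb hq)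
    have h3 : (4:ℝ) ^ k * ((1 + τ) * N) ≤ K * N := by
      have : (4:ℝ) ^ k = m ^ 2 := by rw [hm, ← pow_mul, mul_comm, pow_mul]; norm_num
      rw [this, hK]
      have h5 : 0 ≤ m ^ 2 * N := by positivity
      nlinarith [mul_nonneg h5 (show 0 ≤ 1 - τ by linarith)]
    have h4 := hA1 _ (hcb hp) ((h2.trans h1).trans h3)
    rw [add_sub_cancel_left, map_smul, norm_smul, Real.norm_of_nonneg hmpos.le] at h4
    exact (by rw [le_div_iff₀ hmpos]; linarith : ‖A.symm h‖ ≤ R / m).trans hmρ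
  -- the defect function
  have hW : ∀ x ∈ ball x0 (3 / 2 * b), x ∈ Ω ∧ x + h ∈ Ω ∧ x - h ∈ Ω := by
    intro x hx
    rw [mem_ball, dist_eq_norm] at hx
    refine ⟨hsub ?_, hsub ?_, hsub ?_⟩ <;> rw [mem_ball, dist_eq_norm]
    · linarith
    · rw [add_sub_right_comm]
      linarith [norm_add_le (x - x0) h]
    · rw [sub_right_comm]
      linarith [norm_sub_le (x - x0) h]
  have hZW : closedBall x0 b ⊆ ball x0 (3 / 2 * b) := closedBall_subset_ball (by linarith)
  have hvC := hu.toC2On.second_diff h hW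
  have hwC := ((C2On.const (Ω := ball x0 (3 / 2 * b)) ((1 + τ) * N)).add (hvC.smul (-1))).affine
    x0 A κ
  have := hloc _ Z Q _ _ _ hl _ _ _ _ (isOpen_ball.preimage hAcont) hwC
    (fun x hx => hZW hx) (τ / K) (2 * ω) (by positivity) (by positivity)
    (by
      intro x hx
      obtain ⟨hΩ1, hΩ2, hΩ3⟩ := hW _ (hZW hx)
      constructor
      · have := hv _ hx
        rw [secondDiff] at this
        exact mul_nonneg hκ0.le (by linarith)
      · rw [linMA_affH x0 A hκ0 (hu.posDef hΩ1)]
        have h1 := hu.linMA_second_diff hΩ1 hΩ2 hΩ3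
        have h2 := hω' _ hx
        have e : (((0:E →L[ℝ] E) + (-1:ℝ) • (H (x0 + A x + h) + H (x0 + A x - h) -
            (2:ℝ) • H (x0 + A x)) : E →L[ℝ] E) : E →ₗ[ℝ] E) = (-1:ℝ) •
            ((H (x0 + A x + h) + H (x0 + A x - h) -
            (2:ℝ) • H (x0 + A x) : E →L[ℝ] E) : E →ₗ[ℝ] E) := by
          rw [zero_add]; rfl
        rw [e, linMA_smul]
        linarith [h2.1, h2.2])
    (by
      have h1 : u (x0 + h) + u (x0 - h) - 2 * u x0 = N := hN0
      simp only [map_zero, add_zero]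
      rw [h1]
      refine hscale' (le_of_eq ?_)
      field_simp
      ring)
    (A.symm h) hstep
  obtain ⟨x, ⟨hx, hwx⟩, ⟨hxp, hwp⟩, hxm, hwm⟩ := this
  have hfin : ∀ z, κ * ((1 + τ) * N + -1 * secondDiff u h z) ≤ C * (τ / K + 2 * ω) →
      N * (1 - C * (1 + 2 * K) * (τ + ω)) ≤ secondDiff u h z := by
    intro z hz
    have h1 := hscale hz
    have e : C * (τ / K + 2 * ω) * (K * N) = C * (τ + 2 * K * ω) * N := by field_simp
    rw [e] at h1
    have h2 : C * (τ + 2 * K * ω) * N ≤ C * (1 + 2 * K) * (τ + ω) * N := by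
      apply mul_le_mul_of_nonneg_right _ hN.le
      have : 0 ≤ C * ω + C * (2 * K * τ) := by positivity
      linarith
    have h3 : 0 < τ * N := by positivity
    linarith
  have e1 : x0 + A (x + A.symm h) = x0 + A x + h := by simp [add_assoc]
  have e2 : x0 + A (x - A.symm h) = x0 + A x - h := by simp [add_sub_assoc]
  have f1 := hfin _ hwx
  have f2 := hfin (x0 + A x + h) (by rw [← e1]; exact hwp)
  have f3 := hfin (x0 + A x - h) (by rw [← e2]; exact hwm)
  refine ⟨x0 + A x, hx, ?_⟩
  rw [secondDiff_two_smul]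
  linarith

end Doubling

section UnitBall

set_option linter.unusedSectionVars false

open Module (finrank)
open Filter Topology

variable {E : Type*} [NormedAddCommGroup E] [InnerProductSpace ℝ E] [FiniteDimensional ℝ E]
variable {Ω : Set E} {u w : E → ℝ} {G Gw : E → E} {H Hw : E → E →L[ℝ] E}

/-- A solution in the unit ball with determinant between two constants and a quantified modulus of
convexity. -/
structure UnitSol (lam Lam : ℝ) (σ : ℝ → ℝ) (u : E → ℝ) (G : E → E) (H : E → E →L[ℝ] E) :
    Prop where
  sol : MASol (ball (0:E) 1) u G H
  convexity : ∀ t > 0, ∀ x ∈ ball (0:E) 1, ∀ z ∈ ball (0:E) 1, t < dist x z → σ t ≤ breg u G x z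
  lower : ∀ x ∈ ball (0:E) 1, lam ≤ (H x).det
  upper : ∀ x ∈ ball (0:E) 1, (H x).det ≤ Lam

section
variable {lam Lam : ℝ} {σ : ℝ → ℝ} (hU : UnitSol lam Lam σ u G H)
include hU

lemma UnitSol.norm_le {x y : E} (hx : x ∈ ball (0:E) 1) (hy : y ∈ ball (0:E) 1)
    (h : breg u G x y < σ (1 / 8)) : ‖x - y‖ ≤ 1 / 8 := by
  by_contra hlt
  push Not at hlt
  have := hU.convexity (1 / 8) (by norm_num) x hx y hy (by rwa [dist_eq_norm])
  linarith

lemma UnitSol.isCompact_section {y : E} (hy : y ∈ closedBall (0:E) (3 / 4)) {a : ℝ}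
    (ha : a < σ (1 / 8)) : IsCompact {x ∈ ball (0:E) 1 | breg u G x y ≤ a} := by
  have hy1 : y ∈ ball (0:E) 1 := closedBall_subset_ball (by norm_num) hy
  rw [mem_closedBall_zero_iff] at hy
  have hsub : closedBall (0:E) (7 / 8) ⊆ ball 0 1 := closedBall_subset_ball (by norm_num)
  have h1 : IsClosed (closedBall (0:E) (7 / 8) ∩ (fun x => breg u G x y) ⁻¹' Iic a) :=
    (hU.sol.continuousOn_breg_left.mono hsub).preimage_isClosed_of_isClosed
      isClosed_closedBall isClosed_Iic
  have h2 : {x ∈ ball (0:E) 1 | breg u G x y ≤ a} =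
      closedBall (0:E) (7 / 8) ∩ (fun x => breg u G x y) ⁻¹' Iic a := by
    ext x
    refine ⟨fun hx => ⟨?_, hx.2⟩, fun hx => ⟨hsub hx.1, hx.2⟩⟩
    have h3 := hU.norm_le hx.1 hy1 (lt_of_le_of_lt hx.2 ha)
    rw [mem_closedBall_zero_iff]
    have h4 := norm_add_le (x - y) y
    rw [sub_add_cancel] at h4
    linarith
  rw [h2]
  exact (isCompact_closedBall _ _).of_isClosed_subset h1 inter_subset_left

end

/-- A lower power bound for the Bregman distance and an upper bound on balls of fixed radius. -/
lemma exists_unit_estimates [Nontrivial E] {lam Lam : ℝ} (hlam : 0 < lam) (hLam : lam ≤ Lam)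
    {σ : ℝ → ℝ} (hσ : ∀ t > 0, 0 < σ t) :
    ∃ h1 > (0:ℝ), ∃ c0 > (0:ℝ), ∃ c1 > (0:ℝ), ∃ P : ℕ, 0 < P ∧
    ∀ (u : E → ℝ) G H, UnitSol lam Lam σ u G H → ∀ y ∈ closedBall (0:E) (3 / 4),
      (∀ x ∈ ball (0:E) 1, ‖x - y‖ ≤ 1 → c1 * ‖x - y‖ ^ P ≤ breg u G x y) ∧
      (∀ v, ‖v‖ ≤ c0 → y + v ∈ ball (0:E) 1 ∧ breg u G (y + v) y ≤ h1) := by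
  have hs : 0 < σ (1 / 8) := hσ _ (by norm_num)
  set h1 : ℝ := σ (1 / 8) / 2 with hh1
  have hh10 : 0 < h1 := by positivity
  have hLam0 : 0 < Lam := hlam.trans_le hLam
  obtain ⟨c0, hc0, hdepth⟩ := exists_depth (E := E) (1 / 8) ((1 / h1) ^ finrank ℝ E * Lam)
    (by norm_num) (by positivity)
  obtain ⟨_, _, b, hb, hsec⟩ := exists_section_estimates (E := E) (Lam / lam) (by positivity)
  obtain ⟨P, hP⟩ := pow_unbounded_of_one_lt 2 (show (1:ℝ) < 1 + b by linarith)
  have hP0 : 0 < P := by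
    rcases Nat.eq_zero_or_pos P with h | h
    · rw [h, pow_zero] at hP; norm_num at hP
    · exact h
  refine ⟨h1, hh10, c0, hc0, h1 / 2, by positivity, P, hP0, ?_⟩
  intro u G H hU y hy
  have hu := hU.sol
  have hy1 : y ∈ ball (0:E) 1 := closedBall_subset_ball (by norm_num) hy
  constructor
  · have hind : ∀ j : ℕ, ∀ x ∈ ball (0:E) 1, breg u G x y ≤ h1 / 2 ^ j →
        (1 + b) ^ j * ‖x - y‖ ≤ 1 / 8 := by
      intro j
      induction j with
      | zero =>
        intro x hx hD
        rw [pow_zero, div_one] at hD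
        rw [pow_zero, one_mul]
        exact hU.norm_le hx hy1 (by linarith)
      | succ j ih =>
        intro x hx hD
        have e : 2 * (h1 / 2 ^ (j + 1)) = h1 / 2 ^ j := by rw [pow_succ]; field_simp
        have hle : h1 / 2 ^ j ≤ h1 := div_le_self hh10.le (one_le_pow₀ (by norm_num))
        obtain ⟨g1, g2⟩ := (hsec _ u G H hu y hy1 (h1 / 2 ^ (j + 1)) (by positivity)
          (by rw [e]; exact hU.isCompact_section hy (by linarith))
          (by
            intro z hz _ z' hz' _
            have f1 := hU.upper z hz
            have f2 := hU.lower z' hz'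
            rw [div_mul_eq_mul_div, le_div_iff₀ hlam]
            exact mul_le_mul f1 f2 hlam.le hLam0.le) x hx hD).2
        rw [e] at g2
        have g3 := ih _ g1 g2
        rw [add_sub_cancel_left, norm_smul, Real.norm_of_nonneg (by linarith)] at g3
        calc (1 + b) ^ (j + 1) * ‖x - y‖ = (1 + b) ^ j * ((1 + b) * ‖x - y‖) := by ring
          _ ≤ 1 / 8 := g3
    intro x hx hxy
    have hn0 := norm_nonneg (x - y)
    rcases eq_or_ne x y with rfl | hne
    · rw [breg_self, sub_self, norm_zero, zero_pow hP0.ne', mul_zero]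
    have hD := hu.strict x hx y hy1 hne
    rcases lt_or_ge h1 (breg u G x y) with hbig | hsmall
    · have : ‖x - y‖ ^ P ≤ 1 := pow_le_one₀ hn0 hxy
      nlinarith
    · obtain ⟨j, hj1, hj2⟩ := exists_nat_pow_near_of_lt_one (x := breg u G x y / h1) (y := 1 / 2)
        (by positivity) ((div_le_one hh10).2 hsmall) (by norm_num) (by norm_num)
      rw [div_le_iff₀ hh10] at hj2
      have g1 := hind j x hx (by
        rw [one_div, inv_pow] at hj2
        rw [div_eq_inv_mul]; exact hj2)
      have hpw : 0 < (1 + b) ^ j := by positivity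
      have g2 : ((1 + b) ^ j * ‖x - y‖) ^ P ≤ 1 :=
        pow_le_one₀ (by positivity) (g1.trans (by norm_num))
      have g3 : (2:ℝ) ^ j ≤ ((1 + b) ^ j) ^ P := by
        rw [← pow_mul, mul_comm, pow_mul]
        exact pow_le_pow_left₀ (by norm_num) hP.le j
      have g4 : (2:ℝ) ^ j * ‖x - y‖ ^ P ≤ 1 := by
        rw [mul_pow] at g2
        exact (mul_le_mul_of_nonneg_right g3 (by positivity)).trans g2
      have g5 : ‖x - y‖ ^ P ≤ (1 / 2) ^ j := by
        rw [one_div, inv_pow, ← one_div, le_div_iff₀ (by positivity)]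
        linarith
      have hj1' : (1 / 2) ^ (j + 1) * h1 < breg u G x y := by
        rwa [lt_div_iff₀ hh10] at hj1
      rw [pow_succ] at hj1'
      nlinarith
  · intro v hv
    have hκ : 0 < 1 / h1 := by positivity
    have hsol := hu.affine 0 (ContinuousLinearEquiv.refl ℝ E) hκ
    have hset : (fun x : E => 0 + (ContinuousLinearEquiv.refl ℝ E) x) ⁻¹' ball (0:E) 1 =
        ball (0:E) 1 := by ext x; simp
    rw [hset] at hsol
    have hbr : ∀ x y, breg (fun x => 1 / h1 * u (0 + (ContinuousLinearEquiv.refl ℝ E) x))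
        (affG 0 (ContinuousLinearEquiv.refl ℝ E) (1 / h1) G) x y = 1 / h1 * breg u G x y := by
      intro x y; rw [breg_affine]; simp
    have hiff : ∀ x y, 1 / h1 * breg u G x y ≤ 1 ↔ breg u G x y ≤ h1 := by
      intro x y; rw [one_div, inv_mul_le_iff₀ hh10, mul_one]
    have := hdepth _ _ _ _ hsol y hy1
    simp only [hbr, hiff] at this
    refine this (hU.isCompact_section hy (by linarith))
      (fun x hx hD => hU.norm_le hx hy1 (by linarith)) (fun x hx _ => ?_) y hy1
      (by rw [breg_self, mul_zero]; norm_num) v hv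
    rw [det_affH]
    have hid : ((ContinuousLinearEquiv.refl ℝ E : E ≃L[ℝ] E) : E →L[ℝ] E).det = 1 := by
      simp [ContinuousLinearMap.det]
    rw [hid, one_pow, mul_one]
    exact mul_le_mul_of_nonneg_left (hU.upper _ (by simpa using hx)) (by positivity)

/-- Heights over the tangent plane at `x` control the oscillation of the gradient near `x`. -/
lemma MASol.norm_grad_sub_mul_le (hu : MASol Ω u G H) {x y : E} {d B : ℝ} (hx : x ∈ Ω)
    (hd : 0 < d) (hB : ∀ v, ‖v‖ ≤ 2 * d → x + v ∈ Ω ∧ breg u G (x + v) x ≤ B)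
    (hxy : ‖y - x‖ ≤ d) : ‖G y - G x‖ * d ≤ B := by
  have hyΩ : y ∈ Ω := by
    have := (hB (y - x) (by linarith)).1
    rwa [add_sub_cancel] at this
  rcases eq_or_ne (G y - G x) 0 with h0 | h0
  · rw [h0, norm_zero, zero_mul]
    have := (hB 0 (by rw [norm_zero]; linarith)).2
    rwa [add_zero, breg_self] at this
  have hn : 0 < ‖G y - G x‖ := norm_pos_iff.2 h0
  set v := (d / ‖G y - G x‖) • (G y - G x) with hv
  have hvn : ‖v‖ = d := by
    rw [hv, norm_smul, Real.norm_of_nonneg (by positivity), div_mul_cancel₀ _ hn.ne']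
  obtain ⟨g1, g2⟩ := hB (y - x + v) (by linarith [norm_add_le (y - x) v])
  have e : x + (y - x + v) = y + v := by abel
  rw [e] at g1 g2
  have h3 := breg_three (u := u) (G := G) (y + v) x y
  have h4 := hu.breg_nonneg g1 hyΩ
  have h5 := hu.breg_nonneg hyΩ hx
  have h6 : ⟪y + v - y, G x - G y⟫ = -(‖G y - G x‖ * d) := by
    rw [add_sub_cancel_left, ← neg_sub (G y) (G x), inner_neg_right, hv, inner_smul_left,
      real_inner_self_eq_norm_sq, conj_trivial]
    field_simp
  linarith

lemma MASol.norm_grad_sub_le (hu : MASol (ball (0:E) 1) u G H) {c h1 : ℝ} (hc : 0 < c)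
    (hB : ∀ y ∈ closedBall (0:E) (3 / 4), ∀ v, ‖v‖ ≤ c →
      y + v ∈ ball (0:E) 1 ∧ breg u G (y + v) y ≤ h1) {m : ℕ} (hm : 2 / c ≤ m)
    {x y : E} (hx : x ∈ ball (0:E) (1 / 2)) (hy : y ∈ ball (0:E) (1 / 2)) :
    ‖G x - G y‖ ≤ m * (2 * h1 / c) := by
  have hm0 : (0:ℝ) < m := lt_of_lt_of_le (by positivity) hm
  have hpt : ∀ t ∈ Icc (0:ℝ) 1, y + t • (x - y) ∈ closedBall (0:E) (3 / 4) := by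
    intro t ht
    exact closedBall_subset_closedBall (by norm_num)
      (ball_subset_closedBall ((convex_ball (0:E) (1 / 2)).add_smul_sub_mem hy hx ht))
  have hxy : ‖x - y‖ ≤ 1 := by
    rw [mem_ball_zero_iff] at hx hy
    linarith [norm_sub_le x y]
  have hind : ∀ j : ℕ, j ≤ m → ‖G (y + ((j:ℝ) / m) • (x - y)) - G y‖ ≤ j * (2 * h1 / c) := by
    intro j
    induction j with
    | zero => intro _; simp
    | succ j ih =>
      intro hj
      have hj' : (j:ℝ) + 1 ≤ m := by exact_mod_cast hj
      have h1' := ih (by omega)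
      have hp := hpt ((j:ℝ) / m) ⟨by positivity, by rw [div_le_one hm0]; linarith⟩
      have h2 := hu.norm_grad_sub_mul_le (x := y + ((j:ℝ) / m) • (x - y))
        (y := y + (((j + 1 : ℕ):ℝ) / m) • (x - y)) (d := c / 2) (B := h1)
        (closedBall_subset_ball (by norm_num) hp) (by positivity)
        (fun v hv => hB _ hp v (by linarith)) (by
          have : y + (((j + 1 : ℕ):ℝ) / m) • (x - y) - (y + ((j:ℝ) / m) • (x - y)) =
              (1 / m : ℝ) • (x - y) := by
            push_cast; module
          rw [this, norm_smul, Real.norm_of_nonneg (by positivity)]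
          have : 1 / (m:ℝ) ≤ c / 2 := by
            rw [div_le_div_iff₀ hm0 (by norm_num)]
            rw [div_le_iff₀ hc] at hm
            linarith
          have h3 : 0 ≤ 1 / (m:ℝ) := by positivity
          nlinarith [norm_nonneg (x - y)])
      have h3 : ‖G (y + (((j + 1 : ℕ):ℝ) / m) • (x - y)) - G (y + ((j:ℝ) / m) • (x - y))‖ ≤
          2 * h1 / c := by
        rw [le_div_iff₀ hc]; linarith
      have h4 := norm_add_le (G (y + (((j + 1 : ℕ):ℝ) / m) • (x - y)) -
        G (y + ((j:ℝ) / m) • (x - y))) (G (y + ((j:ℝ) / m) • (x - y)) - G y)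
      rw [sub_add_sub_cancel] at h4
      refine h4.trans ?_
      push_cast at h3 ⊢
      linarith
  have := hind m le_rfl
  rwa [div_self hm0.ne', one_smul, add_sub_cancel] at this

end UnitBall

section Dini

variable {ω : ℝ → ℝ} (hm : Monotone ω) (h0 : ∀ r, 0 ≤ ω r)
include hm

lemma dini_intervalIntegrable {a b : ℝ} (ha : 0 < a) (hb : 0 < b) :
    IntervalIntegrable (fun s => ω s / s) volume a b := by
  have h1 : IntervalIntegrable ω volume a b := hm.intervalIntegrable
  have h2 : ContinuousOn (fun s : ℝ => s⁻¹) (uIcc a b) := by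
    refine continuousOn_inv₀.mono fun s hs => ?_
    have : 0 < s := lt_of_lt_of_le (lt_min ha hb) hs.1
    exact this.ne'
  simpa only [div_eq_mul_inv] using h1.mul_continuousOn h2

include h0

lemma dini_anti {a b : ℝ} (ha : 0 < a) (hab : a ≤ b) :
    ∫ s in b..1, ω s / s ≤ ∫ s in a..1, ω s / s := by
  have hb := ha.trans_le hab
  rw [← intervalIntegral.integral_add_adjacent_intervals (dini_intervalIntegrable hm ha hb)
    (dini_intervalIntegrable hm hb one_pos)]
  have : 0 ≤ ∫ s in a..b, ω s / s :=
    intervalIntegral.integral_nonneg hab fun s hs => div_nonneg (h0 s) (ha.le.trans hs.1)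
  linarith

omit h0 in
lemma dini_double {r : ℝ} (hr : 0 < r) (h0r : 0 ≤ ω r) :
    (∫ s in (2 * r)..1, ω s / s) + ω r / 2 ≤ ∫ s in r..1, ω s / s := by
  have h2r : 0 < 2 * r := by linarith
  rw [← intervalIntegral.integral_add_adjacent_intervals (dini_intervalIntegrable hm hr h2r)
    (dini_intervalIntegrable hm h2r one_pos)]
  have h1 : ∫ _ in r..(2 * r), ω r / (2 * r) ≤ ∫ s in r..(2 * r), ω s / s := by
    refine intervalIntegral.integral_mono_on (by linarith) (by simp)
      (dini_intervalIntegrable hm hr h2r) fun s hs => ?_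
    have hs0 : 0 < s := hr.trans_le hs.1
    exact div_le_div₀ (h0r.trans (hm hs.1)) (hm hs.1) hs0 hs.2
  rw [intervalIntegral.integral_const, smul_eq_mul] at h1
  have : (2 * r - r) * (ω r / (2 * r)) = ω r / 2 := by field_simp; ring
  linarith

omit h0 in
lemma dini_log {a ε : ℝ} (ha : 0 < a) (ha1 : a ≤ 1) (hε : ε ≤ ω a) :
    ε * Real.log (1 / a) ≤ ∫ s in a..1, ω s / s := by
  have h1 : ∫ s in a..1, ε * (1 / s) = ε * Real.log (1 / a) := by
    rw [intervalIntegral.integral_const_mul, integral_one_div_of_pos ha one_pos]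
  rw [← h1]
  refine intervalIntegral.integral_mono_on ha1 ?_ (dini_intervalIntegrable hm ha one_pos)
    fun s hs => ?_
  · refine (intervalIntegral.intervalIntegrable_one_div ?_ continuousOn_id).const_mul ε
    intro s hs
    rw [uIcc_of_le ha1] at hs
    exact (ha.trans_le hs.1).ne'
  · have hs0 : 0 < s := ha.trans_le hs.1
    rw [mul_one_div]
    exact div_le_div_of_nonneg_right (hε.trans (hm hs.1)) hs0.le

end Dini

section OneStep

set_option linter.unusedSectionVars false

open Module (finrank)
open Filter Topology

variable {E : Type*} [NormedAddCommGroup E] [InnerProductSpace ℝ E] [FiniteDimensional ℝ E]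
variable {Ω : Set E} {u w : E → ℝ} {G Gw : E → E} {H Hw : E → E →L[ℝ] E}

lemma secondDiff_le_of_bound (hu : MASol Ω u G H) {c h1 : ℝ} (hc : 0 < c) {x h : E} (hx : x ∈ Ω)
    (hB : ∀ v, ‖v‖ ≤ c → x + v ∈ Ω ∧ breg u G (x + v) x ≤ h1) (hh : ‖h‖ ≤ c) :
    secondDiff u h x ≤ ‖h‖ / c * (2 * h1) := by
  rcases eq_or_ne h 0 with rfl | h0
  · simp [secondDiff, two_mul]
  have hn : 0 < ‖h‖ := norm_pos_iff.2 h0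
  have key : ∀ k : E, ‖k‖ = ‖h‖ → breg u G (x + k) x ≤ ‖h‖ / c * h1 := by
    intro k hk
    have hv : ‖(c / ‖h‖) • k‖ ≤ c := by
      rw [norm_smul, hk, Real.norm_of_nonneg (by positivity), div_mul_cancel₀ _ hn.ne']
    obtain ⟨g1, g2⟩ := hB _ hv
    have g3 := (hu.breg_segment g1 hx (t := ‖h‖ / c) (by positivity) ((div_le_one hc).2 hh)).2
    have e : x + (‖h‖ / c) • (x + (c / ‖h‖) • k - x) = x + k := by
      rw [add_sub_cancel_left, smul_smul, div_mul_div_cancel₀ hc.ne', div_self hn.ne', one_smul]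
    rw [e] at g3
    exact g3.trans (mul_le_mul_of_nonneg_left g2 (by positivity))
  have k1 := key h rfl
  have k2 := key (-h) (norm_neg h)
  rw [secondDiff_eq_breg u G, sub_eq_add_neg]
  linarith

lemma exists_growth_chain {v : E → ℝ} {x0 : E} {b τ N : ℝ} (hb : 0 ≤ b) (hτ : 0 ≤ τ) (hN : 0 ≤ N)
    (J : ℕ) (h : ∀ x, ‖x - x0‖ ≤ J * b → N ≤ v x → ∃ y ∈ closedBall x b, (1 + τ) * v x ≤ v y)
    (h0 : N ≤ v x0) : ∀ j : ℕ, j ≤ J → ∃ x, ‖x - x0‖ ≤ j * b ∧ (1 + τ) ^ j * N ≤ v x := by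
  intro j
  induction j with
  | zero => intro _; exact ⟨x0, by simp, by simpa using h0⟩
  | succ j ih =>
    intro hj
    obtain ⟨x, hx1, hx2⟩ := ih (by omega)
    have hjJ : (j:ℝ) ≤ J := by exact_mod_cast (by omega : j ≤ J)
    have hone : 1 ≤ (1 + τ) ^ j := one_le_pow₀ (by linarith)
    obtain ⟨y, hy1, hy2⟩ := h x (hx1.trans (mul_le_mul_of_nonneg_right hjJ hb))
      (le_trans (by nlinarith) hx2)
    rw [mem_closedBall, dist_eq_norm] at hy1
    refine ⟨y, ?_, ?_⟩
    · have := norm_add_le (y - x) (x - x0)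
      rw [sub_add_sub_cancel] at this
      push_cast
      linarith
    · refine le_trans ?_ hy2
      calc (1 + τ) ^ (j + 1) * N = (1 + τ) * ((1 + τ) ^ j * N) := by ring
        _ ≤ _ := mul_le_mul_of_nonneg_left hx2 (by linarith)

lemma two_pow_le_growth {t : ℝ} (ht : 0 < t) (m : ℕ) : (2:ℝ) ^ m ≤ (1 + t) ^ (⌈1 / t⌉₊ * m) := by
  rw [pow_mul]
  refine pow_le_pow_left₀ (by norm_num) ?_ m
  have h1 := one_add_mul_le_pow (a := t) (by linarith) ⌈1 / t⌉₊
  have h2 : 1 ≤ (⌈1 / t⌉₊ : ℝ) * t := by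
    rw [← div_le_iff₀ ht]; exact Nat.le_ceil _
  linarith

lemma chain_length_le {t : ℝ} (ht : 0 < t) (ht1 : t ≤ 1) {m : ℕ} (hm : m * t ≤ 1) :
    ((⌈1 / t⌉₊ * m : ℕ) : ℝ) * t ^ 8 + t ^ 8 ≤ 3 * t := by
  have h1 : (⌈1 / t⌉₊ : ℝ) * t ≤ 2 := by
    have := (Nat.ceil_lt_add_one (a := 1 / t) (by positivity)).le
    calc (⌈1 / t⌉₊ : ℝ) * t ≤ (1 / t + 1) * t := mul_le_mul_of_nonneg_right this ht.le
      _ = 1 + t := by field_simp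
      _ ≤ 2 := by linarith
  have h2 : (⌈1 / t⌉₊ : ℝ) * t * (m * t) ≤ 2 * 1 :=
    mul_le_mul h1 hm (by positivity) (by norm_num)
  have h3 : t ^ 6 ≤ t := pow_le_of_le_one ht.le ht1 (by norm_num)
  have h4 : t ^ 8 ≤ t := pow_le_of_le_one ht.le ht1 (by norm_num)
  push_cast
  have h5 : (⌈1 / t⌉₊ : ℝ) * m * t ^ 8 = ((⌈1 / t⌉₊ : ℝ) * t * (m * t)) * t ^ 6 := by ring
  rw [h5]
  have h6 : 0 < t ^ 6 := by positivity
  nlinarith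

set_option maxHeartbeats 1000000 in
/-- Passing from step `2r` to step `r`, second differences of a solution grow at most by the
expected factor `1/4`, up to a relative error controlled by the oscillation of the determinant. -/
lemma exists_one_step [Nontrivial E] {h1 c0 c1 : ℝ} (hh1 : 0 < h1) (hc0 : 0 < c0) (hc1 : 0 < c1)
    {P : ℕ} (hP : 0 < P) :
    ∃ ε0 > (0:ℝ), ∃ t0 > (0:ℝ), ∃ C1 > (0:ℝ), ∀ (u : E → ℝ) (G : E → E) (H : E → E →L[ℝ] E),
      MASol (ball (0:E) 1) u G H →
      (∀ y ∈ closedBall (0:E) (3 / 4),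
        (∀ x ∈ ball (0:E) 1, ‖x - y‖ ≤ 1 → c1 * ‖x - y‖ ^ P ≤ breg u G x y) ∧
        (∀ v, ‖v‖ ≤ c0 → y + v ∈ ball (0:E) 1 ∧ breg u G (y + v) y ≤ h1)) →
      ∀ ω : ℝ → ℝ, Monotone ω → (∀ r, 0 ≤ ω r) →
      (∀ x ∈ ball (0:E) 1, ∀ y ∈ ball (0:E) 1,
        Real.log (H x).det - ω (dist x y) ≤ Real.log (H y).det) →
      ∀ t, 0 < t → t ≤ t0 → ∀ m : ℕ, m * t ≤ 1 → 2 * h1 ≤ 2 ^ m * (t ^ (16 * P)) ^ 2 →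
      ∀ R A : ℝ, R ≤ 5 / 8 → 1 ≤ A → ω (2 * t ^ 8) ≤ ε0 →
      (∀ x ∈ closedBall (0:E) R, ∀ h : E, ‖h‖ = 2 * t ^ (16 * P) →
        secondDiff u h x ≤ A * (2 * t ^ (16 * P)) ^ 2) →
      ∀ x ∈ closedBall (0:E) (R - 3 * t), ∀ h : E, ‖h‖ = t ^ (16 * P) →
        secondDiff u h x ≤ A * (1 + C1 * (t + ω (t ^ (16 * P)))) * (t ^ (16 * P)) ^ 2 := by
  obtain ⟨M, hM, K, hK, ε, hε, C, hC, hdoub⟩ := exists_secondDiff_doubling (E := E)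
  set q := c0 * c1 / (4 * K * h1 * 8 ^ P) with hq
  have hq0 : 0 < q := by positivity
  refine ⟨min ε (1 / (4 * C)), by positivity,
    min (1 / 2) (min (1 / M) (min c0 (min (1 / (4 * C)) q))), by positivity, 2 * C, by positivity, ?_⟩
  intro u G H hu hest ω hmono hω0 hosc t ht htt m hm hm2 R A hR hA hωb hprev x0 hx0 h hh
  simp only [le_min_iff] at htt hωb
  obtain ⟨ht1, ht2, ht3, ht4, ht5⟩ := htt
  have htle : t ≤ 1 := by linarith
  set r := t ^ (16 * P) with hr
  have hr0 : 0 < r := by positivity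
  have hr9 : r ≤ t ^ 9 := pow_le_pow_of_le_one ht.le htle (by omega)
  have h98 : t ^ 9 ≤ t ^ 8 := pow_le_pow_of_le_one ht.le htle (by omega)
  have hrt : r ≤ t := pow_le_of_le_one ht.le htle (by omega)
  have hb16 : t ^ 8 ≤ 1 / 16 := by
    calc t ^ 8 ≤ (1 / 2) ^ 8 := pow_le_pow_left₀ ht.le ht1 8
      _ ≤ 1 / 16 := by norm_num
  have hb0 : 0 < t ^ 8 := by positivity
  have hrc : r ≤ c0 := hrt.trans ht3
  have hs1 : C * (t + ω r) ≤ 1 / 2 := by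
    have h1' : ω r ≤ 1 / (4 * C) := (hmono (by linarith)).trans hωb.2
    have h2' : t + ω r ≤ 1 / (4 * C) + 1 / (4 * C) := add_le_add ht4 h1'
    calc C * (t + ω r) ≤ C * (1 / (4 * C) + 1 / (4 * C)) := mul_le_mul_of_nonneg_left h2' hC.le
      _ = 1 / 2 := by field_simp; norm_num
  have hs0 : 0 ≤ C * (t + ω r) := mul_nonneg hC.le (add_nonneg ht.le (hω0 r))
  by_contra hcon
  push Not at hcon
  set N := A * (1 + 2 * C * (t + ω r)) * r ^ 2 with hN
  have hAr : 0 < A * r ^ 2 := mul_pos (by linarith) (by positivity)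
  have hNA : A * r ^ 2 ≤ N := by rw [hN]; nlinarith
  have hN0 : 0 < N := hAr.trans_le hNA
  have hlen := chain_length_le ht htle hm
  rw [mem_closedBall_zero_iff] at hx0
  have hloc : ∀ x, ‖x - x0‖ ≤ ((⌈1 / t⌉₊ * m : ℕ) : ℝ) * t ^ 8 → ∀ y ∈ closedBall x (t ^ 8),
      ‖y‖ ≤ R := by
    intro x hx y hy
    rw [mem_closedBall, dist_eq_norm] at hy
    have g1 := norm_add_le (y - x) (x - x0)
    have g2 := norm_add_le (y - x0) x0
    rw [sub_add_sub_cancel] at g1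
    rw [sub_add_cancel] at g2
    linarith
  have hjump : ∀ x, ‖x - x0‖ ≤ ((⌈1 / t⌉₊ * m : ℕ) : ℝ) * t ^ 8 → N < secondDiff u h x →
      ∃ y ∈ closedBall x (t ^ 8), (1 + t) * secondDiff u h x < secondDiff u h y := by
    intro x hx hNx
    by_contra hno
    push Not at hno
    have hloc' := hloc x hx
    have hball : ∀ y ∈ closedBall x (t ^ 8), y ∈ ball (0:E) 1 := fun y hy => by
      rw [mem_ball_zero_iff]; linarith [hloc' y hy]
    have hcb : ∀ y ∈ closedBall x (t ^ 8), y ∈ closedBall (0:E) (3 / 4) := fun y hy => by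
      rw [mem_closedBall_zero_iff]; linarith [hloc' y hy]
    have hxx : x ∈ closedBall x (t ^ 8) := mem_closedBall_self hb0.le
    have hdist : ∀ y ∈ closedBall x (t ^ 8), ∀ z ∈ closedBall x (t ^ 8), dist y z ≤ 2 * t ^ 8 := by
      intro y hy z hz
      have := dist_triangle_right y z x
      rw [mem_closedBall] at hy hz
      linarith
    have hNup : secondDiff u h x ≤ r / c0 * (2 * h1) := by
      have := secondDiff_le_of_bound hu hc0 (hball x hxx) (hest x (hcb x hxx)).2
        (h := h) (by rw [hh]; exact hrc)
      rwa [hh] at this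
    obtain ⟨x', hx', hlow⟩ := hdoub _ u G H hu x h (t ^ 8) t (ω r) (secondDiff u h x) hb0
      (by
        intro y hy
        rw [mem_ball, dist_eq_norm] at hy
        rw [mem_ball_zero_iff]
        have g1 := norm_add_le (y - x) x
        rw [sub_add_cancel] at g1
        linarith [hloc' x hxx])
      (by
        rw [hh]
        rw [le_div_iff₀ hM] at ht2
        calc M * r ≤ M * t ^ 9 := mul_le_mul_of_nonneg_left hr9 hM.le
          _ = t * M * t ^ 8 := by ring
          _ ≤ 1 * t ^ 8 := mul_le_mul_of_nonneg_right ht2 hb0.le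
          _ = t ^ 8 := one_mul _)
      ht htle (hω0 r) (hN0.trans hNx) rfl hno
      (by
        intro y hy z hz hyz
        refine lt_of_lt_of_le ?_ ((hest z (hcb z hz)).1 y (hball y hy) (by
          rw [← dist_eq_norm]; linarith [hdist y hy z hz]))
        have hp : (t ^ 8 / 8) ^ P ≤ ‖y - z‖ ^ P := pow_le_pow_left₀ (by positivity) hyz P
        refine lt_of_lt_of_le ?_ (mul_le_mul_of_nonneg_left hp hc1.le)
        have hT : t ^ (8 * P) ≤ q := (pow_le_of_le_one ht.le htle (by omega)).trans ht5
        rw [hq, le_div_iff₀ (by positivity)] at hT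
        have hr2 : r = t ^ (8 * P) * t ^ (8 * P) := by rw [hr, ← pow_add]; congr 1; ring
        have hT0 : 0 < t ^ (8 * P) := by positivity
        calc K * secondDiff u h x ≤ K * (r / c0 * (2 * h1)) :=
              mul_le_mul_of_nonneg_left hNup hK.le
          _ = t ^ (8 * P) * (t ^ (8 * P) * (4 * K * h1 * 8 ^ P)) / (2 * c0 * 8 ^ P) := by
              rw [hr2]; field_simp; ring
          _ ≤ t ^ (8 * P) * (c0 * c1) / (2 * c0 * 8 ^ P) := by gcongr
          _ = c1 * (t ^ 8 / 8) ^ P / 2 := by rw [div_pow, ← pow_mul]; field_simp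
          _ < c1 * (t ^ 8 / 8) ^ P := half_lt_self (by positivity))
      (by
        intro y hy z hz
        have g1 := hosc y (hball y hy) z (hball z hz)
        have g2 := hmono (hdist y hy z hz)
        linarith [hωb.1])
      (by
        intro y hy
        have hk : ∀ k : E, ‖k‖ = r → Real.log (H y).det - ω r ≤ Real.log (H (y + k)).det := by
          intro k hk
          have hyk : y + k ∈ ball (0:E) 1 := by
            rw [mem_ball_zero_iff]
            have := norm_add_le y k
            linarith [hloc' y hy]
          have := hosc y (hball y hy) _ hyk
          rwa [dist_self_add_right, hk] at this
        refine ⟨hk h hh, ?_⟩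
        have := hk (-h) (by rw [norm_neg, hh])
        rwa [← sub_eq_add_neg] at this)
    have hup := hprev x' (by rw [mem_closedBall_zero_iff]; exact hloc' x' hx') ((2:ℝ) • h)
      (by rw [norm_smul, hh]; norm_num)
    have hfin : N * (1 - C * (t + ω r)) < secondDiff u h x * (1 - C * (t + ω r)) :=
      mul_lt_mul_of_pos_right hNx (by linarith)
    have hfin2 : A * r ^ 2 ≤ N * (1 - C * (t + ω r)) := by
      set s := C * (t + ω r) with hs
      have e : N * (1 - s) = A * r ^ 2 * ((1 + 2 * s) * (1 - s)) := by rw [hN, hs]; ring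
      rw [e]
      have : 1 ≤ (1 + 2 * s) * (1 - s) := by nlinarith
      nlinarith
    nlinarith
  obtain ⟨N', hN1, hN2⟩ := exists_between hcon
  obtain ⟨x, hx, hxv⟩ := exists_growth_chain (v := secondDiff u h) (x0 := x0) hb0.le ht.le
    (hN0.trans hN1).le (⌈1 / t⌉₊ * m) (fun x hx hxN => by
      obtain ⟨y, hy, hy2⟩ := hjump x hx (hN1.trans_le hxN)
      exact ⟨y, hy, hy2.le⟩) hN2.le _ le_rfl
  have hxn := hloc x hx x (mem_closedBall_self hb0.le)
  have hup := secondDiff_le_of_bound hu hc0 (x := x) (h := h)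
    (by rw [mem_ball_zero_iff]; linarith)
    (hest x (by rw [mem_closedBall_zero_iff]; linarith)).2 (by rw [hh]; exact hrc)
  have hup2 : ‖h‖ / c0 * (2 * h1) ≤ 2 * h1 := by
    have : ‖h‖ / c0 ≤ 1 := by rw [div_le_one hc0, hh]; exact hrc
    nlinarith
  have hg := two_pow_le_growth ht m
  have h2m : (0:ℝ) < 2 ^ m := by positivity
  have hr2 : r ^ 2 ≤ A * r ^ 2 := le_mul_of_one_le_left (by positivity) hA
  have : 2 ^ m * r ^ 2 < (1 + t) ^ (⌈1 / t⌉₊ * m) * N' :=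
    calc 2 ^ m * r ^ 2 < 2 ^ m * N' := mul_lt_mul_of_pos_left (by linarith) h2m
      _ ≤ _ := mul_le_mul_of_nonneg_right hg (hN0.trans hN1).le
  linarith

end OneStep

section Decay

set_option linter.unusedSectionVars false

open Module (finrank)
open Filter Topology

variable {E : Type*} [NormedAddCommGroup E] [InnerProductSpace ℝ E] [FiniteDimensional ℝ E]
variable {Ω : Set E} {u w : E → ℝ} {G Gw : E → E} {H Hw : E → E →L[ℝ] E}

lemma exists_root_half {M : ℕ} (hM : 0 < M) : ∃ q : ℝ, 0 < q ∧ q < 1 ∧ q ^ M = 1 / 2 := by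
  have e : ((1 / 2 : ℝ) ^ (1 / (M:ℝ))) ^ M = 1 / 2 := by
    rw [one_div (M:ℝ), Real.rpow_inv_natCast_pow (by norm_num) hM.ne']
  refine ⟨(1 / 2 : ℝ) ^ (1 / (M:ℝ)), by positivity, ?_, e⟩
  exact Real.rpow_lt_one (by norm_num) (by norm_num) (by positivity)

lemma exists_scale {q t0 a c0 : ℝ} (hq0 : 0 < q) (hq1 : q < 1) (ht0 : 0 < t0)
    (hc0 : 0 < c0) (k1 : ℕ) : ∃ k0 : ℕ, ∀ k ≥ k0, q ^ k ≤ t0 ∧ ((2 * k + k1 : ℕ) : ℝ) * q ^ k ≤ 1 ∧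
      2 * (q ^ k) ^ 8 ≤ 1 ∧ a * q ^ k ≤ 1 / 16 ∧ (1 / 2 : ℝ) ^ k ≤ c0 := by
  have l1 := tendsto_pow_atTop_nhds_zero_of_lt_one hq0.le hq1
  have l2 := tendsto_self_mul_const_pow_of_lt_one hq0.le hq1
  have l3 : Tendsto (fun k : ℕ => (1 / 2 : ℝ) ^ k) atTop (𝓝 0) :=
    tendsto_pow_atTop_nhds_zero_of_lt_one (by norm_num) (by norm_num)
  have l4 : Tendsto (fun k : ℕ => ((2 * k + k1 : ℕ) : ℝ) * q ^ k) atTop (𝓝 0) := by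
    have := (l2.const_mul 2).add (l1.const_mul (k1:ℝ))
    simp only [mul_zero, add_zero] at this
    refine this.congr fun k => ?_
    push_cast; ring
  have l5 : Tendsto (fun k : ℕ => 2 * (q ^ k) ^ 8) atTop (𝓝 0) := by
    have := (l1.pow 8).const_mul 2
    simpa using this
  have l6 : Tendsto (fun k : ℕ => a * q ^ k) atTop (𝓝 0) := by
    simpa using l1.const_mul a
  exact eventually_atTop.1 ((l1.eventually_le_const ht0).and
    ((l4.eventually_le_const one_pos).and ((l5.eventually_le_const one_pos).and
      ((l6.eventually_le_const (by norm_num)).and (l3.eventually_le_const hc0)))))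

lemma four_pow_mul_half (k : ℕ) : (4:ℝ) ^ k * ((1 / 2 : ℝ) ^ k) ^ 2 = 1 := by
  rw [← pow_mul, mul_comm k 2, pow_mul, ← mul_pow]; norm_num

lemma log_scale {q : ℝ} (hq0 : 0 < q) {M : ℕ} (hM : 0 < M) (hqM : q ^ M = 1 / 2) (k : ℕ) :
    Real.log (1 / (2 * (q ^ k) ^ 8)) = 8 * k * Real.log 2 / M - Real.log 2 := by
  have h1 : (M:ℝ) * Real.log q = - Real.log 2 := by
    rw [← Real.log_pow, hqM, one_div, Real.log_inv]
  have hM' : (M:ℝ) ≠ 0 := by exact_mod_cast hM.ne'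
  have h2 : Real.log q = - Real.log 2 / M := by rw [eq_div_iff hM']; linarith
  rw [one_div, Real.log_inv, Real.log_mul (by norm_num) (by positivity), Real.log_pow,
    Real.log_pow, h2]
  push_cast; ring

lemma exists_secondDiff_le [Nontrivial E] {h1 c0 c1 : ℝ} (hh1 : 0 < h1) (hc0 : 0 < c0)
    (hc1 : 0 < c1) {P : ℕ} (hP : 0 < P) :
    ∃ Γ > (0:ℝ), ∃ A > (0:ℝ), ∃ k0 : ℕ, (1 / 2 : ℝ) ^ k0 ≤ c0 ∧
      ∀ (u : E → ℝ) (G : E → E) (H : E → E →L[ℝ] E),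
      MASol (ball (0:E) 1) u G H →
      (∀ y ∈ closedBall (0:E) (3 / 4),
        (∀ x ∈ ball (0:E) 1, ‖x - y‖ ≤ 1 → c1 * ‖x - y‖ ^ P ≤ breg u G x y) ∧
        (∀ v, ‖v‖ ≤ c0 → y + v ∈ ball (0:E) 1 ∧ breg u G (y + v) y ≤ h1)) →
      ∀ ω : ℝ → ℝ, Monotone ω → (∀ r, 0 ≤ ω r) →
      (∀ x ∈ ball (0:E) 1, ∀ y ∈ ball (0:E) 1,
        Real.log (H x).det - ω (dist x y) ≤ Real.log (H y).det) →
      ∀ k ≥ k0, ∀ x ∈ closedBall (0:E) (9 / 16), ∀ h : E, ‖h‖ = (1 / 2) ^ k →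
        secondDiff u h x ≤
          A * Real.exp (Γ * ∫ s in ((1 / 2 : ℝ) ^ k)..1, ω s / s) * ((1 / 2) ^ k) ^ 2 := by
  obtain ⟨ε0, hε0, t0, ht0, C1, hC1, hstep⟩ := exists_one_step (E := E) hh1 hc0 hc1 hP
  have hM : 0 < 16 * P := by omega
  obtain ⟨q, hq0, hq1, hqM⟩ := exists_root_half hM
  have hMr : (0:ℝ) < (16 * P : ℕ) := by exact_mod_cast hM
  have h1q : 0 < 1 - q := by linarith
  obtain ⟨k1, hk1⟩ := pow_unbounded_of_one_lt (2 * h1) (by norm_num : (1:ℝ) < 2)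
  set a := 3 / (1 - q) with ha
  set a' := C1 / (1 - q) with ha'
  have ha0 : 0 < a := by positivity
  have ha'0 : 0 < a' := by positivity
  obtain ⟨k0, hk0⟩ := exists_scale (a := a) hq0 hq1 ht0 hc0 k1
  set Γ := 2 * C1 + (16 * P : ℕ) / (4 * ε0) with hΓ
  have hΓ0 : 0 < Γ := by positivity
  have hΓε : 2 * ((16 * P : ℕ):ℝ) ≤ Γ * ε0 * 8 := by
    have : Γ * ε0 * 8 = 16 * C1 * ε0 + 2 * (16 * P : ℕ) := by rw [hΓ]; field_simp; ring
    rw [this]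
    have : 0 < 16 * C1 * ε0 := by positivity
    linarith
  have hlog2 : 0 < Real.log 2 := Real.log_pos (by norm_num)
  set L := 1 + 2 * h1 * 4 ^ k0 with hL
  have hL1 : 1 ≤ L := by rw [hL]; have : 0 < 2 * h1 * 4 ^ k0 := by positivity
                         linarith
  have hL2 : 2 * h1 ≤ L := by
    have : (1:ℝ) ≤ 4 ^ k0 := one_le_pow₀ (by norm_num)
    rw [hL]; nlinarith
  set A := L * Real.exp (a' + Γ * ε0 * Real.log 2) with hA
  have hA0 : 0 < A := by positivity
  refine ⟨Γ, hΓ0, A, hA0, k0, (hk0 k0 le_rfl).2.2.2.2, ?_⟩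
  intro u G H hu hest ω hmono hω0 hosc
  set I : ℝ → ℝ := fun d => ∫ s in d..1, ω s / s with hI
  have hρ0 : ∀ k : ℕ, 0 < (1 / 2 : ℝ) ^ k := fun k => by positivity
  have hI0 : ∀ k : ℕ, 0 ≤ I ((1 / 2 : ℝ) ^ k) := by
    intro k
    have := dini_anti hmono hω0 (hρ0 k) (pow_le_one₀ (by norm_num) (by norm_num))
    simpa using this
  have hq : ∀ k : ℕ, q ^ k ≤ 1 := fun k => pow_le_one₀ hq0.le hq1.le
  set F : ℕ → ℝ := fun k => A * Real.exp (Γ * I ((1 / 2 : ℝ) ^ k) - a' * q ^ k) with hF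
  have hFL : ∀ k (s : ℝ), s ≤ Γ * I ((1 / 2 : ℝ) ^ k) + Γ * ε0 * Real.log 2 →
      L * Real.exp s ≤ F k := by
    intro k s hs
    simp only [hF, hA]
    rw [mul_assoc, ← Real.exp_add]
    refine mul_le_mul_of_nonneg_left (Real.exp_le_exp.2 ?_) (by linarith)
    have := hq k
    nlinarith
  have hcrude : ∀ k ≥ k0, ∀ x ∈ closedBall (0:E) (3 / 4), ∀ h : E, ‖h‖ = (1 / 2) ^ k →
      secondDiff u h x ≤ 2 * h1 := by
    intro k hk x hx h hh
    have hc := (hk0 k hk).2.2.2.2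
    rw [← hh] at hc
    have g := secondDiff_le_of_bound hu hc0 (closedBall_subset_ball (by norm_num) hx)
      (hest x hx).2 hc
    have : ‖h‖ / c0 ≤ 1 := (div_le_one hc0).2 hc
    nlinarith
  have main : ∀ k ≥ k0, ∀ x ∈ closedBall (0:E) (9 / 16 + a * q ^ k), ∀ h : E,
      ‖h‖ = (1 / 2) ^ k → secondDiff u h x ≤ F k * ((1 / 2) ^ k) ^ 2 := by
    intro k hk
    have hsmall : ∀ k ≥ k0, closedBall (0:E) (9 / 16 + a * q ^ k) ⊆ closedBall 0 (3 / 4) :=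
      fun k hk => closedBall_subset_closedBall (by linarith [(hk0 k hk).2.2.2.1])
    induction k, hk using Nat.le_induction with
    | base =>
      intro x hx h hh
      refine (hcrude k0 le_rfl x (hsmall k0 le_rfl hx) h hh).trans ?_
      have g1 : L * Real.exp 0 ≤ F k0 := hFL k0 0 (by
        have := mul_nonneg hΓ0.le (hI0 k0)
        positivity)
      rw [Real.exp_zero, mul_one] at g1
      have g2 : 2 * h1 * 4 ^ k0 ≤ F k0 := by rw [hL] at g1; linarith
      calc 2 * h1 = 2 * h1 * 4 ^ k0 * ((1 / 2) ^ k0) ^ 2 := by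
            rw [mul_assoc, four_pow_mul_half, mul_one]
        _ ≤ _ := mul_le_mul_of_nonneg_right g2 (by positivity)
    | succ k hk ih =>
      have hk' : k0 ≤ k + 1 := by omega
      obtain ⟨e1, e2, e3, e4, e5⟩ := hk0 (k + 1) hk'
      have hpow : (q ^ (k + 1)) ^ (16 * P) = (1 / 2 : ℝ) ^ (k + 1) := by
        rw [← pow_mul, mul_comm, pow_mul, hqM]
      have htwo : 2 * (1 / 2 : ℝ) ^ (k + 1) = (1 / 2) ^ k := by rw [pow_succ]; ring
      have hqs : q ^ (k + 1) ≤ q ^ k := pow_le_pow_of_le_one hq0.le hq1.le (by omega)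
      have hqk0 : 0 < q ^ (k + 1) := by positivity
      rcases le_or_gt (ω (2 * (q ^ (k + 1)) ^ 8)) ε0 with hgood | hbad
      · have hFk : 1 ≤ F k := by
          have := hFL k 0 (by
            have := mul_nonneg hΓ0.le (hI0 k)
            positivity)
          rw [Real.exp_zero, mul_one] at this
          linarith
        have g := hstep u G H hu hest ω hmono hω0 hosc (q ^ (k + 1)) hqk0 e1
          (2 * (k + 1) + k1) e2 (by
            rw [hpow, pow_add, pow_mul, show (2:ℝ) ^ 2 = 4 by norm_num, mul_right_comm,
              four_pow_mul_half, one_mul]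
            exact hk1.le)
          (9 / 16 + a * q ^ k) (F k) (by linarith [(hk0 k hk).2.2.2.1]) hFk hgood
          (by rw [hpow, htwo]; exact ih)
        rw [hpow] at g
        intro x hx h hh
        refine (g x (closedBall_subset_closedBall ?_ hx) h hh).trans ?_
        · have : a * q ^ k - a * q ^ (k + 1) = 3 * q ^ k := by
            rw [ha, pow_succ]; field_simp
          linarith
        refine mul_le_mul_of_nonneg_right ?_ (by positivity)
        have hd := dini_double hmono (hρ0 (k + 1)) (hω0 _)
        rw [htwo] at hd
        change I ((1 / 2 : ℝ) ^ k) + _ ≤ I ((1 / 2 : ℝ) ^ (k + 1)) at hd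
        have g1 : 1 + C1 * (q ^ (k + 1) + ω ((1 / 2) ^ (k + 1))) ≤
            Real.exp (C1 * (q ^ (k + 1) + ω ((1 / 2) ^ (k + 1)))) := by
          rw [add_comm]; exact Real.add_one_le_exp _
        refine (mul_le_mul_of_nonneg_left g1 (by linarith)).trans ?_
        simp only [hF]
        rw [mul_assoc, ← Real.exp_add]
        refine mul_le_mul_of_nonneg_left (Real.exp_le_exp.2 ?_) hA0.le
        have e6 : a' * q ^ k - a' * q ^ (k + 1) = C1 * q ^ k := by
          rw [ha', pow_succ]; field_simp
        have e7 := mul_le_mul_of_nonneg_left hqs hC1.le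
        have e8 := mul_le_mul_of_nonneg_left hd hΓ0.le
        have e9 : C1 * ω ((1 / 2) ^ (k + 1)) ≤ Γ * (ω ((1 / 2) ^ (k + 1)) / 2) := by
          have : 2 * C1 ≤ Γ := by
            rw [hΓ]; exact le_add_of_nonneg_right (by positivity)
          nlinarith [hω0 ((1 / 2) ^ (k + 1))]
        linarith
      · intro x hx h hh
        refine (hcrude (k + 1) hk' x (hsmall (k + 1) hk' hx) h hh).trans ?_
        have hle : (1 / 2 : ℝ) ^ (k + 1) ≤ 2 * (q ^ (k + 1)) ^ 8 := by
          rw [← hpow]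
          have : (q ^ (k + 1)) ^ (16 * P) ≤ (q ^ (k + 1)) ^ 8 :=
            pow_le_pow_of_le_one hqk0.le (hq _) (by omega)
          have : 0 < (q ^ (k + 1)) ^ 8 := by positivity
          linarith
        have d1 := dini_log hmono (a := 2 * (q ^ (k + 1)) ^ 8) (by positivity) e3 hbad.le
        have d2 := d1.trans (dini_anti hmono hω0 (hρ0 (k + 1)) hle)
        change _ ≤ I ((1 / 2 : ℝ) ^ (k + 1)) at d2
        rw [log_scale hq0 hM hqM] at d2
        have d3 := mul_le_mul_of_nonneg_left d2 hΓ0.le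
        have d4 : 2 * ((k + 1 : ℕ):ℝ) * Real.log 2 ≤
            Γ * ε0 * (8 * ((k + 1 : ℕ):ℝ) * Real.log 2 / (16 * P : ℕ)) := by
          have e : Γ * ε0 * (8 * ((k + 1 : ℕ):ℝ) * Real.log 2 / (16 * P : ℕ)) =
            (Γ * ε0 * 8) / (16 * P : ℕ) * (((k + 1 : ℕ):ℝ) * Real.log 2) := by ring
          rw [e, mul_assoc 2]
          refine mul_le_mul_of_nonneg_right ?_ (by positivity)
          rwa [le_div_iff₀ hMr]
        have d5 := hFL (k + 1) (2 * ((k + 1 : ℕ):ℝ) * Real.log 2) (by linarith)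
        have d6 : Real.exp (2 * ((k + 1 : ℕ):ℝ) * Real.log 2) = 4 ^ (k + 1) := by
          rw [show 2 * ((k + 1 : ℕ):ℝ) * Real.log 2 = ((k + 1 : ℕ):ℝ) * Real.log (2 ^ 2) by
            rw [Real.log_pow]; push_cast; ring, Real.exp_nat_mul, Real.exp_log (by norm_num)]
          norm_num
        rw [d6] at d5
        calc 2 * h1 = 2 * h1 * (4 ^ (k + 1) * ((1 / 2) ^ (k + 1)) ^ 2) := by
              rw [four_pow_mul_half, mul_one]
          _ ≤ L * (4 ^ (k + 1) * ((1 / 2) ^ (k + 1)) ^ 2) :=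
              mul_le_mul_of_nonneg_right hL2 (by positivity)
          _ = L * 4 ^ (k + 1) * ((1 / 2) ^ (k + 1)) ^ 2 := by ring
          _ ≤ _ := mul_le_mul_of_nonneg_right d5 (by positivity)
  intro k hk x hx h hh
  have hqk : 0 < a * q ^ k := by positivity
  refine (main k hk x (closedBall_subset_closedBall (by linarith) hx) h hh).trans ?_
  refine mul_le_mul_of_nonneg_right ?_ (by positivity)
  refine mul_le_mul_of_nonneg_left (Real.exp_le_exp.2 ?_) hA0.le
  have : 0 < a' * q ^ k := by positivity
  change Γ * I ((1 / 2) ^ k) - _ ≤ Γ * I ((1 / 2) ^ k)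
  linarith

/-- Interior modulus of continuity of the gradient for solutions in the unit ball. -/
theorem exists_gradient_estimate [Nontrivial E] {lam Lam : ℝ} (hlam : 0 < lam) (hLam : lam ≤ Lam)
    {σ : ℝ → ℝ} (hσ : ∀ t > 0, 0 < σ t) :
    ∃ θ > (0:ℝ), ∃ C > (0:ℝ), ∀ (u : E → ℝ) (G : E → E) (H : E → E →L[ℝ] E),
      UnitSol lam Lam σ u G H →
      ∀ ω : ℝ → ℝ, Monotone ω → (∀ r, 0 ≤ ω r) →
      (∀ x ∈ ball (0:E) 1, ∀ y ∈ ball (0:E) 1,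
        Real.log (H x).det - ω (dist x y) ≤ Real.log (H y).det) →
      ∀ x ∈ ball (0:E) (1 / 2), ∀ y ∈ ball (0:E) (1 / 2),
        ‖G x - G y‖ ≤ C * dist x y *
          (1 + Real.exp (2 * θ * ∫ s in (dist x y)..1, ω s / s)) := by
  obtain ⟨h1, hh1, c0, hc0, c1, hc1, P, hP, hest⟩ :=
    exists_unit_estimates (E := E) hlam hLam hσ
  obtain ⟨Γ, hΓ, A, hA, k0, hk0, hmain⟩ := exists_secondDiff_le (E := E) hh1 hc0 hc1 hP
  obtain ⟨m, hm⟩ := exists_nat_ge (2 / c0)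
  have hd00 : (0:ℝ) < (1 / 2) ^ k0 / 2 := by positivity
  have hG0 : 0 ≤ (m:ℝ) * (2 * h1 / c0) / ((1 / 2) ^ k0 / 2) := by positivity
  refine ⟨Γ / 2, by positivity, 16 * A + m * (2 * h1 / c0) / ((1 / 2) ^ k0 / 2), by positivity, ?_⟩
  intro u G H hU ω hmono hω0 hosc x hx y hy
  have hu := hU.sol
  have hest' := hest u G H hU
  set d := dist x y with hd
  set I := ∫ s in d..1, ω s / s with hI
  have hexp := Real.exp_pos (2 * (Γ / 2) * I)
  have hd0 : 0 ≤ d := dist_nonneg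
  rcases le_or_gt ((1 / 2) ^ k0 / 2) d with hbig | hsmall
  · have g := hu.norm_grad_sub_le hc0 (fun y hy => (hest' y hy).2) hm hx hy
    refine g.trans ?_
    have g2 : (m:ℝ) * (2 * h1 / c0) ≤ m * (2 * h1 / c0) / ((1 / 2) ^ k0 / 2) * d := by
      rw [div_mul_eq_mul_div, le_div_iff₀ hd00]
      exact mul_le_mul_of_nonneg_left hbig (by positivity)
    refine g2.trans ?_
    have g3 : 0 ≤ 16 * A * d := by positivity
    have g4 : 0 ≤ (16 * A + m * (2 * h1 / c0) / ((1 / 2) ^ k0 / 2)) * d := by positivity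
    nlinarith
  rcases hd0.eq_or_lt with hd0' | hdpos
  · have hxy : x = y := dist_eq_zero.1 hd0'.symm
    rw [← hd0', hxy]; simp
  have hpk0 : (1 / 2 : ℝ) ^ k0 ≤ 1 := pow_le_one₀ (by norm_num) (by norm_num)
  obtain ⟨k, hk1, hk2⟩ := exists_nat_pow_near_of_lt_one (x := 2 * d) (y := (1 / 2 : ℝ))
    (by positivity) (by linarith) (by norm_num) (by norm_num)
  have hk : k0 ≤ k := by
    by_contra hlt
    push Not at hlt
    have : (1 / 2 : ℝ) ^ k0 ≤ (1 / 2) ^ (k + 1) :=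
      pow_le_pow_of_le_one (by norm_num) (by norm_num) (by omega)
    linarith
  set ρ := (1 / 2 : ℝ) ^ k with hρ
  have hρ0 : 0 < ρ := by positivity
  have hρc : ρ ≤ c0 := (pow_le_pow_of_le_one (by norm_num) (by norm_num) hk).trans hk0
  have hρ4 : ρ < 4 * d := by rw [pow_succ] at hk1; linarith
  have hx1 : x ∈ ball (0:E) 1 := ball_subset_ball (by norm_num) hx
  have hx34 : x ∈ closedBall (0:E) (3 / 4) :=
    ball_subset_closedBall (ball_subset_ball (by norm_num) hx)
  have hx916 : x ∈ closedBall (0:E) (9 / 16) :=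
    ball_subset_closedBall (ball_subset_ball (by norm_num) hx)
  have hB : ∀ v, ‖v‖ ≤ 2 * d → x + v ∈ ball (0:E) 1 ∧
      breg u G (x + v) x ≤ A * Real.exp (2 * (Γ / 2) * I) * (16 * d ^ 2) := by
    intro v hv
    refine ⟨((hest' x hx34).2 v (by linarith)).1, ?_⟩
    rcases eq_or_ne v 0 with rfl | hv0
    · rw [add_zero, breg_self]; positivity
    have hvn : 0 < ‖v‖ := norm_pos_iff.2 hv0
    have hh : ‖(ρ / ‖v‖) • v‖ = ρ := by
      rw [norm_smul, Real.norm_of_nonneg (by positivity), div_mul_cancel₀ _ hvn.ne']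
    have g1 := ((hest' x hx34).2 _ (hh.trans_le hρc)).1
    have g2 := ((hest' x hx34).2 (-((ρ / ‖v‖) • v)) (by rw [norm_neg]; exact hh.trans_le hρc)).1
    rw [← sub_eq_add_neg] at g2
    have hs1 : ‖v‖ / ρ ≤ 1 := (div_le_one hρ0).2 (hv.trans hk2)
    have g3 := (hu.breg_segment g1 hx1 (t := ‖v‖ / ρ) (by positivity) hs1).2
    have e : x + (‖v‖ / ρ) • (x + (ρ / ‖v‖) • v - x) = x + v := by
      rw [add_sub_cancel_left, smul_smul, div_mul_div_cancel₀ hρ0.ne', div_self hvn.ne', one_smul]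
    rw [e] at g3
    have g4 := hu.breg_nonneg g1 hx1
    have g5 := hu.breg_le_secondDiff hx1 g2
    have g6 := hmain u G H hu hest' ω hmono hω0 hosc k hk x hx916 _ hh
    refine (g3.trans (mul_le_of_le_one_left g4 hs1)).trans (g5.trans (g6.trans ?_))
    have g7 := dini_anti hmono hω0 hdpos (by linarith : d ≤ ρ)
    have g8 : Real.exp (Γ * ∫ s in ρ..1, ω s / s) ≤ Real.exp (2 * (Γ / 2) * I) := by
      refine Real.exp_le_exp.2 ?_
      rw [mul_div_cancel₀ Γ (by norm_num : (2:ℝ) ≠ 0)]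
      exact mul_le_mul_of_nonneg_left g7 hΓ.le
    have g9 : ρ ^ 2 ≤ 16 * d ^ 2 := by
      calc ρ ^ 2 ≤ (4 * d) ^ 2 := pow_le_pow_left₀ hρ0.le hρ4.le 2
        _ = 16 * d ^ 2 := by ring
    exact mul_le_mul (mul_le_mul_of_nonneg_left g8 hA.le) g9 (by positivity) (by positivity)
  have key := hu.norm_grad_sub_mul_le hx1 hdpos hB (y := y) (by rw [hd, dist_comm, dist_eq_norm])
  rw [norm_sub_rev]
  have e : A * Real.exp (2 * (Γ / 2) * I) * (16 * d ^ 2) =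
      16 * A * d * Real.exp (2 * (Γ / 2) * I) * d := by ring
  rw [e] at key
  refine (le_of_mul_le_mul_right key hdpos).trans ?_
  have f1 : 0 ≤ (m:ℝ) * (2 * h1 / c0) / ((1 / 2) ^ k0 / 2) * d := by positivity
  have f2 : 0 ≤ 16 * A * d := by positivity
  have f3 := mul_nonneg f1 hexp.le
  nlinarith

end Decay

end MA

namespace MA

section ModCont

variable {n : ℕ} {D : Set (EuclideanSpace ℝ (Fin n))} {F : EuclideanSpace ℝ (Fin n) → ℝ}

lemma modCont_nonneg (r : ℝ) : 0 ≤ modCont D F r := by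
  refine Real.sSup_nonneg ?_
  rintro _ ⟨x, _, y, _, _, rfl⟩
  exact abs_nonneg _

variable {a b : ℝ} (hab : ∀ x ∈ D, a ≤ F x ∧ F x ≤ b)
include hab

lemma modCont_bddAbove (r : ℝ) :
    BddAbove {c : ℝ | ∃ x ∈ D, ∃ y ∈ D, dist x y ≤ r ∧ c = |F x - F y|} := by
  refine ⟨b - a, ?_⟩
  rintro _ ⟨x, hx, y, hy, _, rfl⟩
  have h1 := hab x hx
  have h2 := hab y hy
  rw [abs_le]
  constructor <;> linarith

lemma abs_sub_le_modCont {x y : EuclideanSpace ℝ (Fin n)} (hx : x ∈ D) (hy : y ∈ D) :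
    |F x - F y| ≤ modCont D F (dist x y) :=
  le_csSup (modCont_bddAbove hab _) ⟨x, hx, y, hy, le_rfl, rfl⟩

lemma modCont_monotone : Monotone (modCont D F) := by
  intro r s hrs
  refine Real.sSup_le ?_ (modCont_nonneg s)
  rintro _ ⟨x, hx, y, hy, hxy, rfl⟩
  exact le_csSup (modCont_bddAbove hab s) ⟨x, hx, y, hy, hxy.trans hrs, rfl⟩

end ModCont

end MA

/-- Theorem 2.1: interior continuity estimate for `Du` for the Monge–Ampère equation
`det D²u = B(x, u, Du)` in the unit ball. -/
theorem interior_gradient_continuity_estimate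
    (n : ℕ) (lam Lam : ℝ) (hlam : 0 < lam) (hlamLam : lam ≤ Lam)
    (σ ωB : ℝ → ℝ) (hσ : ∀ t > 0, 0 < σ t) :
    ∃ θ > (0:ℝ), ∃ C > (0:ℝ),
      ∀ (B : (EuclideanSpace ℝ (Fin n)) × ℝ × (EuclideanSpace ℝ (Fin n)) → ℝ)
        (u : EuclideanSpace ℝ (Fin n) → ℝ)
        (Du : EuclideanSpace ℝ (Fin n) → EuclideanSpace ℝ (Fin n))
        (D2u : EuclideanSpace ℝ (Fin n) →
          (EuclideanSpace ℝ (Fin n) →L[ℝ] EuclideanSpace ℝ (Fin n))),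
        -- B is continuous on ℝⁿ × ℝ × ℝⁿ
        Continuous B →
        -- u ∈ C²(B₁(0)): Du is the gradient and D2u the (continuous) Hessian of u
        (∀ x ∈ ball (0 : EuclideanSpace ℝ (Fin n)) 1, HasGradientAt u (Du x) x) →
        (∀ x ∈ ball (0 : EuclideanSpace ℝ (Fin n)) 1, HasFDerivAt Du (D2u x) x) →
        ContinuousOn D2u (ball (0 : EuclideanSpace ℝ (Fin n)) 1) →
        -- u is strictly convex, with modulus of convexity bounded below by σ
        StrictConvexOn ℝ (ball (0 : EuclideanSpace ℝ (Fin n)) 1) u →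
        (∀ t > (0:ℝ), ∀ x ∈ ball (0 : EuclideanSpace ℝ (Fin n)) 1,
          ∀ z ∈ ball (0 : EuclideanSpace ℝ (Fin n)) 1,
          t < dist x z → σ t ≤ u x - u z - ⟪Du z, x - z⟫) →
        -- λ ≤ B_u ≤ Λ on B₁(0), where B_u(x) = B(x, u(x), Du(x))
        (∀ x ∈ ball (0 : EuclideanSpace ℝ (Fin n)) 1,
          lam ≤ B (x, u x, Du x) ∧ B (x, u x, Du x) ≤ Lam) →
        -- upper bound for the modulus of continuity of B_u
        (∀ r > (0:ℝ), modCont (ball (0 : EuclideanSpace ℝ (Fin n)) 1)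
          (fun z => B (z, u z, Du z)) r ≤ ωB r) →
        -- the Monge-Ampère equation det D²u = B(x, u, Du) in B₁(0)
        (∀ x ∈ ball (0 : EuclideanSpace ℝ (Fin n)) 1,
          LinearMap.det (D2u x : EuclideanSpace ℝ (Fin n) →ₗ[ℝ]
            EuclideanSpace ℝ (Fin n)) = B (x, u x, Du x)) →
        -- conclusion on B_{1/2}(0)
        ∀ x ∈ ball (0 : EuclideanSpace ℝ (Fin n)) (1/2),
          ∀ y ∈ ball (0 : EuclideanSpace ℝ (Fin n)) (1/2),
          ‖Du x - Du y‖ ≤ C * dist x y *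
            (1 + Real.exp (2 * θ * ∫ r in (dist x y)..1,
              modCont (ball (0 : EuclideanSpace ℝ (Fin n)) 1)
                (fun z => Real.log (B (z, u z, Du z))) r / r)) := by
  rcases Nat.eq_zero_or_pos n with rfl | hn
  · refine ⟨1, one_pos, 1, one_pos, ?_⟩
    intro B u Du D2u _ _ _ _ _ _ _ _ _ x _ y _
    rw [Subsingleton.elim (Du x) (Du y), sub_self, norm_zero]
    have : 0 ≤ dist x y := dist_nonneg
    positivity
  have : Nonempty (Fin n) := ⟨⟨0, hn⟩⟩
  obtain ⟨θ, hθ, C, hC, hmain⟩ :=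
    MA.exists_gradient_estimate (E := EuclideanSpace ℝ (Fin n)) hlam hlamLam hσ
  refine ⟨θ, hθ, C, hC, ?_⟩
  intro B u Du D2u _ hDu hD2u hcont _ hconv hbd _ hdet x hx y hy
  have hdet' : ∀ x ∈ ball (0 : EuclideanSpace ℝ (Fin n)) 1,
      (D2u x).det = B (x, u x, Du x) := hdet
  have hsol : MA.MASol (ball (0 : EuclideanSpace ℝ (Fin n)) 1) u Du D2u :=
    { grad := fun x hx => (hDu x hx).hasFDerivAt
      hess := hD2u
      cont := hcont
      isOpen := isOpen_ball
      convex := convex_ball _ _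
      strict := fun x hx y hy hxy => by
        have hd : 0 < dist x y := dist_pos.2 hxy
        exact (hσ _ (half_pos hd)).trans_le
          (hconv _ (half_pos hd) x hx y hy (half_lt_self hd))
      det_pos := fun x hx => by
        rw [hdet' x hx]; exact hlam.trans_le (hbd x hx).1 }
  have hunit : MA.UnitSol lam Lam σ u Du D2u :=
    { sol := hsol
      convexity := hconv
      lower := fun x hx => by rw [hdet' x hx]; exact (hbd x hx).1
      upper := fun x hx => by rw [hdet' x hx]; exact (hbd x hx).2 }
  have hlog : ∀ x ∈ ball (0 : EuclideanSpace ℝ (Fin n)) 1,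
      Real.log lam ≤ Real.log (B (x, u x, Du x)) ∧
        Real.log (B (x, u x, Du x)) ≤ Real.log Lam := fun x hx =>
    ⟨Real.log_le_log hlam (hbd x hx).1,
      Real.log_le_log (hlam.trans_le (hbd x hx).1) (hbd x hx).2⟩
  refine hmain u Du D2u hunit _ (MA.modCont_monotone hlog) MA.modCont_nonneg ?_ x hx y hy
  intro x hx y hy
  rw [hdet' x hx, hdet' y hy]
  have := (abs_le.1 (MA.abs_sub_le_modCont hlog hx hy)).2
  linarith
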